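/- (Minimax rate for Gaussian mean matrix estimation under submatrix sparsity) There exist universal constants c, C > 0 such that the following holds for all integers p, m ≥ 1, 1 ≤ k ≤ p, 1 ≤ s ≤ m, and every unitarily invariant norm ‖·‖ on the space of p×m real matrices. Consider the model Y = M + Z where Z is a p×m random matrix with i.i.d. N(0,1) entries and M ∈ ℱ(k, s; p, m). Set r = min(k, s), let I_r ∈ ℝ^{p×m} be the matrix with ones in the entries (i, i) for 1 ≤ i ≤ r and zeros elsewhere, and let L = sup{ ‖A‖ : A ∈ ℱ(k, s; p, m), ‖A‖_F = 1 }. Then c · [ ‖I_r‖² (k + s) + L² ( k·log(e·p/k) + s·log(e·m/s) ) ] ≤ inf_{M̂} sup_{M ∈ ℱ(k,s;p,m)} E[ ‖M̂(M + Z) − M‖² ] ≤ C · [ ‖I_r‖² (k + s) + L² ( k·log(e·p/k) + s·log(e·m/s) ) ], where the infimum is over all measurable maps M̂ : ℝ^{p×m} → ℝ^{p×m}. -/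

import Mathlib

open MeasureTheory ProbabilityTheory Matrix
open scoped ENNReal

instance matrixMeasurableSpace {p m : ℕ} : MeasurableSpace (Matrix (Fin p) (Fin m) ℝ) :=
  MeasurableSpace.pi

/-- The law of a `p × m` random matrix with i.i.d. standard Gaussian entries. -/
noncomputable def stdGaussianMatrix (p m : ℕ) : Measure (Matrix (Fin p) (Fin m) ℝ) :=
  Measure.pi fun _ : Fin p => Measure.pi fun _ : Fin m => gaussianReal 0 1

/-- `nrm` is a norm on the space of `p × m` real matrices. -/
def IsMatrixNorm {p m : ℕ} (nrm : Matrix (Fin p) (Fin m) ℝ → ℝ) : Prop :=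
  (∀ A B, nrm (A + B) ≤ nrm A + nrm B) ∧
  (∀ (c : ℝ) A, nrm (c • A) = |c| * nrm A) ∧
  (∀ A, nrm A = 0 → A = 0)

/-- `nrm` is invariant under left and right multiplication by orthogonal matrices. -/
def IsUnitarilyInvariant {p m : ℕ} (nrm : Matrix (Fin p) (Fin m) ℝ → ℝ) : Prop :=
  ∀ (U : Matrix (Fin p) (Fin p) ℝ) (V : Matrix (Fin m) (Fin m) ℝ)
    (A : Matrix (Fin p) (Fin m) ℝ), U * Uᵀ = 1 → V * Vᵀ = 1 → nrm (U * A * V) = nrm A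

/-- The Frobenius norm of a real matrix. -/
noncomputable def frobNorm {p m : ℕ} (A : Matrix (Fin p) (Fin m) ℝ) : ℝ :=
  Real.sqrt (∑ i, ∑ j, (A i j) ^ 2)

/-- `ℱ(k, s; p, m)`: the set of `p × m` real matrices with at most `k` nonzero rows
and at most `s` nonzero columns. -/
def SubmatrixSparse (p m k s : ℕ) : Set (Matrix (Fin p) (Fin m) ℝ) :=
  {M | {i | ∃ j, M i j ≠ 0}.ncard ≤ k ∧ {j | ∃ i, M i j ≠ 0}.ncard ≤ s}

/-- The restricted Lipschitz constant
`L = sup { ‖A‖ : A ∈ ℱ(k, s; p, m), ‖A‖_F = 1 }`. -/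
noncomputable def sparseLip (p m k s : ℕ) (nrm : Matrix (Fin p) (Fin m) ℝ → ℝ) : ℝ :=
  sSup (nrm '' {A | A ∈ SubmatrixSparse p m k s ∧ frobNorm A = 1})

/-- The `p × m` matrix with ones in the entries `(i, i)` for `i < r` and zeros elsewhere. -/
def Imat (p m r : ℕ) : Matrix (Fin p) (Fin m) ℝ :=
  Matrix.of fun i j => if (i : ℕ) = (j : ℕ) ∧ (i : ℕ) < r then 1 else 0

/-- One-dimensional Brunn–Minkowski inequality for midpoints. -/
theorem volume_add_le_two_mul_of_midpoint_mem {A B C : Set ℝ} (hA : MeasurableSet A)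
    (hB : MeasurableSet B) (hA0 : A.Nonempty) (hB0 : B.Nonempty)
    (hC : ∀ x ∈ A, ∀ y ∈ B, (x + y) / 2 ∈ C) :
    volume A + volume B ≤ 2 * volume C := by
  have key : ∀ K ⊆ A, ∀ K' ⊆ B, IsCompact K → IsCompact K' → K.Nonempty → K'.Nonempty →
      volume K + volume K' ≤ 2 * volume C := by
    intro K hKA K' hKB hK hK' hKn hKn'
    obtain ⟨a, haK, ha⟩ := hK.exists_isGreatest hKn
    obtain ⟨b, hbK, hb⟩ := hK'.exists_isLeast hKn'
    set S : Set ℝ := (fun x => x + b) '' K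
    set T : Set ℝ := (fun x => x + a) '' K'
    have hS : volume S = volume K := by
      simp [S, Set.image_add_right]
    have hT : volume T = volume K' := by
      simp [T, Set.image_add_right]
    have hTm : MeasurableSet T := (hK'.image (by fun_prop)).measurableSet
    have hST0 : volume (S ∩ T) = 0 := by
      refine measure_mono_null (t := {a + b}) ?_ (by simp)
      rintro _ ⟨⟨x, hx, rfl⟩, ⟨y, hy, h⟩⟩
      have h1 := ha hx
      have h2 := hb hy
      simp only [Set.mem_singleton_iff] at *
      linarith
    have h1 : volume S + volume T = volume (S ∪ T) := by
      rw [← measure_union_add_inter S hTm, hST0, add_zero]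
    have h2 : S ∪ T ⊆ (fun x => x / 2) ⁻¹' C := by
      rintro _ (⟨x, hx, rfl⟩ | ⟨y, hy, rfl⟩)
      · exact hC x (hKA hx) b (hKB hbK)
      · have := hC a (hKA haK) y (hKB hy)
        simpa [add_comm] using this
    have h3 : volume ((fun x : ℝ => x / 2) ⁻¹' C) = 2 * volume C := by
      have := Real.volume_preimage_mul_right (a := (2 : ℝ)⁻¹) (by norm_num) C
      simp [div_eq_mul_inv]
    calc volume K + volume K' = volume (S ∪ T) := by rw [← h1, hS, hT]
      _ ≤ _ := measure_mono h2
      _ = _ := h3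
  obtain ⟨a, ha⟩ := hA0
  obtain ⟨b, hb⟩ := hB0
  rw [hA.measure_eq_iSup_isCompact, hB.measure_eq_iSup_isCompact]
  simp_rw [iSup_and']
  refine ENNReal.biSup_add_biSup_le' (p := fun K => K ⊆ A ∧ IsCompact K)
    (q := fun K => K ⊆ B ∧ IsCompact K) ⟨∅, Set.empty_subset _, isCompact_empty⟩
    ⟨∅, Set.empty_subset _, isCompact_empty⟩ ?_
  rintro K ⟨hKA, hK⟩ K' ⟨hKB, hK'⟩
  calc volume K + volume K' ≤ volume (insert a K) + volume (insert b K') := by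
        gcongr <;> exact Set.subset_insert _ _
    _ ≤ _ := key _ (Set.insert_subset ha hKA) _ (Set.insert_subset hb hKB) (hK.insert a)
        (hK'.insert b) ⟨a, Set.mem_insert _ _⟩ ⟨b, Set.mem_insert _ _⟩

theorem ENNReal.mul_le_sq_of_add_le_two_mul {a b c : ℝ≥0∞} (h : a + b ≤ 2 * c) :
    a * b ≤ c ^ 2 := by
  rcases eq_or_ne c ⊤ with rfl | hc
  · simp
  have hab : a + b ≠ ⊤ := ne_top_of_le_ne_top (by finiteness) h
  lift c to NNReal using hc
  lift a to NNReal using ne_top_of_le_ne_top hab le_self_add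
  lift b to NNReal using ne_top_of_le_ne_top hab le_add_self
  norm_cast at h ⊢
  rw [← NNReal.coe_le_coe] at h ⊢
  push_cast at h ⊢
  nlinarith [sq_nonneg ((a : ℝ) - b), a.2, b.2, c.2, mul_self_le_mul_self (add_nonneg a.2 b.2) h]

/-- Prékopa–Leindler on the line, normalised: both functions have supremum one. -/
theorem lintegral_mul_lintegral_le_sq_of_sup_eq_one {f g h : ℝ → ℝ} (hf : Measurable f)
    (hg : Measurable g) (hh : Measurable h) (hf0 : 0 ≤ f) (hg0 : 0 ≤ g) (hh0 : 0 ≤ h)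
    (hf1 : ∀ x, f x ≤ 1) (hg1 : ∀ x, g x ≤ 1) (hf1' : ∀ t < 1, ∃ x, t < f x)
    (hg1' : ∀ t < 1, ∃ x, t < g x) (H : ∀ x y, f x * g y ≤ h ((x + y) / 2) ^ 2) :
    (∫⁻ x, ENNReal.ofReal (f x)) * (∫⁻ x, ENNReal.ofReal (g x)) ≤
      (∫⁻ x, ENNReal.ofReal (h x)) ^ 2 := by
  apply ENNReal.mul_le_sq_of_add_le_two_mul
  rw [lintegral_eq_lintegral_meas_lt _ (.of_forall hf0) hf.aemeasurable,
    lintegral_eq_lintegral_meas_lt _ (.of_forall hg0) hg.aemeasurable,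
    lintegral_eq_lintegral_meas_lt _ (.of_forall hh0) hh.aemeasurable]
  have hm : ∀ u : ℝ → ℝ, Measurable fun t => volume {a : ℝ | t < u a} := fun u =>
    Antitone.measurable fun s t hst => measure_mono fun x hx => lt_of_le_of_lt hst hx
  rw [← lintegral_add_left (hm f), ← lintegral_const_mul _ (hm h)]
  refine setLIntegral_mono ((hm h).const_mul _) fun t ht => ?_
  have ht : 0 < t := ht
  rcases lt_or_ge t 1 with h1 | h1
  · refine volume_add_le_two_mul_of_midpoint_mem (hf measurableSet_Ioi)
      (hg measurableSet_Ioi) (hf1' t h1) (hg1' t h1) ?_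
    intro x hx y hy
    have hx : t < f x := hx
    have hy : t < g y := hy
    have : t ^ 2 < h ((x + y) / 2) ^ 2 := lt_of_lt_of_le (by nlinarith) (H x y)
    exact lt_of_pow_lt_pow_left₀ 2 (hh0 _) this
  · have h2 : {a : ℝ | t < f a} = ∅ := by
      ext x; simpa using (hf1 x).trans h1
    have h3 : {a : ℝ | t < g a} = ∅ := by
      ext x; simpa using (hg1 x).trans h1
    simp [h2, h3]

/-- Prékopa–Leindler on the line for bounded functions. -/
theorem lintegral_mul_lintegral_le_sq {f g h : ℝ → ℝ} (hf : Measurable f)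
    (hg : Measurable g) (hh : Measurable h) (hf0 : 0 ≤ f) (hg0 : 0 ≤ g) (hh0 : 0 ≤ h)
    (hfb : BddAbove (Set.range f)) (hgb : BddAbove (Set.range g))
    (H : ∀ x y, f x * g y ≤ h ((x + y) / 2) ^ 2) :
    (∫⁻ x, ENNReal.ofReal (f x)) * (∫⁻ x, ENNReal.ofReal (g x)) ≤
      (∫⁻ x, ENNReal.ofReal (h x)) ^ 2 := by
  set a := ⨆ x, f x with ha
  set b := ⨆ x, g x with hb
  have hfa : ∀ x, f x ≤ a := le_ciSup hfb
  have hgb' : ∀ x, g x ≤ b := le_ciSup hgb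
  rcases (Real.iSup_nonneg hf0 : 0 ≤ a).eq_or_lt with ha0 | ha0
  · have : ∀ x, f x = 0 := fun x => le_antisymm ((hfa x).trans ha0.symm.le) (hf0 x)
    simp [this]
  rcases (Real.iSup_nonneg hg0 : 0 ≤ b).eq_or_lt with hb0 | hb0
  · have : ∀ x, g x = 0 := fun x => le_antisymm ((hgb' x).trans hb0.symm.le) (hg0 x)
    simp [this]
  have hsup : ∀ (u : ℝ → ℝ), 0 < (⨆ x, u x) → ∀ t < 1, ∃ x, t < u x / ⨆ x, u x := by
    intro u hu t ht
    obtain ⟨x, hx⟩ := exists_lt_of_lt_ciSup (show t * (⨆ x, u x) < ⨆ x, u x by nlinarith)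
    exact ⟨x, by rwa [lt_div_iff₀ hu]⟩
  have key := lintegral_mul_lintegral_le_sq_of_sup_eq_one (f := fun x => f x / a)
    (g := fun x => g x / b) (h := fun x => h x / √(a * b)) (by fun_prop) (by fun_prop)
    (by fun_prop) (fun x => div_nonneg (hf0 x) ha0.le) (fun x => div_nonneg (hg0 x) hb0.le)
    (fun x => div_nonneg (hh0 x) (Real.sqrt_nonneg _))
    (fun x => div_le_one_of_le₀ (hfa x) ha0.le) (fun x => div_le_one_of_le₀ (hgb' x) hb0.le)
    (hsup f ha0) (hsup g hb0) (by
      intro x y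
      rw [div_pow, Real.sq_sqrt (by positivity), div_mul_div_comm]
      gcongr
      exact H x y)
  have hsc : ∀ (u : ℝ → ℝ) (c : ℝ), 0 < c → Measurable u →
      ∫⁻ x, ENNReal.ofReal (u x) = ENNReal.ofReal c * ∫⁻ x, ENNReal.ofReal (u x / c) := by
    intro u c hc hu
    rw [← lintegral_const_mul _ (by fun_prop)]
    congr with x
    rw [← ENNReal.ofReal_mul hc.le, mul_div_cancel₀ _ hc.ne']
  rw [hsc f a ha0 hf, hsc g b hb0 hg, hsc h (√(a * b)) (by positivity) hh, mul_pow,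
    ← ENNReal.ofReal_pow (by positivity), Real.sq_sqrt (by positivity), mul_mul_mul_comm,
    ← ENNReal.ofReal_mul ha0.le]
  gcongr

/-- Functional form of Gaussian-type concentration (Maurey's property) of a measure with
respect to a cost function. -/
def TransportProp {α : Type*} [MeasurableSpace α] (μ : Measure α) (c : α → α → ℝ) : Prop :=
  ∀ f g : α → ℝ≥0∞, Measurable f → Measurable g →
    (∀ x y, f x * g y ≤ ENNReal.ofReal (Real.exp (c x y))) →
    (∫⁻ x, f x ∂μ) * (∫⁻ x, g x ∂μ) ≤ 1

theorem lintegral_eq_iSup_min {α : Type*} [MeasurableSpace α] (μ : Measure α) {f : α → ℝ≥0∞}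
    (hf : Measurable f) : ∫⁻ x, f x ∂μ = ⨆ n : ℕ, ∫⁻ x, min (f x) n ∂μ := by
  rw [← lintegral_iSup (fun n => by fun_prop)]
  · congr with x
    rw [← inf_iSup_eq, ENNReal.iSup_natCast, inf_top_eq]
  · intro n n' h x
    dsimp
    gcongr

theorem transportProp_gaussianReal :
    TransportProp (gaussianReal 0 1) fun x y => (x - y) ^ 2 / 4 := by
  intro f g hf hg H
  rw [lintegral_eq_iSup_min _ hf, lintegral_eq_iSup_min _ hg, ENNReal.iSup_mul]
  refine iSup_le fun n => ?_
  rw [ENNReal.mul_iSup]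
  refine iSup_le fun n' => ?_
  have hφ : ∀ u : ℝ → ℝ≥0∞, Measurable u → ∀ n : ℕ,
      ∫⁻ x, min (u x) n ∂(gaussianReal 0 1) =
      ∫⁻ x, ENNReal.ofReal ((min (u x) n).toReal * gaussianPDFReal 0 1 x) := by
    intro u hu n
    rw [gaussianReal_of_var_ne_zero _ one_ne_zero,
      lintegral_withDensity_eq_lintegral_mul _ (measurable_gaussianPDF _ _) (by fun_prop)]
    congr with x
    rw [ENNReal.ofReal_mul ENNReal.toReal_nonneg, ENNReal.ofReal_toReal, mul_comm]
    · rfl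
    · exact ne_top_of_le_ne_top (ENNReal.natCast_ne_top n) (min_le_right _ _)
  rw [hφ f hf, hφ g hg]
  have hone : (1 : ℝ≥0∞) = (∫⁻ x, ENNReal.ofReal (gaussianPDFReal 0 1 x)) ^ 2 := by
    have := lintegral_gaussianPDFReal_eq_one 0 (v := 1) one_ne_zero
    rw [this, one_pow]
  rw [hone]
  have hb : ∀ (u : ℝ → ℝ≥0∞) (n : ℕ),
      BddAbove (Set.range fun x => (min (u x) n).toReal * gaussianPDFReal 0 1 x) := by
    intro u n
    refine ⟨n * (√(2 * Real.pi * 1))⁻¹, ?_⟩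
    rintro _ ⟨x, rfl⟩
    have h1 : (min (u x) n).toReal ≤ n :=
      ENNReal.toReal_le_of_le_ofReal (by positivity) (by simp)
    have h2 : gaussianPDFReal 0 1 x ≤ (√(2 * Real.pi * 1))⁻¹ := by
      rw [gaussianPDFReal]
      refine mul_le_of_le_one_right (by positivity) (Real.exp_le_one_iff.2 ?_)
      have := sq_nonneg (x - 0)
      simp only [NNReal.coe_one]
      linarith
    exact mul_le_mul h1 h2 (gaussianPDFReal_nonneg _ _ _) (by positivity)
  refine lintegral_mul_lintegral_le_sq ?_ ?_ (measurable_gaussianPDFReal _ _) ?_ ?_ ?_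
    (hb f n) (hb g n') ?_
  · exact (hf.min measurable_const).ennreal_toReal.mul (measurable_gaussianPDFReal _ _)
  · exact (hg.min measurable_const).ennreal_toReal.mul (measurable_gaussianPDFReal _ _)
  · exact fun x => mul_nonneg ENNReal.toReal_nonneg (gaussianPDFReal_nonneg _ _ _)
  · exact fun x => mul_nonneg ENNReal.toReal_nonneg (gaussianPDFReal_nonneg _ _ _)
  · exact fun x => gaussianPDFReal_nonneg _ _ _
  · intro x y
    have h1 : (min (f x) n).toReal * (min (g y) n').toReal ≤ Real.exp ((x - y) ^ 2 / 4) := by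
      rw [← ENNReal.toReal_mul]
      refine ENNReal.toReal_le_of_le_ofReal (Real.exp_nonneg _) (le_trans ?_ (H x y))
      gcongr <;> exact min_le_left _ _
    have h2 : Real.exp ((x - y) ^ 2 / 4) * (gaussianPDFReal 0 1 x * gaussianPDFReal 0 1 y) =
        gaussianPDFReal 0 1 ((x + y) / 2) ^ 2 := by
      simp only [gaussianPDFReal, sub_zero, NNReal.coe_one, mul_one]
      rw [mul_pow, ← Real.exp_nat_mul, mul_mul_mul_comm, ← Real.exp_add, mul_left_comm,
        ← Real.exp_add]
      congr 1
      · ring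
      · congr 1
        push_cast
        ring
    calc _ = (min (f x) n).toReal * (min (g y) n').toReal *
          (gaussianPDFReal 0 1 x * gaussianPDFReal 0 1 y) := by ring
      _ ≤ _ := by
        rw [← h2]
        exact mul_le_mul_of_nonneg_right h1
          (mul_nonneg (gaussianPDFReal_nonneg _ _ _) (gaussianPDFReal_nonneg _ _ _))

theorem piFinSuccAbove_zero_symm_apply {α : Type*} [MeasurableSpace α] {n : ℕ}
    (q : α × (Fin n → α)) :
    (MeasurableEquiv.piFinSuccAbove (fun _ : Fin (n + 1) => α) 0).symm q = Fin.cons q.1 q.2 :=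
  Fin.insertNth_zero' _ _

theorem lintegral_pi_succ {α : Type*} [MeasurableSpace α] (μ : Measure α) [SigmaFinite μ]
    {n : ℕ} {f : (Fin (n + 1) → α) → ℝ≥0∞} (hf : Measurable f) :
    ∫⁻ x, f x ∂(Measure.pi fun _ : Fin (n + 1) => μ) =
      ∫⁻ a, ∫⁻ x, f (Fin.cons a x) ∂(Measure.pi fun _ : Fin n => μ) ∂μ := by
  have h := (measurePreserving_piFinSuccAbove (fun _ : Fin (n + 1) => μ) 0).symm
  rw [← h.lintegral_comp hf, lintegral_prod]
  · simp_rw [piFinSuccAbove_zero_symm_apply]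
  · exact (hf.comp h.measurable).aemeasurable

theorem measurable_finCons {α : Type*} [MeasurableSpace α] {n : ℕ} :
    Measurable fun q : α × (Fin n → α) => (Fin.cons q.1 q.2 : Fin (n + 1) → α) := by
  simp_rw [← piFinSuccAbove_zero_symm_apply]
  exact (MeasurableEquiv.piFinSuccAbove (fun _ : Fin (n + 1) => α) 0).symm.measurable

theorem TransportProp.pi {α : Type*} [MeasurableSpace α] {μ : Measure α} [SigmaFinite μ]
    {c : α → α → ℝ} (h : TransportProp μ c) (n : ℕ) :
    TransportProp (Measure.pi fun _ : Fin n => μ) fun x y => ∑ i, c (x i) (y i) := by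
  induction n with
  | zero =>
    intro f g hf hg H
    have := H Fin.elim0 Fin.elim0
    simp only [Measure.pi_of_empty (fun _ : Fin 0 => μ) Fin.elim0, lintegral_dirac]
    simpa using this
  | succ n ih =>
    intro f g hf hg H
    rw [lintegral_pi_succ μ hf, lintegral_pi_succ μ hg]
    have hf' : Measurable fun q : α × (Fin n → α) => f (Fin.cons q.1 q.2) :=
      hf.comp measurable_finCons
    have hg' : Measurable fun q : α × (Fin n → α) => g (Fin.cons q.1 q.2) :=
      hg.comp measurable_finCons
    refine h _ _ hf'.lintegral_prod_right' hg'.lintegral_prod_right' fun a b => ?_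
    have key := ih (fun x => f (Fin.cons a x))
      (fun y => ENNReal.ofReal (Real.exp (-c a b)) * g (Fin.cons b y))
      (hf'.comp measurable_prodMk_left) ((hg'.comp measurable_prodMk_left).const_mul _) (by
        intro x y
        have := H (Fin.cons a x) (Fin.cons b y)
        simp only [Fin.sum_univ_succ] at this
        simp only [Fin.cons_zero, Fin.cons_succ] at this
        calc _ = ENNReal.ofReal (Real.exp (-c a b)) * (f (Fin.cons a x) * g (Fin.cons b y)) := by
              ring
          _ ≤ ENNReal.ofReal (Real.exp (-c a b)) *
              ENNReal.ofReal (Real.exp (c a b + ∑ i, c (x i) (y i))) := by gcongr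
          _ = _ := by
            rw [← ENNReal.ofReal_mul (Real.exp_nonneg _), ← Real.exp_add,
              neg_add_cancel_left])
    have hgb : Measurable fun y => g (Fin.cons b y) := hg'.comp measurable_prodMk_left
    rw [lintegral_const_mul _ hgb] at key
    calc _ = ENNReal.ofReal (Real.exp (c a b)) * ((∫⁻ x, f (Fin.cons a x)
            ∂(Measure.pi fun _ : Fin n => μ)) * (ENNReal.ofReal (Real.exp (-c a b)) *
            ∫⁻ x, g (Fin.cons b x) ∂(Measure.pi fun _ : Fin n => μ))) := by
          rw [mul_left_comm _ (ENNReal.ofReal (Real.exp (-c a b))), ← mul_assoc,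
            ← ENNReal.ofReal_mul (Real.exp_nonneg _), ← Real.exp_add]
          simp
      _ ≤ ENNReal.ofReal (Real.exp (c a b)) * 1 := by gcongr
      _ = _ := mul_one _

/-- Translations of `μ` are absolutely continuous with density `exp (d a ·)`. -/
def ShiftProp {α : Type*} [MeasurableSpace α] [Add α] (μ : Measure α) (d : α → α → ℝ) : Prop :=
  ∀ a, Measurable (d a) ∧ ∀ f : α → ℝ≥0∞, Measurable f →
    ∫⁻ x, f (a + x) ∂μ = ∫⁻ x, ENNReal.ofReal (Real.exp (d a x)) * f x ∂μ

theorem shiftProp_gaussianReal :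
    ShiftProp (gaussianReal 0 1) fun a x => a * x - a ^ 2 / 2 := by
  intro a
  refine ⟨by fun_prop, fun f hf => ?_⟩
  rw [← lintegral_map (μ := gaussianReal 0 1) (g := fun x => a + x) hf (by fun_prop),
    gaussianReal_map_const_add, zero_add, gaussianReal_of_var_ne_zero _ one_ne_zero,
    gaussianReal_of_var_ne_zero _ one_ne_zero,
    lintegral_withDensity_eq_lintegral_mul _ (measurable_gaussianPDF _ _) (by fun_prop),
    lintegral_withDensity_eq_lintegral_mul _ (measurable_gaussianPDF _ _) (by fun_prop)]
  congr with x
  simp only [Pi.mul_apply, ← mul_assoc]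
  congr 1
  simp only [gaussianPDF, gaussianPDFReal]
  rw [← ENNReal.ofReal_mul (by positivity), mul_assoc (√_)⁻¹, ← Real.exp_add]
  congr 3
  simp only [NNReal.coe_one]
  ring

theorem ShiftProp.pi {α : Type*} [MeasurableSpace α] [Add α] [MeasurableAdd α] {μ : Measure α}
    [SigmaFinite μ] {d : α → α → ℝ} (h : ShiftProp μ d) (n : ℕ) :
    ShiftProp (Measure.pi fun _ : Fin n => μ) fun a x => ∑ i, d (a i) (x i) := by
  intro a
  have hm : Measurable fun x : Fin n → α => ∑ i, d (a i) (x i) :=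
    Finset.measurable_sum _ fun i _ => (h (a i)).1.comp (measurable_pi_apply i)
  refine ⟨hm, ?_⟩
  induction n with
  | zero =>
    intro f hf
    simp only [Measure.pi_of_empty (fun _ : Fin 0 => μ) Fin.elim0, lintegral_dirac]
    simp [Subsingleton.elim (a + Fin.elim0) Fin.elim0]
  | succ n ih =>
    intro f hf
    have hm' : Measurable fun x : Fin n → α => ∑ i : Fin n, d (a i.succ) (x i) :=
      Finset.measurable_sum _ fun i _ => (h (a i.succ)).1.comp (measurable_pi_apply i)
    have hf' : Measurable fun q : α × (Fin n → α) => f (Fin.cons q.1 q.2) :=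
      hf.comp measurable_finCons
    have hadd : Measurable fun x : Fin (n + 1) → α => a + x :=
      measurable_pi_lambda _ fun i => (measurable_const_add (a i)).comp (measurable_pi_apply i)
    rw [lintegral_pi_succ μ (f := fun x => f (a + x)) (hf.comp hadd),
      lintegral_pi_succ μ (by exact (Real.measurable_exp.comp hm).ennreal_ofReal.mul hf)]
    have h1 : ∀ b : α, ∫⁻ x, f (a + Fin.cons b x) ∂(Measure.pi fun _ : Fin n => μ) =
        ∫⁻ x, ENNReal.ofReal (Real.exp (∑ i : Fin n, d (a i.succ) (x i))) *
          f (Fin.cons (a 0 + b) x) ∂(Measure.pi fun _ : Fin n => μ) := by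
      intro b
      rw [← ih (fun i => a i.succ) hm' (fun x => f (Fin.cons (a 0 + b) x))
        (hf'.comp measurable_prodMk_left)]
      congr with x
      congr 1
      ext i
      refine Fin.cases ?_ (fun i => ?_) i <;> simp
    simp_rw [h1]
    have hF : Measurable fun b => ∫⁻ x, ENNReal.ofReal (Real.exp (∑ i : Fin n, d (a i.succ) (x i))) *
          f (Fin.cons b x) ∂(Measure.pi fun _ : Fin n => μ) := by
      refine Measurable.lintegral_prod_right' (f := fun q : α × (Fin n → α) =>
        ENNReal.ofReal (Real.exp (∑ i : Fin n, d (a i.succ) (q.2 i))) * f (Fin.cons q.1 q.2)) ?_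
      exact (Real.measurable_exp.comp (hm'.comp measurable_snd)).ennreal_ofReal.mul hf'
    rw [(h (a 0)).2 _ hF]
    congr with b
    rw [← lintegral_const_mul]
    · congr with x
      rw [Fin.sum_univ_succ]
      simp only [Fin.cons_zero, Fin.cons_succ]
      rw [Real.exp_add, ENNReal.ofReal_mul (Real.exp_nonneg _), mul_assoc]
    · exact (Real.measurable_exp.comp hm').ennreal_ofReal.mul (hf'.comp measurable_prodMk_left)

/-- Coordinatewise application of maps preserving `μ × μ` preserves `μⁿ × μⁿ`. -/
theorem measurePreserving_pi_prod_pi {α : Type*} [MeasurableSpace α] {μ : Measure α}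
    [IsProbabilityMeasure μ] {ι : Type*} [Fintype ι] (τ : ι → α × α → α × α)
    (h : ∀ i, MeasurePreserving (τ i) (μ.prod μ) (μ.prod μ)) :
    MeasurePreserving (fun q : (ι → α) × (ι → α) =>
        ((fun i => (τ i (q.1 i, q.2 i)).1, fun i => (τ i (q.1 i, q.2 i)).2) :
          (ι → α) × (ι → α)))
      ((Measure.pi fun _ => μ).prod (Measure.pi fun _ => μ))
      ((Measure.pi fun _ => μ).prod (Measure.pi fun _ => μ)) := by
  have e := measurePreserving_arrowProdEquivProdArrow α α ι (fun _ => μ) (fun _ => μ)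
  exact (e.comp (measurePreserving_pi _ _ h)).comp e.symm

instance isProbabilityMeasure_stdGaussianMatrix (p m : ℕ) :
    IsProbabilityMeasure (stdGaussianMatrix p m) :=
  inferInstanceAs (IsProbabilityMeasure
    (Measure.pi fun _ : Fin p => Measure.pi fun _ : Fin m => gaussianReal 0 1))

theorem frobNorm_sq {p m : ℕ} (A : Matrix (Fin p) (Fin m) ℝ) :
    frobNorm A ^ 2 = ∑ i, ∑ j, A i j ^ 2 :=
  Real.sq_sqrt (Finset.sum_nonneg fun _ _ => Finset.sum_nonneg fun _ _ => sq_nonneg _)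

theorem frobNorm_nonneg {p m : ℕ} (A : Matrix (Fin p) (Fin m) ℝ) : 0 ≤ frobNorm A :=
  Real.sqrt_nonneg _

theorem frobNorm_smul {p m : ℕ} (c : ℝ) (A : Matrix (Fin p) (Fin m) ℝ) :
    frobNorm (c • A) = |c| * frobNorm A := by
  rw [← sq_eq_sq₀ (frobNorm_nonneg _) (mul_nonneg (abs_nonneg _) (frobNorm_nonneg _)), mul_pow,
    frobNorm_sq, frobNorm_sq, sq_abs]
  simp [mul_pow, Finset.mul_sum]

/-- The entrywise inner product of matrices. -/
def frobInner {p m : ℕ} (A B : Matrix (Fin p) (Fin m) ℝ) : ℝ := ∑ i, ∑ j, A i j * B i j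

theorem measurable_entry {p m : ℕ} (i : Fin p) (j : Fin m) :
    Measurable fun z : Matrix (Fin p) (Fin m) ℝ => z i j :=
  (measurable_pi_apply j).comp (measurable_pi_apply i)

theorem measurable_of_entries {p m : ℕ} {α : Type*} [MeasurableSpace α]
    {f : α → Matrix (Fin p) (Fin m) ℝ} (h : ∀ i j, Measurable fun x => f x i j) :
    Measurable f :=
  measurable_pi_lambda _ fun i => measurable_pi_lambda _ fun j => h i j

theorem measurable_frobInner {p m : ℕ} (A : Matrix (Fin p) (Fin m) ℝ) :
    Measurable (frobInner A) :=
  Finset.measurable_sum _ fun i _ => Finset.measurable_sum _ fun j _ =>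
    (measurable_entry i j).const_mul _

theorem transportProp_stdGaussianMatrix (p m : ℕ) :
    TransportProp (stdGaussianMatrix p m) fun x y => frobNorm (x - y) ^ 2 / 4 := by
  have h := (transportProp_gaussianReal.pi m).pi p
  have e : ∀ x y : Matrix (Fin p) (Fin m) ℝ,
      frobNorm (x - y) ^ 2 / 4 = ∑ i, ∑ j, (x i j - y i j) ^ 2 / 4 := by
    intro x y
    rw [frobNorm_sq, Finset.sum_div]
    simp_rw [Finset.sum_div]
    rfl
  simp_rw [e]
  exact h

theorem lintegral_stdGaussianMatrix_add {p m : ℕ} (A : Matrix (Fin p) (Fin m) ℝ)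
    {f : Matrix (Fin p) (Fin m) ℝ → ℝ≥0∞} (hf : Measurable f) :
    ∫⁻ z, f (A + z) ∂(stdGaussianMatrix p m) =
      ∫⁻ z, ENNReal.ofReal (Real.exp (frobInner A z - frobNorm A ^ 2 / 2)) * f z
        ∂(stdGaussianMatrix p m) := by
  have h := (((shiftProp_gaussianReal.pi m).pi p) A).2 f hf
  have e : ∀ z, frobInner A z - frobNorm A ^ 2 / 2 =
      ∑ i, ∑ j, (A i j * z i j - A i j ^ 2 / 2) := by
    intro z
    rw [frobNorm_sq, Finset.sum_div, frobInner, ← Finset.sum_sub_distrib]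
    simp_rw [Finset.sum_div, ← Finset.sum_sub_distrib]
  simp_rw [e]
  exact h

theorem lintegral_exp_frobInner {p m : ℕ} (A : Matrix (Fin p) (Fin m) ℝ) :
    ∫⁻ z, ENNReal.ofReal (Real.exp (frobInner A z)) ∂(stdGaussianMatrix p m) =
      ENNReal.ofReal (Real.exp (frobNorm A ^ 2 / 2)) := by
  have h := lintegral_stdGaussianMatrix_add A (f := fun _ => 1) measurable_const
  simp only [lintegral_const, measure_univ, mul_one] at h
  calc _ = ∫⁻ z, ENNReal.ofReal (Real.exp (frobNorm A ^ 2 / 2)) *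
        ENNReal.ofReal (Real.exp (frobInner A z - frobNorm A ^ 2 / 2))
          ∂(stdGaussianMatrix p m) := by
        congr with z
        rw [← ENNReal.ofReal_mul (Real.exp_nonneg _), ← Real.exp_add]
        ring_nf
    _ = _ := by
      rw [lintegral_const_mul, ← h, mul_one]
      exact (Real.measurable_exp.comp ((measurable_frobInner A).sub_const _)).ennreal_ofReal

theorem measurePreserving_neg_stdGaussianMatrix (p m : ℕ) :
    MeasurePreserving (fun z : Matrix (Fin p) (Fin m) ℝ => -z) (stdGaussianMatrix p m)
      (stdGaussianMatrix p m) := by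
  have h1 : MeasurePreserving (fun x : ℝ => -x) (gaussianReal 0 1) (gaussianReal 0 1) :=
    ⟨measurable_neg, by simpa using gaussianReal_map_neg (μ := 0) (v := 1)⟩
  exact measurePreserving_pi _ _ fun _ : Fin p =>
    measurePreserving_pi (fun _ : Fin m => gaussianReal 0 1) _ fun _ => h1

theorem lintegral_entry_sq_stdGaussianMatrix {p m : ℕ} (i : Fin p) (j : Fin m) :
    ∫⁻ z, ENNReal.ofReal (z i j ^ 2) ∂(stdGaussianMatrix p m) = 1 := by
  have h1 : MeasurePreserving (fun z : Matrix (Fin p) (Fin m) ℝ => z i j)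
      (stdGaussianMatrix p m) (gaussianReal 0 1) :=
    (measurePreserving_eval (fun _ : Fin m => gaussianReal 0 1) j).comp
      (measurePreserving_eval (fun _ : Fin p => Measure.pi fun _ : Fin m => gaussianReal 0 1) i)
  rw [h1.lintegral_comp (f := fun x => ENNReal.ofReal (x ^ 2)) (by fun_prop),
    ← ofReal_integral_eq_lintegral_ofReal _ (.of_forall fun x => sq_nonneg x)]
  · have h := variance_id_gaussianReal (μ := 0) (v := 1)
    rw [variance_of_integral_eq_zero aemeasurable_id (by simp)] at h
    simp at h
    simp [h]
  · exact (memLp_id_gaussianReal 2).integrable_sq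

/-- Exchange of two matrices on the entries selected by `S`. -/
theorem measurePreserving_swap_stdGaussianMatrix {p m : ℕ} (S : Fin p → Fin m → Prop)
    [∀ i j, Decidable (S i j)] :
    MeasurePreserving
      (fun q : Matrix (Fin p) (Fin m) ℝ × Matrix (Fin p) (Fin m) ℝ =>
        ((Matrix.of fun i j => if S i j then q.2 i j else q.1 i j,
          Matrix.of fun i j => if S i j then q.1 i j else q.2 i j) :
          Matrix (Fin p) (Fin m) ℝ × Matrix (Fin p) (Fin m) ℝ))
      ((stdGaussianMatrix p m).prod (stdGaussianMatrix p m))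
      ((stdGaussianMatrix p m).prod (stdGaussianMatrix p m)) := by
  have h0 := measurePreserving_pi_prod_pi (ι := Fin p)
    (μ := Measure.pi fun _ : Fin m => gaussianReal 0 1) _ fun i =>
      measurePreserving_pi_prod_pi (ι := Fin m) (μ := gaussianReal 0 1)
        (fun j => if S i j then Prod.swap else id) (fun j => by
          split_ifs
          · exact Measure.measurePreserving_swap
          · exact MeasurePreserving.id _)
  have h : MeasurePreserving
      (fun q : (Fin p → Fin m → ℝ) × (Fin p → Fin m → ℝ) =>
        ((fun i j => if S i j then q.2 i j else q.1 i j,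
          fun i j => if S i j then q.1 i j else q.2 i j) :
          (Fin p → Fin m → ℝ) × (Fin p → Fin m → ℝ)))
      ((Measure.pi fun _ : Fin p => Measure.pi fun _ : Fin m => gaussianReal 0 1).prod
        (Measure.pi fun _ : Fin p => Measure.pi fun _ : Fin m => gaussianReal 0 1))
      ((Measure.pi fun _ : Fin p => Measure.pi fun _ : Fin m => gaussianReal 0 1).prod
        (Measure.pi fun _ : Fin p => Measure.pi fun _ : Fin m => gaussianReal 0 1)) := by
    convert h0 using 1
    funext q
    ext i j <;> by_cases hS : S i j <;> simp [hS]
  exact h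

/-- The `p × m` matrix with diagonal `d`. -/
def rectDiag (p m : ℕ) (d : ℕ → ℝ) : Matrix (Fin p) (Fin m) ℝ :=
  Matrix.of fun i j => if (i : ℕ) = (j : ℕ) then d i else 0

theorem exists_svd {p m : ℕ} (A : Matrix (Fin p) (Fin m) ℝ) :
    ∃ (U : Matrix (Fin p) (Fin p) ℝ) (V : Matrix (Fin m) (Fin m) ℝ) (d : ℕ → ℝ),
      U * Uᵀ = 1 ∧ V * Vᵀ = 1 ∧ (∀ l, 0 ≤ d l) ∧ Antitone d ∧ (∀ l, A.rank ≤ l → d l = 0) ∧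
      A = U * rectDiag p m d * V := by
  classical
  set T : EuclideanSpace ℝ (Fin m) →ₗ[ℝ] EuclideanSpace ℝ (Fin p) := Matrix.toLpLin 2 2 A with hT
  have hrank : Module.finrank ℝ T.range = A.rank := by
    rw [Matrix.rank_eq_finrank_range_toLin A (EuclideanSpace.basisFun (Fin p) ℝ).toBasis
      (EuclideanSpace.basisFun (Fin m) ℝ).toBasis]
    congr 2
  have hn : Module.finrank ℝ (EuclideanSpace ℝ (Fin m)) = m := by simp
  set b := T.isSymmetric_adjoint_comp_self.eigenvectorBasis hn with hb
  set d : ℕ → ℝ := fun l => T.singularValues l with hd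
  have hTT : ∀ i j, inner ℝ (T (b i)) (T (b j)) = if i = j then d j ^ 2 else 0 := by
    intro i j
    have h1 : (LinearMap.adjoint T ∘ₗ T) (b j) = (d j ^ 2) • b j := by
      rw [hd, T.sq_singularValues_fin hn]
      simpa [hb, -LinearMap.IsSymmetric.apply_eigenvectorBasis] using T.isSymmetric_adjoint_comp_self.apply_eigenvectorBasis hn j
    rw [← LinearMap.adjoint_inner_right]
    change inner ℝ (b i) ((LinearMap.adjoint T ∘ₗ T) (b j)) = _
    rw [h1, inner_smul_right, b.inner_eq_ite]
    split_ifs <;> simp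
  have hd0 : ∀ l, A.rank ≤ l → d l = 0 := fun l hl =>
    (T.singularValues_eq_zero_iff_le_finrank_range).2 (hrank.trans_le hl)
  have hT0 : ∀ j : Fin m, A.rank ≤ j → T (b j) = 0 := by
    intro j hj
    have := hTT j j
    rw [hd0 _ hj] at this
    simpa using this
  have hrm : A.rank ≤ m := by simpa using A.rank_le_width
  have hrp : A.rank ≤ p := by simpa using A.rank_le_height
  have hpos : ∀ l, l < A.rank → 0 < d l := fun l hl =>
    T.singularValues_pos_iff_lt_finrank_range.2 (hrank ▸ hl)
  set s : Set (Fin p) := {i | (i : ℕ) < A.rank}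
  set v : Fin p → EuclideanSpace ℝ (Fin p) := fun i =>
    if h : (i : ℕ) < m then (d i)⁻¹ • T (b ⟨i, h⟩) else 0 with hv
  have hvo : Orthonormal ℝ (s.domRestrict v) := by
    rw [orthonormal_iff_ite]
    rintro ⟨i, hi⟩ ⟨j, hj⟩
    have hi' : (i : ℕ) < m := lt_of_lt_of_le hi hrm
    have hj' : (j : ℕ) < m := lt_of_lt_of_le hj hrm
    have h1 := hpos i hi
    have h2 := hpos j hj
    simp only [Set.domRestrict_apply, hv, hi', hj', dif_pos, inner_smul_left, inner_smul_right,
      hTT, Fin.mk.injEq, Subtype.mk.injEq, Fin.val_inj]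
    split_ifs with h
    · subst h
      simp
      field_simp
    · simp
  obtain ⟨u, hu⟩ := hvo.exists_orthonormalBasis_extension_of_card_eq (by simp)
  have hUV : ∀ {n : ℕ} (w : OrthonormalBasis (Fin n) ℝ (EuclideanSpace ℝ (Fin n))),
      (Matrix.of fun i a => w i a) * (Matrix.of fun i a => w i a)ᵀ = 1 := by
    intro n w
    ext i j
    have := w.inner_eq_ite i j
    rw [PiLp.inner_apply] at this
    simp only [Matrix.mul_apply, Matrix.transpose_apply, Matrix.of_apply, Matrix.one_apply]
    rw [← this]
    simp [mul_comm]
  refine ⟨(Matrix.of fun i a => u i a)ᵀ, Matrix.of fun i a => b i a, d, ?_, hUV b,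
    T.singularValues_nonneg, T.singularValues_antitone, hd0, ?_⟩
  · rw [Matrix.transpose_transpose]
    exact mul_eq_one_comm.1 (hUV u)
  have key : A * (Matrix.of fun i a => b i a)ᵀ =
      (Matrix.of fun i a => u i a)ᵀ * rectDiag p m d := by
    ext a j
    have h1 : (A * (Matrix.of fun i a => b i a)ᵀ) a j = T (b j) a := by
      simp [hT, Matrix.toLpLin_apply, Matrix.mul_apply, Matrix.mulVec, dotProduct]
    rw [h1]
    simp only [Matrix.mul_apply, Matrix.transpose_apply, Matrix.of_apply, rectDiag]
    by_cases hj : (j : ℕ) < A.rank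
    · rw [Finset.sum_eq_single ⟨j, hj.trans_le hrp⟩]
      · have := hu ⟨j, hj.trans_le hrp⟩ (by simpa [s] using hj)
        rw [this]
        have := (hpos j hj).ne'
        simp [hv]
        field_simp
      · rintro i - hij
        rw [if_neg, mul_zero]
        contrapose hij
        exact Fin.ext hij
      · simp
    · rw [hT0 j (not_lt.1 hj)]
      symm
      apply Finset.sum_eq_zero
      intro i _
      split_ifs with h
      · rw [h, hd0 _ (not_lt.1 hj), mul_zero]
      · simp
  rw [← key, Matrix.mul_assoc, mul_eq_one_comm.1 (hUV b), Matrix.mul_one]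

section MatrixNorm

variable {p m : ℕ} {nrm : Matrix (Fin p) (Fin m) ℝ → ℝ}

theorem IsMatrixNorm.map_zero (h : IsMatrixNorm nrm) : nrm 0 = 0 := by
  simpa using h.2.1 0 0

theorem IsMatrixNorm.map_neg (h : IsMatrixNorm nrm) (A : Matrix (Fin p) (Fin m) ℝ) :
    nrm (-A) = nrm A := by
  simpa using h.2.1 (-1) A

theorem IsMatrixNorm.nonneg (h : IsMatrixNorm nrm) (A : Matrix (Fin p) (Fin m) ℝ) :
    0 ≤ nrm A := by
  have := h.1 A (-A)
  rw [add_neg_cancel, h.map_zero, h.map_neg] at this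
  linarith

theorem IsMatrixNorm.pos (h : IsMatrixNorm nrm) {A : Matrix (Fin p) (Fin m) ℝ} (hA : A ≠ 0) :
    0 < nrm A :=
  lt_of_le_of_ne (h.nonneg A) fun h0 => hA (h.2.2 A h0.symm)

theorem IsMatrixNorm.sub_le (h : IsMatrixNorm nrm) (A B : Matrix (Fin p) (Fin m) ℝ) :
    nrm (A - B) ≤ nrm A + nrm B := by
  rw [sub_eq_add_neg, ← h.map_neg B]
  exact h.1 _ _

theorem IsMatrixNorm.sum_le (h : IsMatrixNorm nrm) {ι : Type*} (s : Finset ι)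
    (f : ι → Matrix (Fin p) (Fin m) ℝ) : nrm (∑ i ∈ s, f i) ≤ ∑ i ∈ s, nrm (f i) := by
  classical
  induction s using Finset.induction_on with
  | empty => simp [h.map_zero]
  | insert a s ha ih =>
    rw [Finset.sum_insert ha, Finset.sum_insert ha]
    linarith [h.1 (f a) (∑ i ∈ s, f i)]

theorem IsMatrixNorm.continuous (h : IsMatrixNorm nrm) : Continuous nrm := by
  have hN : ConvexOn ℝ Set.univ fun A : Fin p → Fin m → ℝ => nrm (Matrix.of A) := by
    refine ⟨convex_univ, fun A _ B _ a b ha hb _ => ?_⟩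
    have h1 := h.1 (a • Matrix.of A) (b • Matrix.of B)
    rwa [h.2.1, h.2.1, abs_of_nonneg ha, abs_of_nonneg hb] at h1
  exact continuousOn_univ.1 (ConvexOn.continuousOn isOpen_univ hN)

theorem IsMatrixNorm.measurable (h : IsMatrixNorm nrm) : Measurable nrm := by
  have : BorelSpace (Matrix (Fin p) (Fin m) ℝ) :=
    inferInstanceAs (BorelSpace (Fin p → Fin m → ℝ))
  exact h.continuous.measurable

theorem IsMatrixNorm.transpose (h : IsMatrixNorm nrm) :
    IsMatrixNorm fun B : Matrix (Fin m) (Fin p) ℝ => nrm Bᵀ := by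
  refine ⟨fun A B => ?_, fun c A => ?_, fun A hA => ?_⟩
  · simpa using h.1 Aᵀ Bᵀ
  · simpa using h.2.1 c Aᵀ
  · simpa using congrArg Matrix.transpose (h.2.2 _ hA)

theorem IsUnitarilyInvariant.transpose (h : IsUnitarilyInvariant nrm) :
    IsUnitarilyInvariant fun B : Matrix (Fin m) (Fin p) ℝ => nrm Bᵀ := by
  intro U V A hU hV
  have := h Vᵀ Uᵀ Aᵀ (by rw [transpose_transpose]; exact mul_eq_one_comm.1 hV)
    (by rw [transpose_transpose]; exact mul_eq_one_comm.1 hU)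
  simpa [Matrix.transpose_mul, Matrix.mul_assoc] using this

theorem IsUnitarilyInvariant.nrm_diagonal_mul_le (h : IsUnitarilyInvariant nrm)
    (hn : IsMatrixNorm nrm) {c : Fin p → ℝ} (hc : ∀ i, |c i| ≤ 1)
    (A : Matrix (Fin p) (Fin m) ℝ) : nrm (diagonal c * A) ≤ nrm A := by
  suffices H : ∀ s : Finset (Fin p),
      nrm (diagonal (fun i => if i ∈ s then c i else 1) * A) ≤ nrm A by
    simpa using H Finset.univ
  intro s
  induction s using Finset.induction_on with
  | empty => simp
  | insert a s ha ih =>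
    set D := diagonal (fun i => if i ∈ s then c i else 1) * A with hD
    set S : Matrix (Fin p) (Fin p) ℝ := diagonal (fun i => if i = a then -1 else 1) with hS
    have hSS : S * Sᵀ = 1 := by
      rw [hS, diagonal_transpose, diagonal_mul_diagonal, ← diagonal_one]
      congr 1
      ext i
      split_ifs <;> simp
    have e : diagonal (fun i => if i ∈ insert a s then c i else 1) * A =
        ((1 + c a) / 2) • D + ((1 - c a) / 2) • (S * D * (1 : Matrix (Fin m) (Fin m) ℝ)) := by
      ext i j
      simp only [hD, hS, Matrix.mul_one, diagonal_mul, Matrix.add_apply, Matrix.smul_apply,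
        smul_eq_mul, Finset.mem_insert]
      by_cases hia : i = a
      · subst hia
        simp [ha]
        ring
      · simp [hia]
        split_ifs <;> ring
    have h1 := abs_le.1 (hc a)
    rw [e]
    refine (hn.1 _ _).trans ?_
    rw [hn.2.1, hn.2.1, h S 1 D hSS (by simp), abs_of_nonneg (by linarith),
      abs_of_nonneg (by linarith)]
    linarith

theorem IsUnitarilyInvariant.nrm_mul_diagonal_le (h : IsUnitarilyInvariant nrm)
    (hn : IsMatrixNorm nrm) {c : Fin m → ℝ} (hc : ∀ i, |c i| ≤ 1)
    (A : Matrix (Fin p) (Fin m) ℝ) : nrm (A * diagonal c) ≤ nrm A := by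
  simpa [Matrix.transpose_mul] using h.transpose.nrm_diagonal_mul_le hn.transpose hc Aᵀ

theorem one_submatrix_mul_transpose {n : ℕ} (e f : Equiv.Perm (Fin n)) :
    (1 : Matrix (Fin n) (Fin n) ℝ).submatrix e f * ((1 : Matrix (Fin n) (Fin n) ℝ).submatrix e f)ᵀ
      = 1 := by
  rw [transpose_submatrix, submatrix_mul_equiv]
  simp

theorem IsUnitarilyInvariant.nrm_submatrix (h : IsUnitarilyInvariant nrm)
    (A : Matrix (Fin p) (Fin m) ℝ) (e : Equiv.Perm (Fin p)) (f : Equiv.Perm (Fin m)) :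
    nrm (A.submatrix e f) = nrm A := by
  rw [← h _ _ A (one_submatrix_mul_transpose e (Equiv.refl _))
    (one_submatrix_mul_transpose (Equiv.refl _) f)]
  congr 1
  have h1 : (1 : Matrix (Fin p) (Fin p) ℝ).submatrix e (Equiv.refl _) * A = A.submatrix e id := by
    have := submatrix_mul_equiv (1 : Matrix (Fin p) (Fin p) ℝ) A e (Equiv.refl _) id
    simpa using this
  rw [h1]
  have := submatrix_mul_equiv A (1 : Matrix (Fin m) (Fin m) ℝ) e (Equiv.refl _) f
  simpa using this.symm

theorem rectDiag_eq_diagonal_mul_Imat {r : ℕ} {d : ℕ → ℝ} (hd : ∀ l, r ≤ l → d l = 0) :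
    rectDiag p m d = diagonal (fun i : Fin p => d i) * Imat p m r := by
  ext i j
  simp only [rectDiag, Imat, diagonal_mul, Matrix.of_apply]
  rcases lt_or_ge (i : ℕ) r with hi | hi
  · simp [hi]
  · simp [hd _ hi]

theorem IsUnitarilyInvariant.nrm_rectDiag_le (h : IsUnitarilyInvariant nrm)
    (hn : IsMatrixNorm nrm) {r : ℕ} {d : ℕ → ℝ} {t : ℝ} (hd : ∀ l, r ≤ l → d l = 0)
    (ht : 0 ≤ t) (hdt : ∀ l, |d l| ≤ t) : nrm (rectDiag p m d) ≤ t * nrm (Imat p m r) := by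
  rcases ht.eq_or_lt with rfl | ht
  · have : rectDiag p m d = 0 := by
      ext i j
      simp [rectDiag, abs_nonpos_iff.1 (hdt i)]
    simp [this, hn.map_zero]
  have e : rectDiag p m d = t • (diagonal (fun i : Fin p => d i / t) * Imat p m r) := by
    rw [rectDiag_eq_diagonal_mul_Imat hd]
    ext i j
    simp only [diagonal_mul, Matrix.smul_apply, smul_eq_mul]
    field_simp
  rw [e, hn.2.1, abs_of_pos ht]
  gcongr
  refine h.nrm_diagonal_mul_le hn (fun i => ?_) _
  rw [abs_div, abs_of_pos ht]
  exact (div_le_one ht).2 (hdt i)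

theorem IsUnitarilyInvariant.sum_mul_nrm_Imat_le (h : IsUnitarilyInvariant nrm)
    (hn : IsMatrixNorm nrm) {r : ℕ} {d : ℕ → ℝ} (hr : 1 ≤ r) (hrp : r ≤ p) (hrm : r ≤ m)
    (hd : ∀ l, r ≤ l → d l = 0) (hd0 : ∀ l, 0 ≤ d l) :
    (∑ l : Fin r, d l) * nrm (Imat p m r) ≤ r * nrm (rectDiag p m d) := by
  have : NeZero r := ⟨by omega⟩
  set e : Fin r → Equiv.Perm (Fin p) := fun a =>
    (Equiv.addRight a : Equiv.Perm (Fin r)).viaFintypeEmbedding (Fin.castLEEmb hrp)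
  set f : Fin r → Equiv.Perm (Fin m) := fun a =>
    (Equiv.addRight a : Equiv.Perm (Fin r)).viaFintypeEmbedding (Fin.castLEEmb hrm)
  have he : ∀ (a i : Fin r), e a (Fin.castLE hrp i) = Fin.castLE hrp (i + a) := fun a i =>
    Equiv.Perm.viaFintypeEmbedding_apply_image _ _ _
  have hf : ∀ (a i : Fin r), f a (Fin.castLE hrm i) = Fin.castLE hrm (i + a) := fun a i =>
    Equiv.Perm.viaFintypeEmbedding_apply_image _ _ _
  have he' : ∀ (a : Fin r) (i : Fin p), r ≤ i → e a i = i := fun a i hi =>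
    Equiv.Perm.viaFintypeEmbedding_apply_notMem_range _ _ (by
      rintro ⟨x, rfl⟩
      simp at hi
      omega)
  have hf' : ∀ (a : Fin r) (i : Fin m), r ≤ i → f a i = i := fun a i hi =>
    Equiv.Perm.viaFintypeEmbedding_apply_notMem_range _ _ (by
      rintro ⟨x, rfl⟩
      simp at hi
      omega)
  have key : ∑ a : Fin r, (rectDiag p m d).submatrix (e a) (f a) =
      (∑ l : Fin r, d l) • Imat p m r := by
    ext i j
    simp only [Matrix.sum_apply, submatrix_apply, Matrix.smul_apply, smul_eq_mul, Imat,
      Matrix.of_apply, rectDiag]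
    rcases lt_or_ge (i : ℕ) r with hi | hi
    · obtain ⟨i, rfl⟩ : ∃ i' : Fin r, i = Fin.castLE hrp i' := ⟨⟨i, hi⟩, rfl⟩
      rcases lt_or_ge (j : ℕ) r with hj | hj
      · obtain ⟨j, rfl⟩ : ∃ j' : Fin r, j = Fin.castLE hrm j' := ⟨⟨j, hj⟩, rfl⟩
        simp only [he, hf, Fin.val_castLE, Fin.val_inj, add_left_inj]
        by_cases hij : i = j
        · subst hij
          simp only [if_true, Fin.is_lt, and_self, mul_one]
          exact Fintype.sum_equiv (Equiv.addLeft i) _ _ fun a => rfl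
        · simp [hij]
      · have : (i : ℕ) ≠ j := by omega
        simp only [he, hf' _ _ hj]
        rw [if_neg (by simpa using fun h => absurd h this), mul_zero]
        refine Finset.sum_eq_zero fun a _ => if_neg fun hh => ?_
        rw [Fin.val_castLE] at hh
        have := (i + a).2
        omega
    · simp only [he' _ _ hi]
      rw [if_neg (by omega), mul_zero]
      exact Finset.sum_eq_zero fun a _ => by rw [hd _ hi, ite_self]
  have h1 := hn.sum_le Finset.univ fun a => (rectDiag p m d).submatrix (e a) (f a)
  have h2 : 0 ≤ ∑ l : Fin r, d l := Finset.sum_nonneg fun l _ => hd0 l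
  rw [key, hn.2.1, abs_of_nonneg h2] at h1
  simpa [h.nrm_submatrix] using h1

theorem frobNorm_sq_eq_trace (A : Matrix (Fin p) (Fin m) ℝ) :
    frobNorm A ^ 2 = (Aᵀ * A).trace := by
  rw [frobNorm_sq, Finset.sum_comm]
  simp [Matrix.trace, Matrix.mul_apply, sq]

theorem frobNorm_mul_mul {U : Matrix (Fin p) (Fin p) ℝ} {V : Matrix (Fin m) (Fin m) ℝ}
    (A : Matrix (Fin p) (Fin m) ℝ) (hU : U * Uᵀ = 1) (hV : V * Vᵀ = 1) :
    frobNorm (U * A * V) = frobNorm A := by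
  rw [← sq_eq_sq₀ (frobNorm_nonneg _) (frobNorm_nonneg _), frobNorm_sq_eq_trace,
    frobNorm_sq_eq_trace, Matrix.trace_mul_comm]
  have : U * A * V * (U * A * V)ᵀ = U * (A * (V * Vᵀ) * Aᵀ * Uᵀ) := by
    simp [Matrix.transpose_mul, Matrix.mul_assoc]
  rw [this, Matrix.trace_mul_comm, hV, Matrix.mul_one, Matrix.mul_assoc,
    mul_eq_one_comm.1 hU, Matrix.mul_one, Matrix.trace_mul_comm]

/-- Comparison of a unitarily invariant norm with the operator norm `t`. -/
theorem IsUnitarilyInvariant.exists_opNorm (h : IsUnitarilyInvariant nrm)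
    (hn : IsMatrixNorm nrm) {r : ℕ} (hr : 1 ≤ r) (hrp : r ≤ p) (hrm : r ≤ m)
    (A : Matrix (Fin p) (Fin m) ℝ) (hA : A.rank ≤ r) :
    ∃ (t : ℝ) (u : Fin p → ℝ) (v : Fin m → ℝ), 0 ≤ t ∧ t ≤ frobNorm A ∧ ∑ i, u i ^ 2 = 1 ∧
      ∑ j, v j ^ 2 = 1 ∧ t = ∑ i, ∑ j, u i * A i j * v j ∧ nrm A ≤ t * nrm (Imat p m r) ∧
      frobNorm A ^ 2 * nrm (Imat p m r) ≤ t * r * nrm A := by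
  obtain ⟨U, V, d, hU, hV, hd0, hdm, hdr, rfl⟩ := exists_svd A
  have hp : 0 < p := by omega
  have hm : 0 < m := by omega
  set B := U * rectDiag p m d * V with hB
  have hU' := mul_eq_one_comm.1 hU
  have hdr' : ∀ l, r ≤ l → d l = 0 := fun l hl => hdr l (hA.trans hl)
  have hBn : nrm B = nrm (rectDiag p m d) := h _ _ _ hU hV
  have hf : frobNorm B ^ 2 = ∑ l : Fin r, d l ^ 2 := by
    rw [hB, frobNorm_mul_mul _ hU hV, frobNorm_sq]
    have h1 : ∀ i : Fin p, ∑ j : Fin m, rectDiag p m d i j ^ 2 = d i ^ 2 := by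
      intro i
      rcases lt_or_ge (i : ℕ) m with hi | hi
      · rw [Finset.sum_eq_single ⟨i, hi⟩]
        · simp [rectDiag]
        · intro j _ hj
          have : (i : ℕ) ≠ j := fun h => hj (Fin.ext h.symm)
          simp [rectDiag, this]
        · simp
      · rw [hdr' _ (hrm.trans hi)]
        refine (Finset.sum_eq_zero fun j _ => ?_).trans (by simp)
        have : (i : ℕ) ≠ j := by omega
        simp [rectDiag, this]
    simp_rw [h1]
    rw [Fin.sum_univ_eq_sum_range (fun l => d l ^ 2) p,
      Fin.sum_univ_eq_sum_range (fun l => d l ^ 2) r]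
    symm
    refine Finset.sum_subset (Finset.range_subset_range.2 hrp) fun l _ hl => ?_
    rw [hdr' l (by simpa using hl)]
    simp
  refine ⟨d 0, fun i => U i ⟨0, hp⟩, fun j => V ⟨0, hm⟩ j, hd0 0, ?_, ?_, ?_, ?_, ?_, ?_⟩
  · rw [← sq_le_sq₀ (hd0 0) (frobNorm_nonneg _), hf]
    exact Finset.single_le_sum (f := fun l : Fin r => d l ^ 2) (fun _ _ => sq_nonneg _)
      (Finset.mem_univ ⟨0, hr⟩)
  · have := congrFun (congrFun hU' ⟨0, hp⟩) ⟨0, hp⟩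
    simpa [Matrix.mul_apply, sq] using this
  · have := congrFun (congrFun hV ⟨0, hm⟩) ⟨0, hm⟩
    simpa [Matrix.mul_apply, sq] using this
  · have e : Uᵀ * B * Vᵀ = rectDiag p m d := by
      calc _ = (Uᵀ * U) * rectDiag p m d * (V * Vᵀ) := by simp [hB, Matrix.mul_assoc]
        _ = _ := by simp [hU', hV]
    have := congrFun (congrFun e ⟨0, hp⟩) ⟨0, hm⟩
    simp only [Matrix.mul_apply, Matrix.transpose_apply, rectDiag, Matrix.of_apply, if_true]
      at this
    rw [← this, Finset.sum_comm]
    simp [Finset.sum_mul]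
  · rw [hBn]
    refine h.nrm_rectDiag_le hn hdr' (hd0 0) fun l => ?_
    rw [abs_of_nonneg (hd0 l)]
    exact hdm (Nat.zero_le l)
  · rw [hf, hBn, mul_assoc]
    calc _ ≤ (d 0 * ∑ l : Fin r, d l) * nrm (Imat p m r) := by
          refine mul_le_mul_of_nonneg_right ?_ (hn.nonneg _)
          rw [Finset.mul_sum]
          refine Finset.sum_le_sum fun l _ => ?_
          rw [sq]
          exact mul_le_mul_of_nonneg_right (hdm (Nat.zero_le _)) (hd0 _)
      _ = d 0 * ((∑ l : Fin r, d l) * nrm (Imat p m r)) := by ring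
      _ ≤ _ := mul_le_mul_of_nonneg_left
          (h.sum_mul_nrm_Imat_le hn hr hrp hrm hdr' hd0) (hd0 0)

end MatrixNorm

section Restriction

variable {p m : ℕ} {nrm : Matrix (Fin p) (Fin m) ℝ → ℝ}

/-- Restriction of a matrix to the rows in `I` and the columns in `J`. -/
def restr (I : Finset (Fin p)) (J : Finset (Fin m)) (A : Matrix (Fin p) (Fin m) ℝ) :
    Matrix (Fin p) (Fin m) ℝ :=
  Matrix.of fun i j => if i ∈ I ∧ j ∈ J then A i j else 0

theorem restr_eq_diagonal_mul (I : Finset (Fin p)) (J : Finset (Fin m))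
    (A : Matrix (Fin p) (Fin m) ℝ) : restr I J A =
      diagonal (fun i => if i ∈ I then (1 : ℝ) else 0) * A *
        diagonal (fun j => if j ∈ J then (1 : ℝ) else 0) := by
  ext i j
  simp only [restr, Matrix.of_apply, mul_diagonal, diagonal_mul]
  by_cases hi : i ∈ I <;> by_cases hj : j ∈ J <;> simp [hi, hj]

theorem restr_sub (I : Finset (Fin p)) (J : Finset (Fin m)) (A B : Matrix (Fin p) (Fin m) ℝ) :
    restr I J (A - B) = restr I J A - restr I J B := by
  ext i j
  simp only [restr, Matrix.of_apply, Matrix.sub_apply]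
  split_ifs <;> simp

theorem restr_smul (I : Finset (Fin p)) (J : Finset (Fin m)) (c : ℝ)
    (A : Matrix (Fin p) (Fin m) ℝ) : restr I J (c • A) = c • restr I J A := by
  ext i j
  simp only [restr, Matrix.of_apply, Matrix.smul_apply]
  split_ifs <;> simp

theorem restr_restr (I I' : Finset (Fin p)) (J J' : Finset (Fin m))
    (A : Matrix (Fin p) (Fin m) ℝ) : restr I J (restr I' J' A) = restr (I ∩ I') (J ∩ J') A := by
  ext i j
  simp only [restr, Matrix.of_apply, Finset.mem_inter]
  grind

theorem measurable_restr (I : Finset (Fin p)) (J : Finset (Fin m)) :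
    Measurable (restr (p := p) (m := m) I J) := by
  refine measurable_of_entries fun i j => ?_
  by_cases h : i ∈ I ∧ j ∈ J
  · simpa [restr, h] using measurable_entry i j
  · simp [restr, h]

theorem rank_restr_le (I : Finset (Fin p)) (J : Finset (Fin m)) (A : Matrix (Fin p) (Fin m) ℝ) :
    (restr I J A).rank ≤ min I.card J.card := by
  have hd : ∀ {n : ℕ} (K : Finset (Fin n)),
      (diagonal (fun i => if i ∈ K then (1 : ℝ) else 0)).rank = K.card := by
    intro n K
    rw [rank_diagonal]
    simp
  rw [restr_eq_diagonal_mul]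
  refine le_min ?_ ?_
  · rw [Matrix.mul_assoc]
    exact (rank_mul_le_left _ _).trans (hd I).le
  · exact (rank_mul_le_right _ _).trans (hd J).le

theorem IsUnitarilyInvariant.nrm_restr_le (h : IsUnitarilyInvariant nrm) (hn : IsMatrixNorm nrm)
    (I : Finset (Fin p)) (J : Finset (Fin m)) (A : Matrix (Fin p) (Fin m) ℝ) :
    nrm (restr I J A) ≤ nrm A := by
  rw [restr_eq_diagonal_mul]
  refine (h.nrm_mul_diagonal_le hn (fun j => ?_) _).trans
    (h.nrm_diagonal_mul_le hn (fun i => ?_) _) <;> split_ifs <;> simp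

theorem frobNorm_restr_le (I : Finset (Fin p)) (J : Finset (Fin m))
    (A : Matrix (Fin p) (Fin m) ℝ) : frobNorm (restr I J A) ≤ frobNorm A := by
  refine Real.sqrt_le_sqrt (Finset.sum_le_sum fun i _ => Finset.sum_le_sum fun j _ => ?_)
  simp only [restr, Matrix.of_apply]
  split_ifs
  · exact le_rfl
  · simpa using sq_nonneg (A i j)

theorem restr_mem_submatrixSparse {k s : ℕ} {I : Finset (Fin p)} {J : Finset (Fin m)}
    (hI : I.card ≤ k) (hJ : J.card ≤ s) (A : Matrix (Fin p) (Fin m) ℝ) :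
    restr I J A ∈ SubmatrixSparse p m k s := by
  constructor
  · refine le_trans ?_ hI
    rw [← Set.ncard_coe_finset]
    refine Set.ncard_le_ncard ?_ (Finset.finite_toSet I)
    rintro i ⟨j, hj⟩
    by_contra h
    simp only [Finset.mem_coe] at h
    simp [restr, h] at hj
  · refine le_trans ?_ hJ
    rw [← Set.ncard_coe_finset]
    refine Set.ncard_le_ncard ?_ (Finset.finite_toSet J)
    rintro j ⟨i, hj⟩
    by_contra h
    simp only [Finset.mem_coe] at h
    simp [restr, h] at hj

theorem exists_restr_eq_of_mem_submatrixSparse {k s : ℕ} (hk : k ≤ p) (hs : s ≤ m)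
    {A : Matrix (Fin p) (Fin m) ℝ} (hA : A ∈ SubmatrixSparse p m k s) :
    ∃ (I : Finset (Fin p)) (J : Finset (Fin m)), I.card = k ∧ J.card = s ∧ restr I J A = A := by
  classical
  have key : ∀ {n l : ℕ} (S : Set (Fin n)), S.ncard ≤ l → l ≤ n →
      ∃ K : Finset (Fin n), K.card = l ∧ S ⊆ K := by
    intro n l S hS hl
    obtain ⟨K, h1, -, h2⟩ := Finset.exists_subsuperset_card_eq (Finset.subset_univ S.toFinset)
      (n := l) (by rwa [← Set.ncard_eq_toFinset_card']) (by simpa using hl)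
    exact ⟨K, h2, by simpa using Finset.coe_subset.2 h1⟩
  obtain ⟨I, hI, hI'⟩ := key _ hA.1 hk
  obtain ⟨J, hJ, hJ'⟩ := key _ hA.2 hs
  refine ⟨I, J, hI, hJ, ?_⟩
  ext i j
  simp only [restr, Matrix.of_apply]
  split_ifs with h
  · rfl
  · by_contra h0
    exact h ⟨hI' ⟨j, Ne.symm h0⟩, hJ' ⟨i, Ne.symm h0⟩⟩

theorem smul_mem_submatrixSparse {k s : ℕ} (c : ℝ) {A : Matrix (Fin p) (Fin m) ℝ}
    (hA : A ∈ SubmatrixSparse p m k s) : c • A ∈ SubmatrixSparse p m k s := by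
  refine ⟨le_trans (Set.ncard_le_ncard ?_ (Set.toFinite _)) hA.1,
    le_trans (Set.ncard_le_ncard ?_ (Set.toFinite _)) hA.2⟩
  · rintro i ⟨j, hj⟩
    exact ⟨j, by simp at hj; exact hj.2⟩
  · rintro i ⟨j, hj⟩
    exact ⟨j, by simp at hj; exact hj.2⟩

theorem Imat_pos (hn : IsMatrixNorm nrm) {r : ℕ} (hr : 1 ≤ r) (hrp : r ≤ p) (hrm : r ≤ m) :
    0 < nrm (Imat p m r) := by
  refine hn.pos fun h => ?_
  have := congrFun (congrFun h ⟨0, by omega⟩) ⟨0, by omega⟩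
  simp [Imat] at this
  omega

theorem rank_le_of_mem_submatrixSparse {k s : ℕ} (hk : k ≤ p) (hs : s ≤ m)
    {A : Matrix (Fin p) (Fin m) ℝ} (hA : A ∈ SubmatrixSparse p m k s) : A.rank ≤ min k s := by
  obtain ⟨I, J, rfl, rfl, hA'⟩ := exists_restr_eq_of_mem_submatrixSparse hk hs hA
  rw [← hA']
  exact rank_restr_le I J A

theorem IsUnitarilyInvariant.nrm_le_nrm_Imat_mul (h : IsUnitarilyInvariant nrm)
    (hn : IsMatrixNorm nrm) {k s : ℕ} (hk1 : 1 ≤ k) (hk : k ≤ p) (hs1 : 1 ≤ s) (hs : s ≤ m)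
    {A : Matrix (Fin p) (Fin m) ℝ} (hA : A ∈ SubmatrixSparse p m k s) :
    nrm A ≤ nrm (Imat p m (min k s)) * frobNorm A := by
  obtain ⟨t, u, v, ht, htf, -, -, -, h1, -⟩ := h.exists_opNorm hn (r := min k s)
    (by omega) (by omega) (by omega) A (rank_le_of_mem_submatrixSparse hk hs hA)
  rw [mul_comm]
  exact h1.trans (mul_le_mul_of_nonneg_right htf (hn.nonneg _))

theorem IsUnitarilyInvariant.bddAbove_sparseLip (h : IsUnitarilyInvariant nrm)
    (hn : IsMatrixNorm nrm) {k s : ℕ} (hk1 : 1 ≤ k) (hk : k ≤ p) (hs1 : 1 ≤ s) (hs : s ≤ m) :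
    nrm (Imat p m (min k s)) ∈
      upperBounds (nrm '' {A | A ∈ SubmatrixSparse p m k s ∧ frobNorm A = 1}) := by
  rintro _ ⟨A, ⟨hA, hf⟩, rfl⟩
  simpa [hf] using h.nrm_le_nrm_Imat_mul hn hk1 hk hs1 hs hA

theorem nonempty_sparseLip {k s : ℕ} (hk1 : 1 ≤ k) (hk : k ≤ p) (hs1 : 1 ≤ s) (hs : s ≤ m) :
    (nrm '' {A | A ∈ SubmatrixSparse p m k s ∧ frobNorm A = 1}).Nonempty := by
  set i0 : Fin p := ⟨0, by omega⟩
  set j0 : Fin m := ⟨0, by omega⟩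
  refine ⟨_, restr {i0} {j0} (Matrix.of fun _ _ => 1), ⟨restr_mem_submatrixSparse
    (by simpa using hk1) (by simpa using hs1) _, ?_⟩, rfl⟩
  rw [frobNorm, Finset.sum_eq_single i0, Finset.sum_eq_single j0] <;> simp +contextual [restr]

theorem IsUnitarilyInvariant.sparseLip_le (h : IsUnitarilyInvariant nrm)
    (hn : IsMatrixNorm nrm) {k s : ℕ} (hk1 : 1 ≤ k) (hk : k ≤ p) (hs1 : 1 ≤ s) (hs : s ≤ m) :
    sparseLip p m k s nrm ≤ nrm (Imat p m (min k s)) :=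
  csSup_le (nonempty_sparseLip hk1 hk hs1 hs) (h.bddAbove_sparseLip hn hk1 hk hs1 hs)

theorem entry_sq_le_frobNorm_sq (A : Matrix (Fin p) (Fin m) ℝ) (i : Fin p) (j : Fin m) :
    A i j ^ 2 ≤ frobNorm A ^ 2 := by
  rw [frobNorm_sq]
  exact (Finset.single_le_sum (f := fun j => A i j ^ 2) (fun _ _ => sq_nonneg _)
    (Finset.mem_univ j)).trans (Finset.single_le_sum (f := fun i => ∑ j, A i j ^ 2)
      (fun _ _ => Finset.sum_nonneg fun _ _ => sq_nonneg _) (Finset.mem_univ i))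

theorem frobNorm_eq_zero {A : Matrix (Fin p) (Fin m) ℝ} (h : frobNorm A = 0) : A = 0 := by
  ext i j
  have h1 := entry_sq_le_frobNorm_sq A i j
  rw [h, zero_pow two_ne_zero] at h1
  exact pow_eq_zero_iff two_ne_zero |>.1 (le_antisymm h1 (sq_nonneg _))

theorem IsUnitarilyInvariant.nrm_le_sparseLip_mul (h : IsUnitarilyInvariant nrm)
    (hn : IsMatrixNorm nrm) {k s : ℕ} (hk1 : 1 ≤ k) (hk : k ≤ p) (hs1 : 1 ≤ s) (hs : s ≤ m)
    {A : Matrix (Fin p) (Fin m) ℝ} (hA : A ∈ SubmatrixSparse p m k s) :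
    nrm A ≤ sparseLip p m k s nrm * frobNorm A := by
  rcases (frobNorm_nonneg A).eq_or_lt with h0 | h0
  · rw [frobNorm_eq_zero h0.symm, hn.map_zero]
    rw [← frobNorm_eq_zero h0.symm, ← h0, mul_zero]
  · have h1 : nrm ((frobNorm A)⁻¹ • A) ≤ sparseLip p m k s nrm :=
      le_csSup ⟨_, h.bddAbove_sparseLip hn hk1 hk hs1 hs⟩
        ⟨_, ⟨smul_mem_submatrixSparse _ hA, by
          rw [frobNorm_smul, abs_of_pos (inv_pos.2 h0), inv_mul_cancel₀ h0.ne']⟩, rfl⟩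
    rw [hn.2.1, abs_of_pos (inv_pos.2 h0)] at h1
    rwa [← div_eq_inv_mul, div_le_iff₀ h0] at h1

theorem IsUnitarilyInvariant.exists_half_sparseLip_le (h : IsUnitarilyInvariant nrm)
    (hn : IsMatrixNorm nrm) {k s : ℕ} (hk1 : 1 ≤ k) (hk : k ≤ p) (hs1 : 1 ≤ s) (hs : s ≤ m) :
    0 < sparseLip p m k s nrm ∧ ∃ A ∈ SubmatrixSparse p m k s, frobNorm A = 1 ∧
      sparseLip p m k s nrm / 2 ≤ nrm A := by
  have hne := nonempty_sparseLip (nrm := nrm) hk1 hk hs1 hs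
  have hpos : 0 < sparseLip p m k s nrm := by
    obtain ⟨_, A, ⟨hA, hf⟩, rfl⟩ := hne
    refine lt_of_lt_of_le (hn.pos (A := A) ?_)
      (le_csSup ⟨_, h.bddAbove_sparseLip hn hk1 hk hs1 hs⟩ ⟨A, ⟨hA, hf⟩, rfl⟩)
    rintro rfl
    simp [frobNorm] at hf
  obtain ⟨_, ⟨A, ⟨hA, hf⟩, rfl⟩, hlt⟩ := exists_lt_of_lt_csSup hne (half_lt_self hpos)
  exact ⟨hpos, A, hA, hf, hlt.le⟩

end Restriction

section OperatorNorm

theorem ofReal_exp_mul_volume_ball_le {E : Type*} [NormedAddCommGroup E] [NormedSpace ℝ E]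
    [MeasurableSpace E] [BorelSpace E] [FiniteDimensional ℝ E] (μ : Measure E)
    [μ.IsAddHaarMeasure] {l : E → ℝ} (hl : ∀ c h, l (c + h) + l (c - h) = 2 * l c)
    (hm : Measurable l) (c : E) (r : ℝ) :
    ENNReal.ofReal (Real.exp (l c)) * μ (Metric.ball c r) ≤
      ∫⁻ w in Metric.ball c r, ENNReal.ofReal (Real.exp (l w)) ∂μ := by
  have hme : Measurable fun w => ENNReal.ofReal (Real.exp (l w)) := by fun_prop
  have hp : MeasurePreserving (fun w : E => (c + c) - w) μ μ :=
    μ.measurePreserving_sub_left (c + c)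
  have h1 : ∫⁻ w in Metric.ball c r, ENNReal.ofReal (Real.exp (l ((c + c) - w))) ∂μ =
      ∫⁻ w in Metric.ball c r, ENNReal.ofReal (Real.exp (l w)) ∂μ := by
    have := hp.setLIntegral_comp_preimage (Metric.isOpen_ball (x := c) (ε := r)).measurableSet hme
    rw [← this]
    congr 2
    ext w
    simp only [Metric.mem_ball, Set.mem_preimage, dist_eq_norm]
    rw [← norm_neg]
    congr! 2
    abel
  have h2 : 2 * (ENNReal.ofReal (Real.exp (l c)) * μ (Metric.ball c r)) ≤
      2 * ∫⁻ w in Metric.ball c r, ENNReal.ofReal (Real.exp (l w)) ∂μ := by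
    calc _ = ∫⁻ w in Metric.ball c r, 2 * ENNReal.ofReal (Real.exp (l c)) ∂μ := by
          rw [setLIntegral_const, mul_assoc]
      _ ≤ ∫⁻ w in Metric.ball c r, (ENNReal.ofReal (Real.exp (l ((c + c) - w))) +
            ENNReal.ofReal (Real.exp (l w))) ∂μ := by
          refine lintegral_mono fun w => ?_
          rw [← ENNReal.ofReal_add (Real.exp_nonneg _) (Real.exp_nonneg _),
            ← ENNReal.ofReal_ofNat 2, ← ENNReal.ofReal_mul (by norm_num)]
          refine ENNReal.ofReal_le_ofReal ?_
          have h3 := hl c (w - c)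
          rw [show c + (w - c) = w by abel, show c - (w - c) = c + c - w by abel] at h3
          have h4 : Real.exp (l c) ^ 2 = Real.exp (l (c + c - w)) * Real.exp (l w) := by
            rw [← Real.exp_add, sq, ← Real.exp_add]
            congr 1
            linarith
          have h5 := Real.exp_pos (l (c + c - w))
          have h6 := Real.exp_pos (l w)
          refine abs_le_of_sq_le_sq' ?_ (by positivity) |>.2
          nlinarith [sq_nonneg (Real.exp (l (c + c - w)) - Real.exp (l w))]
      _ = _ := by rw [lintegral_add_right _ hme, h1, two_mul]
  exact (ENNReal.mul_le_mul_iff_right (by norm_num) (by norm_num)).1 h2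

/-- Extension by zero of a vector indexed by a finset. -/
def extZero {n : ℕ} (I : Finset (Fin n)) (w : EuclideanSpace ℝ I) (i : Fin n) : ℝ :=
  if h : i ∈ I then w ⟨i, h⟩ else 0

theorem measurable_extZero {n : ℕ} (I : Finset (Fin n)) (i : Fin n) :
    Measurable fun w => extZero I w i := by
  by_cases h : i ∈ I
  · simp only [extZero, h, dif_pos]
    fun_prop
  · simp only [extZero, h, dif_neg, not_false_eq_true]
    fun_prop

theorem sum_extZero_sq {n : ℕ} (I : Finset (Fin n)) (w : EuclideanSpace ℝ I) :
    ∑ i, extZero I w i ^ 2 = ‖w‖ ^ 2 := by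
  rw [EuclideanSpace.norm_sq_eq, ← Finset.sum_subset (Finset.subset_univ I), ← Finset.sum_coe_sort]
  · simp [extZero]
  · intro i _ hi
    simp [extZero, hi]

theorem extZero_add {n : ℕ} (I : Finset (Fin n)) (w w' : EuclideanSpace ℝ I) (i : Fin n) :
    extZero I (w + w') i = extZero I w i + extZero I w' i := by
  unfold extZero
  split_ifs <;> simp

theorem extZero_sub {n : ℕ} (I : Finset (Fin n)) (w w' : EuclideanSpace ℝ I) (i : Fin n) :
    extZero I (w - w') i = extZero I w i - extZero I w' i := by
  unfold extZero
  split_ifs <;> simp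

variable {p m : ℕ}

/-- The bilinear form of a block of the matrix `A`. -/
def blockForm (I : Finset (Fin p)) (J : Finset (Fin m)) (A : Matrix (Fin p) (Fin m) ℝ)
    (w : EuclideanSpace ℝ I) (w' : EuclideanSpace ℝ J) : ℝ :=
  ∑ i, ∑ j, extZero I w i * A i j * extZero J w' j

theorem measurable_blockForm {α : Type*} [MeasurableSpace α] (I : Finset (Fin p))
    (J : Finset (Fin m)) {f : α → Matrix (Fin p) (Fin m) ℝ} {g : α → EuclideanSpace ℝ I}
    {h : α → EuclideanSpace ℝ J} (hf : Measurable f) (hg : Measurable g) (hh : Measurable h) :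
    Measurable fun x => blockForm I J (f x) (g x) (h x) :=
  Finset.measurable_sum _ fun i _ => Finset.measurable_sum _ fun j _ =>
    (((measurable_extZero I i).comp hg).mul ((measurable_entry i j).comp hf)).mul
      ((measurable_extZero J j).comp hh)

theorem blockForm_eq_frobInner (I : Finset (Fin p)) (J : Finset (Fin m)) (l : ℝ)
    (A : Matrix (Fin p) (Fin m) ℝ) (w : EuclideanSpace ℝ I) (w' : EuclideanSpace ℝ J) :
    l * blockForm I J A w w' =
      frobInner (Matrix.of fun i j => l * (extZero I w i * extZero J w' j)) A := by
  simp only [blockForm, frobInner, Finset.mul_sum, Matrix.of_apply]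
  refine Finset.sum_congr rfl fun i _ => Finset.sum_congr rfl fun j _ => ?_
  ring

theorem frobNorm_sq_extZero_mul (I : Finset (Fin p)) (J : Finset (Fin m)) (l : ℝ)
    (w : EuclideanSpace ℝ I) (w' : EuclideanSpace ℝ J) :
    frobNorm (Matrix.of fun i j => l * (extZero I w i * extZero J w' j)) ^ 2 =
      l ^ 2 * (‖w‖ ^ 2 * ‖w'‖ ^ 2) := by
  rw [frobNorm_sq, ← sum_extZero_sq, ← sum_extZero_sq, Finset.sum_mul_sum, Finset.mul_sum]
  refine Finset.sum_congr rfl fun i _ => ?_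
  rw [Finset.mul_sum]
  refine Finset.sum_congr rfl fun j _ => ?_
  simp only [Matrix.of_apply]
  ring

/-- The exponential moment of a block averaged over pairs of unit balls. -/
noncomputable def ballMoment (I : Finset (Fin p)) (J : Finset (Fin m)) (l : ℝ)
    (A : Matrix (Fin p) (Fin m) ℝ) : ℝ≥0∞ :=
  ∫⁻ w in Metric.ball (0 : EuclideanSpace ℝ I) 1, ∫⁻ w' in Metric.ball (0 : EuclideanSpace ℝ J) 1,
    ENNReal.ofReal (Real.exp (l * blockForm I J A w w'))

theorem measurable_ballMoment (I : Finset (Fin p)) (J : Finset (Fin m)) (l : ℝ) :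
    Measurable (ballMoment I J l) := by
  unfold ballMoment
  refine Measurable.lintegral_prod_right' (f := fun q : Matrix (Fin p) (Fin m) ℝ × _ =>
    ∫⁻ w' in Metric.ball (0 : EuclideanSpace ℝ J) 1,
      ENNReal.ofReal (Real.exp (l * blockForm I J q.1 q.2 w'))) ?_
  refine Measurable.lintegral_prod_right' (f := fun q : (Matrix (Fin p) (Fin m) ℝ × _) × _ =>
      ENNReal.ofReal (Real.exp (l * blockForm I J q.1.1 q.1.2 q.2))) ?_
  exact (Real.measurable_exp.comp ((measurable_blockForm I J (by fun_prop) (by fun_prop)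
    (by fun_prop)).const_mul l)).ennreal_ofReal

theorem lintegral_ballMoment_le (I : Finset (Fin p)) (J : Finset (Fin m)) (l : ℝ) :
    ∫⁻ z, ballMoment I J l z ∂(stdGaussianMatrix p m) ≤ ENNReal.ofReal (Real.exp (l ^ 2 / 2)) *
      (volume (Metric.ball (0 : EuclideanSpace ℝ I) 1) *
        volume (Metric.ball (0 : EuclideanSpace ℝ J) 1)) := by
  unfold ballMoment
  have hme : Measurable fun q : (Matrix (Fin p) (Fin m) ℝ × EuclideanSpace ℝ I) ×
      EuclideanSpace ℝ J => ENNReal.ofReal (Real.exp (l * blockForm I J q.1.1 q.1.2 q.2)) :=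
    (Real.measurable_exp.comp ((measurable_blockForm I J (by fun_prop) (by fun_prop)
      (by fun_prop)).const_mul l)).ennreal_ofReal
  rw [lintegral_lintegral_swap hme.lintegral_prod_right'.aemeasurable]
  calc _ ≤ ∫⁻ w in Metric.ball (0 : EuclideanSpace ℝ I) 1,
        ENNReal.ofReal (Real.exp (l ^ 2 / 2)) * volume (Metric.ball (0 : EuclideanSpace ℝ J) 1) := by
        refine setLIntegral_mono measurable_const fun w hw => ?_
        rw [lintegral_lintegral_swap]
        · rw [← setLIntegral_const]
          refine setLIntegral_mono measurable_const fun w' hw' => ?_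
          simp_rw [blockForm_eq_frobInner]
          rw [lintegral_exp_frobInner, frobNorm_sq_extZero_mul]
          refine ENNReal.ofReal_le_ofReal (Real.exp_le_exp.2 ?_)
          have h1 : ‖w‖ ^ 2 ≤ 1 := by
            have : ‖w‖ < 1 := by simpa using hw
            nlinarith [norm_nonneg w]
          have h2 : ‖w'‖ ^ 2 ≤ 1 := by
            have : ‖w'‖ < 1 := by simpa using hw'
            nlinarith [norm_nonneg w']
          have h3 : ‖w‖ ^ 2 * ‖w'‖ ^ 2 ≤ 1 := mul_le_one₀ h1 (by positivity) h2
          have := mul_le_mul_of_nonneg_left h3 (sq_nonneg l)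
          linarith
        · exact (hme.comp (f := fun q : Matrix (Fin p) (Fin m) ℝ × EuclideanSpace ℝ J =>
            ((q.1, w), q.2)) (by fun_prop)).aemeasurable
    _ = _ := by
      rw [setLIntegral_const]
      ring

theorem le_ballMoment (I : Finset (Fin p)) (J : Finset (Fin m)) (l : ℝ)
    (A : Matrix (Fin p) (Fin m) ℝ) {u : EuclideanSpace ℝ I} {v : EuclideanSpace ℝ J}
    (hu : ‖u‖ ≤ 1) (hv : ‖v‖ ≤ 1) :
    ENNReal.ofReal (Real.exp (l * blockForm I J A ((3 / 4 : ℝ) • u) ((3 / 4 : ℝ) • v))) *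
      (volume (Metric.ball ((3 / 4 : ℝ) • u) (1 / 4)) *
        volume (Metric.ball ((3 / 4 : ℝ) • v) (1 / 4))) ≤ ballMoment I J l A := by
  have hsub : ∀ {n : ℕ} (K : Finset (Fin n)) (x : EuclideanSpace ℝ K), ‖x‖ ≤ 1 →
      Metric.ball ((3 / 4 : ℝ) • x) (1 / 4) ⊆ Metric.ball 0 1 := by
    intro n K x hx
    refine Metric.ball_subset_ball' ?_
    rw [dist_zero_right, norm_smul, Real.norm_of_nonneg (by norm_num)]
    linarith
  unfold ballMoment
  calc _ ≤ ∫⁻ w in Metric.ball ((3 / 4 : ℝ) • u) (1 / 4),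
        ENNReal.ofReal (Real.exp (l * blockForm I J A w ((3 / 4 : ℝ) • v))) *
          volume (Metric.ball ((3 / 4 : ℝ) • v) (1 / 4)) := by
        rw [lintegral_mul_const, ← mul_assoc]
        · gcongr
          refine ofReal_exp_mul_volume_ball_le volume
            (l := fun w => l * blockForm I J A w ((3 / 4 : ℝ) • v)) (fun c h => ?_) ?_ _ _
          · simp only [blockForm, extZero_add, extZero_sub, add_mul, sub_mul,
              Finset.sum_add_distrib, Finset.sum_sub_distrib]
            ring
          · exact (measurable_blockForm I J measurable_const measurable_id
              measurable_const).const_mul l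
        · exact (Real.measurable_exp.comp ((measurable_blockForm I J measurable_const
            measurable_id measurable_const).const_mul l)).ennreal_ofReal
    _ ≤ ∫⁻ w in Metric.ball ((3 / 4 : ℝ) • u) (1 / 4),
        ∫⁻ w' in Metric.ball ((3 / 4 : ℝ) • v) (1 / 4),
          ENNReal.ofReal (Real.exp (l * blockForm I J A w w')) := by
        refine lintegral_mono fun w => ?_
        refine ofReal_exp_mul_volume_ball_le volume
            (l := fun w' => l * blockForm I J A w w') (fun c h => ?_) ?_ _ _
        · simp only [blockForm, extZero_add, extZero_sub, mul_add, mul_sub,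
              Finset.sum_add_distrib, Finset.sum_sub_distrib]
          ring
        · exact (measurable_blockForm I J measurable_const measurable_const
              measurable_id).const_mul l
    _ ≤ _ := by
      refine (lintegral_mono fun w => lintegral_mono_set (hsub J v hv)).trans ?_
      exact lintegral_mono_set (hsub I u hu)

theorem volume_ball_quarter {n : ℕ} (K : Finset (Fin n)) (x : EuclideanSpace ℝ K) :
    volume (Metric.ball (0 : EuclideanSpace ℝ K) 1) =
      ENNReal.ofReal (4 ^ K.card) * volume (Metric.ball x (1 / 4)) := by
  rw [Measure.addHaar_ball_of_pos volume x (by norm_num : (0 : ℝ) < 1 / 4), ← mul_assoc,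
    ← ENNReal.ofReal_mul (by positivity)]
  simp

theorem sq_le_of_exp (y a : ℝ) (hy : 0 ≤ y) : y ^ 2 ≤ 2 * a ^ 2 + 4 * Real.exp (y - a) := by
  rcases le_or_gt y a with h | h
  · nlinarith [Real.exp_pos (y - a)]
  · have := Real.quadratic_le_exp_of_nonneg (sub_nonneg.2 h.le)
    nlinarith [sq_nonneg (y - a - a)]

/-- A random variable with mean of order `|I| + |J|` dominates the squared operator norm of the
`I × J` block of a Gaussian matrix. -/
theorem exists_opNorm_dominant (I : Finset (Fin p)) (J : Finset (Fin m)) (hI : 1 ≤ I.card)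
    (hJ : 1 ≤ J.card) : ∃ Φ : Matrix (Fin p) (Fin m) ℝ → ℝ≥0∞, Measurable Φ ∧
      ∫⁻ z, Φ z ∂(stdGaussianMatrix p m) ≤ ENNReal.ofReal (40 * (I.card + J.card)) ∧
      ∀ (A : Matrix (Fin p) (Fin m) ℝ) (u : Fin p → ℝ) (v : Fin m → ℝ), ∑ i, u i ^ 2 ≤ 1 →
        ∑ j, v j ^ 2 ≤ 1 →
        ENNReal.ofReal ((∑ i, ∑ j, u i * restr I J A i j * v j) ^ 2) ≤ Φ A := by
  set n : ℝ := I.card + J.card with hn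
  have hn2 : 2 ≤ n := by
    have h1 : (1 : ℝ) ≤ I.card := by exact_mod_cast hI
    have h2 : (1 : ℝ) ≤ J.card := by exact_mod_cast hJ
    linarith
  set l : ℝ := Real.sqrt n with hl
  have hl2 : l ^ 2 = n := Real.sq_sqrt (by linarith)
  set V := volume (Metric.ball (0 : EuclideanSpace ℝ I) 1) *
        volume (Metric.ball (0 : EuclideanSpace ℝ J) 1) with hV
  have hV0 : V ≠ 0 := mul_ne_zero (Metric.measure_ball_pos _ _ one_pos).ne'
    (Metric.measure_ball_pos _ _ one_pos).ne'
  have hVt : V ≠ ⊤ := ENNReal.mul_ne_top measure_ball_lt_top.ne measure_ball_lt_top.ne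
  set Q : ℝ := 4 ^ I.card * 4 ^ J.card with hQ
  have hQ0 : 0 < Q := by positivity
  have h4 : (4 : ℝ) ≤ Real.exp (3 / 2) := by
    have h1 : (2.7182818283 : ℝ) < Real.exp 1 := Real.exp_one_gt_d9
    have h2 : (1.625 : ℝ) ≤ Real.exp (1 / 2) := by
      have := Real.quadratic_le_exp_of_nonneg (x := 1 / 2) (by norm_num)
      linarith
    have h3 : Real.exp (3 / 2) = Real.exp 1 * Real.exp (1 / 2) := by
      rw [← Real.exp_add]
      norm_num
    rw [h3]
    nlinarith
  have hQe : Q ≤ Real.exp (3 / 2 * n) := by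
    rw [hQ, ← pow_add, show 3 / 2 * n = ((I.card + J.card : ℕ) : ℝ) * (3 / 2) by
      rw [hn]; push_cast; ring, Real.exp_nat_mul]
    exact pow_le_pow_left₀ (by norm_num) h4 _
  set κ : ℝ := 256 / 81 / n with hκ
  have hκ0 : 0 < κ := by positivity
  refine ⟨fun A => ENNReal.ofReal (κ * (8 * n ^ 2)) +
    ENNReal.ofReal (κ * (4 * Real.exp (-(2 * n)) * Q)) * (V⁻¹ * ballMoment I J l A),
    ((measurable_ballMoment I J l).const_mul _ |>.const_mul _).const_add _, ?_, ?_⟩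
  · rw [lintegral_add_left measurable_const, lintegral_const_mul _
      ((measurable_ballMoment I J l).const_mul _), lintegral_const_mul _
      (measurable_ballMoment I J l), lintegral_const, measure_univ, mul_one]
    have h1 : V⁻¹ * ∫⁻ z, ballMoment I J l z ∂(stdGaussianMatrix p m) ≤
        ENNReal.ofReal (Real.exp (n / 2)) := by
      calc _ ≤ V⁻¹ * (ENNReal.ofReal (Real.exp (l ^ 2 / 2)) * V) := by
            gcongr
            exact lintegral_ballMoment_le I J l
        _ = _ := by
          rw [mul_comm, mul_assoc, ENNReal.mul_inv_cancel hV0 hVt, mul_one, hl2]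
    refine (add_le_add_right (mul_le_mul_right h1 _) _).trans ?_
    rw [← ENNReal.ofReal_mul (by positivity), ← ENNReal.ofReal_add (by positivity) (by positivity)]
    refine ENNReal.ofReal_le_ofReal ?_
    have h2 : Real.exp (-(2 * n)) * Q * Real.exp (n / 2) ≤ 1 := by
      calc _ ≤ Real.exp (-(2 * n)) * Real.exp (3 / 2 * n) * Real.exp (n / 2) := by gcongr
        _ = 1 := by
          rw [← Real.exp_add, ← Real.exp_add, ← Real.exp_zero]
          congr 1
          ring
    have h3 : κ * (8 * n ^ 2) + κ * (4 * Real.exp (-(2 * n)) * Q) * Real.exp (n / 2) ≤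
        κ * (8 * n ^ 2 + 4) := by
      nlinarith
    refine h3.trans ?_
    rw [hκ, div_mul_eq_mul_div, div_le_iff₀ (by linarith)]
    nlinarith
  · intro A u v hu hv
    have key : ∀ (u : Fin p → ℝ), ∑ i, u i ^ 2 ≤ 1 →
        0 ≤ ∑ i, ∑ j, u i * restr I J A i j * v j →
        ENNReal.ofReal ((∑ i, ∑ j, u i * restr I J A i j * v j) ^ 2) ≤
          ENNReal.ofReal (κ * (8 * n ^ 2)) +
            ENNReal.ofReal (κ * (4 * Real.exp (-(2 * n)) * Q)) * (V⁻¹ * ballMoment I J l A) := by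
      intro u hu hσ
      set σ := ∑ i, ∑ j, u i * restr I J A i j * v j with hσd
      have hnorm : ∀ {d : ℕ} (K : Finset (Fin d)) (x : Fin d → ℝ), ∑ i, x i ^ 2 ≤ 1 →
          ‖(WithLp.toLp 2 fun i : K => x i : EuclideanSpace ℝ K)‖ ≤ 1 := by
        intro d K x hx
        rw [← sq_le_one_iff₀ (norm_nonneg _), EuclideanSpace.norm_sq_eq]
        refine le_trans ?_ hx
        simp only [Real.norm_eq_abs, sq_abs]
        rw [Finset.sum_coe_sort K fun i => x i ^ 2]
        exact Finset.sum_le_sum_of_subset_of_nonneg (Finset.subset_univ _)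
          fun _ _ _ => sq_nonneg _
      have hb := le_ballMoment I J l A (hnorm I u hu) (hnorm J v hv)
      have hform : blockForm I J A ((3 / 4 : ℝ) • (WithLp.toLp 2 fun i : I => u i))
          ((3 / 4 : ℝ) • (WithLp.toLp 2 fun j : J => v j)) = 9 / 16 * σ := by
        rw [hσd, blockForm, Finset.mul_sum]
        refine Finset.sum_congr rfl fun i _ => ?_
        rw [Finset.mul_sum]
        refine Finset.sum_congr rfl fun j _ => ?_
        by_cases hi : i ∈ I <;> by_cases hj : j ∈ J <;> simp [extZero, restr, hi, hj]
        ring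
      rw [hform] at hb
      set y := l * (9 / 16 * σ) with hy
      have hy0 : 0 ≤ y := by positivity
      have hexp : ENNReal.ofReal (Real.exp y) ≤ ENNReal.ofReal Q * (V⁻¹ * ballMoment I J l A) := by
        refine le_trans ?_ (mul_le_mul_right (mul_le_mul_right hb _) _)
        rw [hV, volume_ball_quarter I ((3 / 4 : ℝ) • (WithLp.toLp 2 fun i : I => u i)),
          volume_ball_quarter J ((3 / 4 : ℝ) • (WithLp.toLp 2 fun j : J => v j))]
        set a := volume (Metric.ball ((3 / 4 : ℝ) •
          (WithLp.toLp 2 fun i : I => u i : EuclideanSpace ℝ I)) (1 / 4)) with ha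
        set b := volume (Metric.ball ((3 / 4 : ℝ) •
          (WithLp.toLp 2 fun j : J => v j : EuclideanSpace ℝ J)) (1 / 4)) with hb
        have e : ENNReal.ofReal (4 ^ I.card) * a * (ENNReal.ofReal (4 ^ J.card) * b) =
            ENNReal.ofReal Q * (a * b) := by
          rw [hQ, ENNReal.ofReal_mul (by positivity)]
          ring
        have h0 : ENNReal.ofReal Q * (a * b) ≠ 0 := mul_ne_zero (ENNReal.ofReal_pos.2 hQ0).ne'
          (mul_ne_zero (Metric.measure_ball_pos _ _ (by norm_num)).ne'
            (Metric.measure_ball_pos _ _ (by norm_num)).ne')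
        have ht : ENNReal.ofReal Q * (a * b) ≠ ⊤ := ENNReal.mul_ne_top ENNReal.ofReal_ne_top
          (ENNReal.mul_ne_top measure_ball_lt_top.ne measure_ball_lt_top.ne)
        rw [e]
        calc _ = ENNReal.ofReal (Real.exp y) * ((ENNReal.ofReal Q * (a * b)) *
              (ENNReal.ofReal Q * (a * b))⁻¹) := by rw [ENNReal.mul_inv_cancel h0 ht, mul_one]
          _ ≤ _ := le_of_eq (by ring)
      have h1 := sq_le_of_exp y (2 * n) hy0
      have h2 : σ ^ 2 ≤ κ * (8 * n ^ 2) + κ * (4 * Real.exp (-(2 * n))) * Real.exp y := by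
        have e1 : y ^ 2 = n * (81 / 256) * σ ^ 2 := by
          rw [hy, mul_pow, hl2]
          ring
        have e2 : σ ^ 2 = κ * y ^ 2 := by
          rw [e1, hκ]
          field_simp
        rw [e2]
        calc _ ≤ κ * (2 * (2 * n) ^ 2 + 4 * Real.exp (y - 2 * n)) :=
              mul_le_mul_of_nonneg_left h1 hκ0.le
          _ = _ := by
            rw [show y - 2 * n = -(2 * n) + y by ring, Real.exp_add]
            ring
      calc _ ≤ ENNReal.ofReal (κ * (8 * n ^ 2) + κ * (4 * Real.exp (-(2 * n))) * Real.exp y) :=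
            ENNReal.ofReal_le_ofReal h2
        _ = ENNReal.ofReal (κ * (8 * n ^ 2)) +
            ENNReal.ofReal (κ * (4 * Real.exp (-(2 * n)))) * ENNReal.ofReal (Real.exp y) := by
          rw [ENNReal.ofReal_add (by positivity) (by positivity),
            ENNReal.ofReal_mul (by positivity : 0 ≤ κ * (4 * Real.exp (-(2 * n))))]
        _ ≤ ENNReal.ofReal (κ * (8 * n ^ 2)) + ENNReal.ofReal (κ * (4 * Real.exp (-(2 * n)))) *
            (ENNReal.ofReal Q * (V⁻¹ * ballMoment I J l A)) := by gcongr
        _ = _ := by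
          rw [← mul_assoc (ENNReal.ofReal _) (ENNReal.ofReal Q),
            ← ENNReal.ofReal_mul (by positivity)]
          ring_nf
    rcases le_total 0 (∑ i, ∑ j, u i * restr I J A i j * v j) with h | h
    · exact key u hu h
    · have e : ∑ i, ∑ j, (-u i) * restr I J A i j * v j =
          -∑ i, ∑ j, u i * restr I J A i j * v j := by
        simp [Finset.sum_neg_distrib]
      have := key (fun i => -u i) (by simpa using hu) (by rw [e]; linarith)
      rw [e, neg_sq] at this
      exact this

end OperatorNorm

section BlockMoments

variable {p m : ℕ} {nrm : Matrix (Fin p) (Fin m) ℝ → ℝ}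

theorem IsMatrixNorm.measurable_nrm_restr_sq (hn : IsMatrixNorm nrm) (I : Finset (Fin p))
    (J : Finset (Fin m)) : Measurable fun z => ENNReal.ofReal (nrm (restr I J z) ^ 2) :=
  ((hn.measurable.comp (measurable_restr I J)).pow_const 2).ennreal_ofReal

theorem lintegral_frobNorm_restr_sq (I : Finset (Fin p)) (J : Finset (Fin m)) :
    ∫⁻ z, ENNReal.ofReal (frobNorm (restr I J z) ^ 2) ∂(stdGaussianMatrix p m) =
      ENNReal.ofReal (I.card * J.card) := by
  have e : ∀ z : Matrix (Fin p) (Fin m) ℝ, ENNReal.ofReal (frobNorm (restr I J z) ^ 2) =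
      ∑ i ∈ I, ∑ j ∈ J, ENNReal.ofReal (z i j ^ 2) := by
    intro z
    rw [frobNorm_sq, ← Finset.sum_subset (Finset.subset_univ I),
      ENNReal.ofReal_sum_of_nonneg (f := fun i => ∑ j, restr I J z i j ^ 2)
        fun _ _ => Finset.sum_nonneg fun _ _ => sq_nonneg _]
    · refine Finset.sum_congr rfl fun i hi => ?_
      rw [← Finset.sum_subset (Finset.subset_univ J),
        ENNReal.ofReal_sum_of_nonneg (f := fun j => restr I J z i j ^ 2) fun _ _ => sq_nonneg _]
      · refine Finset.sum_congr rfl fun j hj => ?_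
        simp [restr, hi, hj]
      · intro j _ hj
        simp [restr, hj]
    · intro i _ hi
      simp [restr, hi]
  simp_rw [e]
  have hm : ∀ i j, Measurable fun z : Matrix (Fin p) (Fin m) ℝ => ENNReal.ofReal (z i j ^ 2) :=
    fun i j => ((measurable_entry i j).pow_const 2).ennreal_ofReal
  rw [lintegral_finsetSum _ fun i _ => Finset.measurable_sum _ fun j _ => hm i j]
  simp_rw [lintegral_finsetSum _ fun j _ => hm _ j, lintegral_entry_sq_stdGaussianMatrix]
  rw [ENNReal.ofReal_mul (by positivity)]
  simp

theorem IsUnitarilyInvariant.lintegral_nrm_restr_sq_le (h : IsUnitarilyInvariant nrm)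
    (hn : IsMatrixNorm nrm) {I : Finset (Fin p)} {J : Finset (Fin m)} (hI : 1 ≤ I.card)
    (hJ : 1 ≤ J.card) :
    ∫⁻ z, ENNReal.ofReal (nrm (restr I J z) ^ 2) ∂(stdGaussianMatrix p m) ≤
      ENNReal.ofReal (40 * (nrm (Imat p m (min I.card J.card)) ^ 2 * (I.card + J.card))) := by
  obtain ⟨Φ, hΦ, hΦi, hΦu⟩ := exists_opNorm_dominant I J hI hJ
  set ν := nrm (Imat p m (min I.card J.card))
  have hIp : I.card ≤ p := by simpa using I.card_le_univ
  have hJm : J.card ≤ m := by simpa using J.card_le_univ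
  calc _ ≤ ∫⁻ z, ENNReal.ofReal (ν ^ 2) * Φ z ∂(stdGaussianMatrix p m) := by
        refine lintegral_mono fun z => ?_
        obtain ⟨t, u, v, ht, -, hu, hv, hte, h1, -⟩ := h.exists_opNorm hn (r := min I.card J.card)
          (by omega) (by omega) (by omega) (restr I J z) (rank_restr_le I J z)
        refine le_trans ?_ (mul_le_mul_right (hΦu z u v hu.le hv.le) _)
        rw [← hte, ← ENNReal.ofReal_mul (sq_nonneg _), ← mul_pow, mul_comm ν]
        exact ENNReal.ofReal_le_ofReal (pow_le_pow_left₀ (hn.nonneg _) h1 2)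
    _ ≤ ENNReal.ofReal (ν ^ 2) * ENNReal.ofReal (40 * (I.card + J.card)) := by
        rw [lintegral_const_mul _ hΦ]
        gcongr
    _ = _ := by
        rw [← ENNReal.ofReal_mul (sq_nonneg _)]
        ring_nf

theorem IsUnitarilyInvariant.le_lintegral_nrm_restr_sq (h : IsUnitarilyInvariant nrm)
    (hn : IsMatrixNorm nrm) {I : Finset (Fin p)} {J : Finset (Fin m)} (hI : 1 ≤ I.card)
    (hJ : 1 ≤ J.card) :
    ENNReal.ofReal (1 / 160 * (nrm (Imat p m (min I.card J.card)) ^ 2 * (I.card + J.card))) ≤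
      ∫⁻ z, ENNReal.ofReal (nrm (restr I J z) ^ 2) ∂(stdGaussianMatrix p m) := by
  obtain ⟨Φ, hΦ, hΦi, hΦu⟩ := exists_opNorm_dominant I J hI hJ
  have hIp : I.card ≤ p := by simpa using I.card_le_univ
  have hJm : J.card ≤ m := by simpa using J.card_le_univ
  set r := min I.card J.card with hr
  set ν := nrm (Imat p m r)
  have hν : 0 < ν := Imat_pos hn (by omega) (by omega) (by omega)
  have hr0 : (0 : ℝ) < r := by
    have : 0 < r := by omega
    exact_mod_cast this
  have hI0 : (0 : ℝ) < I.card := by exact_mod_cast hI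
  have hJ0 : (0 : ℝ) < J.card := by exact_mod_cast hJ
  set n : ℝ := I.card + J.card with hnd
  have hn0 : 0 < n := by positivity
  set θ : ℝ := I.card * J.card * ν / (40 * n * r) with hθ
  have hθ0 : 0 < θ := by positivity
  set E := ∫⁻ z, ENNReal.ofReal (nrm (restr I J z) ^ 2) ∂(stdGaussianMatrix p m)
  have hpt : ∀ z : Matrix (Fin p) (Fin m) ℝ,
      ENNReal.ofReal (2 * ν) * ENNReal.ofReal (frobNorm (restr I J z) ^ 2) ≤
        ENNReal.ofReal (r * θ) * Φ z +
          ENNReal.ofReal (r / θ) * ENNReal.ofReal (nrm (restr I J z) ^ 2) := by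
    intro z
    obtain ⟨t, u, v, ht, -, hu, hv, hte, -, h1⟩ := h.exists_opNorm hn (r := r)
      (by omega) (by omega) (by omega) (restr I J z) (rank_restr_le I J z)
    refine le_trans ?_ (add_le_add_left (mul_le_mul_right (hΦu z u v hu.le hv.le) _) _)
    rw [← hte, ← ENNReal.ofReal_mul (by positivity), ← ENNReal.ofReal_mul (by positivity),
      ← ENNReal.ofReal_mul (by positivity), ← ENNReal.ofReal_add (by positivity) (by positivity)]
    refine ENNReal.ofReal_le_ofReal ?_
    set x := nrm (restr I J z)
    have h2 : 2 * (t * x) ≤ θ * t ^ 2 + x ^ 2 / θ := by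
      have e : θ * t ^ 2 + x ^ 2 / θ - 2 * (t * x) = (θ * t - x) ^ 2 / θ := by
        field_simp
        ring
      have : 0 ≤ (θ * t - x) ^ 2 / θ := by positivity
      linarith
    calc 2 * ν * frobNorm (restr I J z) ^ 2 = 2 * (frobNorm (restr I J z) ^ 2 * ν) := by ring
      _ ≤ 2 * (t * r * x) := by linarith
      _ = r * (2 * (t * x)) := by ring
      _ ≤ r * (θ * t ^ 2 + x ^ 2 / θ) := by gcongr
      _ = _ := by ring
  have hle := lintegral_mono (μ := stdGaussianMatrix p m) hpt
  have hmf : Measurable fun z : Matrix (Fin p) (Fin m) ℝ =>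
      ENNReal.ofReal (frobNorm (restr I J z) ^ 2) := by
    simp_rw [frobNorm_sq]
    exact (Finset.measurable_sum _ fun i _ => Finset.measurable_sum _ fun j _ =>
      ((measurable_entry i j).comp (measurable_restr I J)).pow_const 2).ennreal_ofReal
  rw [lintegral_const_mul _ hmf, lintegral_frobNorm_restr_sq,
    lintegral_add_left (hΦ.const_mul _), lintegral_const_mul _ hΦ,
    lintegral_const_mul _ (hn.measurable_nrm_restr_sq I J)] at hle
  have h3 : ENNReal.ofReal (I.card * J.card * ν) + ENNReal.ofReal (I.card * J.card * ν) ≤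
      ENNReal.ofReal (I.card * J.card * ν) + ENNReal.ofReal (r / θ) * E := by
    calc _ = ENNReal.ofReal (2 * ν) * ENNReal.ofReal (I.card * J.card) := by
          rw [← ENNReal.ofReal_add (by positivity) (by positivity),
            ← ENNReal.ofReal_mul (by positivity)]
          ring_nf
      _ ≤ _ := hle
      _ ≤ _ := by
        gcongr
        refine (mul_le_mul_right hΦi _).trans ?_
        rw [← ENNReal.ofReal_mul (by positivity)]
        refine ENNReal.ofReal_le_ofReal (le_of_eq ?_)
        rw [hθ]
        field_simp
  have h4 := ENNReal.le_of_add_le_add_left ENNReal.ofReal_ne_top h3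
  calc _ ≤ ENNReal.ofReal (θ / r) * ENNReal.ofReal (I.card * J.card * ν) := by
        rw [← ENNReal.ofReal_mul (by positivity)]
        refine ENNReal.ofReal_le_ofReal ?_
        have hmax : r * n ≤ 2 * (I.card * J.card : ℝ) := by
          rw [hr, hnd]
          push_cast
          rcases le_total (I.card : ℝ) J.card with h | h
          · rw [min_eq_left h]
            nlinarith
          · rw [min_eq_right h]
            nlinarith
        have hsq : (r * n) ^ 2 ≤ (2 * (I.card * J.card : ℝ)) ^ 2 :=
          pow_le_pow_left₀ (by positivity) hmax 2
        calc _ = ν ^ 2 / 4 * (r * n) ^ 2 / (40 * n * r * r) := by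
              field_simp
              ring
          _ ≤ ν ^ 2 / 4 * (2 * (I.card * J.card : ℝ)) ^ 2 / (40 * n * r * r) := by gcongr
          _ = _ := by
            rw [hθ]
            field_simp
            ring
    _ ≤ ENNReal.ofReal (θ / r) * (ENNReal.ofReal (r / θ) * E) := by gcongr
    _ = E := by
      rw [← mul_assoc, ← ENNReal.ofReal_mul (by positivity)]
      have : θ / r * (r / θ) = 1 := by field_simp
      rw [this, ENNReal.ofReal_one, one_mul]

end BlockMoments

section Concentration

variable {p m : ℕ} {nrm : Matrix (Fin p) (Fin m) ℝ → ℝ}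

theorem log_choose_le {n k : ℕ} (hk : 1 ≤ k) (hkn : k ≤ n) :
    Real.log (n.choose k) ≤ k * Real.log (Real.exp 1 * n / k) := by
  have hk0 : (0 : ℝ) < k := by exact_mod_cast hk
  have hn0 : (0 : ℝ) < n := by exact_mod_cast hk.trans hkn
  rw [← Real.log_pow]
  refine Real.log_le_log (by exact_mod_cast Nat.choose_pos hkn) ?_
  refine (Nat.choose_le_pow_div k n).trans ?_
  have h1 := Real.pow_div_factorial_le_exp k hk0.le k
  rw [div_le_iff₀ (by positivity)] at h1
  rw [div_pow, mul_pow, ← Real.exp_nat_mul, mul_one, div_le_div_iff₀ (by positivity)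
    (by positivity)]
  calc (n : ℝ) ^ k * k ^ k ≤ n ^ k * (Real.exp k * k.factorial) := by gcongr
    _ = _ := by ring

theorem IsUnitarilyInvariant.nrm_restr_sub_le (h : IsUnitarilyInvariant nrm)
    (hn : IsMatrixNorm nrm) {k s : ℕ} (hk1 : 1 ≤ k) (hk : k ≤ p) (hs1 : 1 ≤ s) (hs : s ≤ m)
    {I : Finset (Fin p)} {J : Finset (Fin m)} (hI : I.card = k) (hJ : J.card = s)
    (x y : Matrix (Fin p) (Fin m) ℝ) :
    nrm (restr I J x) - nrm (restr I J y) ≤ sparseLip p m k s nrm * frobNorm (x - y) := by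
  have h1 := hn.1 (restr I J (x - y)) (restr I J y)
  rw [restr_sub, sub_add_cancel, ← restr_sub] at h1
  have h2 := h.nrm_le_sparseLip_mul hn hk1 hk hs1 hs
    (restr_mem_submatrixSparse hI.le hJ.le (x - y))
  have h3 := (h.exists_half_sparseLip_le hn hk1 hk hs1 hs).1
  have h4 := mul_le_mul_of_nonneg_left (frobNorm_restr_le I J (x - y)) h3.le
  linarith

/-- Exponential concentration of the norm of a block above the level `T`. -/
theorem IsUnitarilyInvariant.lintegral_exp_nrm_restr_le (h : IsUnitarilyInvariant nrm)
    (hn : IsMatrixNorm nrm) {k s : ℕ} (hk1 : 1 ≤ k) (hk : k ≤ p) (hs1 : 1 ≤ s) (hs : s ≤ m)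
    {I : Finset (Fin p)} {J : Finset (Fin m)} (hI : I.card = k) (hJ : J.card = s) {T : ℝ}
    (hT : 0 ≤ T) (hT2 : T ^ 2 = 80 * (nrm (Imat p m (min k s)) ^ 2 * (k + s))) :
    ∫⁻ z, ENNReal.ofReal (Real.exp ((max (nrm (restr I J z) - T) 0 / sparseLip p m k s nrm) ^ 2 / 4))
      ∂(stdGaussianMatrix p m) ≤ 2 := by
  have hL := (h.exists_half_sparseLip_le hn hk1 hk hs1 hs).1
  set L := sparseLip p m k s nrm
  have hν : 0 < nrm (Imat p m (min k s)) := Imat_pos hn (by omega) (by omega) (by omega)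
  have hk0 : (0 : ℝ) < k := by exact_mod_cast hk1
  have hT2' : 0 < T ^ 2 := by rw [hT2]; positivity
  have hm : Measurable fun z => nrm (restr I J z) := hn.measurable.comp (measurable_restr I J)
  set K := {z : Matrix (Fin p) (Fin m) ℝ | nrm (restr I J z) < T}
  have hKm : MeasurableSet K := measurableSet_lt hm measurable_const
  have hK : 2⁻¹ ≤ stdGaussianMatrix p m K := by
    have h1 := mul_meas_ge_le_lintegral (μ := stdGaussianMatrix p m)
      (hn.measurable_nrm_restr_sq I J) (ENNReal.ofReal (T ^ 2))
    have h2 : {z : Matrix (Fin p) (Fin m) ℝ |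
        ENNReal.ofReal (T ^ 2) ≤ ENNReal.ofReal (nrm (restr I J z) ^ 2)} = Kᶜ := by
      ext z
      simp only [Set.mem_ofPred_eq, Set.mem_compl_iff, K, not_lt]
      rw [ENNReal.ofReal_le_ofReal_iff (sq_nonneg _), sq_le_sq₀ hT (hn.nonneg _)]
    have h3 := h.lintegral_nrm_restr_sq_le hn (I := I) (J := J) (by omega) (by omega)
    rw [hI, hJ] at h3
    rw [h2] at h1
    have h4 : ENNReal.ofReal (T ^ 2) * stdGaussianMatrix p m Kᶜ ≤ ENNReal.ofReal (T ^ 2) * 2⁻¹ := by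
      refine (h1.trans h3).trans (le_of_eq ?_)
      rw [hT2, ← ENNReal.ofReal_ofNat 2, ← ENNReal.ofReal_inv_of_pos (by norm_num),
        ← ENNReal.ofReal_mul (by positivity)]
      ring_nf
    have h5 : stdGaussianMatrix p m Kᶜ ≤ 2⁻¹ :=
      (ENNReal.mul_le_mul_iff_right (ENNReal.ofReal_pos.2 hT2').ne' ENNReal.ofReal_ne_top).1 h4
    have h6 := prob_add_prob_compl (μ := stdGaussianMatrix p m) hKm
    by_contra! h7
    have h8 := ENNReal.add_lt_add_of_lt_of_le (ne_top_of_le_ne_top (by simp) h5) h7 h5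
    rw [h6, ENNReal.inv_two_add_inv_two] at h8
    exact lt_irrefl _ h8
  have key := transportProp_stdGaussianMatrix p m
    (fun z => ENNReal.ofReal (Real.exp ((max (nrm (restr I J z) - T) 0 / L) ^ 2 / 4)))
    (K.indicator 1) (Real.measurable_exp.comp (((((hm.sub_const T).max measurable_const).div_const
      L).pow_const 2).div_const 4)).ennreal_ofReal (measurable_one.indicator hKm) ?_
  · rw [lintegral_indicator_one hKm] at key
    have h1 := (mul_le_mul_right hK _).trans key
    rw [← div_eq_mul_inv] at h1
    simpa using ENNReal.div_le_iff (by norm_num) (by norm_num) |>.1 h1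
  · intro x y
    by_cases hy : y ∈ K
    · simp only [Set.indicator_of_mem hy, Pi.one_apply, mul_one]
      refine ENNReal.ofReal_le_ofReal (Real.exp_le_exp.2 ?_)
      gcongr
      rw [div_le_iff₀ hL, mul_comm]
      refine max_le ?_ (mul_nonneg hL.le (frobNorm_nonneg _))
      have h1 := h.nrm_restr_sub_le hn hk1 hk hs1 hs hI hJ x y
      have h2 : nrm (restr I J y) < T := hy
      linarith
    · simp [Set.indicator_of_notMem hy]

/-- The index set of `k × s` blocks. -/
def blocks (p m k s : ℕ) : Finset (Finset (Fin p) × Finset (Fin m)) :=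
  Finset.powersetCard k Finset.univ ×ˢ Finset.powersetCard s Finset.univ

theorem mem_blocks {k s : ℕ} {q : Finset (Fin p) × Finset (Fin m)} :
    q ∈ blocks p m k s ↔ q.1.card = k ∧ q.2.card = s := by
  simp [blocks]

theorem card_blocks (p m k s : ℕ) : (blocks p m k s).card = p.choose k * m.choose s := by
  simp [blocks]

/-- A common dominant of the squared norms of all the blocks of a Gaussian matrix. -/
theorem IsUnitarilyInvariant.exists_blocks_dominant (h : IsUnitarilyInvariant nrm)
    (hn : IsMatrixNorm nrm) {k s : ℕ} (hk1 : 1 ≤ k) (hk : k ≤ p) (hs1 : 1 ≤ s) (hs : s ≤ m) :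
    ∃ Ψ : Matrix (Fin p) (Fin m) ℝ → ℝ≥0∞, Measurable Ψ ∧
      ∫⁻ z, Ψ z ∂(stdGaussianMatrix p m) ≤ ENNReal.ofReal (168 *
        (nrm (Imat p m (min k s)) ^ 2 * ((k : ℝ) + s) + sparseLip p m k s nrm ^ 2 *
          ((k : ℝ) * Real.log (Real.exp 1 * p / k) + (s : ℝ) * Real.log (Real.exp 1 * m / s)))) ∧
      ∀ q ∈ blocks p m k s, ∀ z, ENNReal.ofReal (nrm (restr q.1 q.2 z) ^ 2) ≤ Ψ z := by
  have hL := (h.exists_half_sparseLip_le hn hk1 hk hs1 hs).1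
  have hLν := h.sparseLip_le hn hk1 hk hs1 hs
  set L := sparseLip p m k s nrm
  set ν := nrm (Imat p m (min k s))
  have hk0 : (1 : ℝ) ≤ k := by exact_mod_cast hk1
  have hs0 : (1 : ℝ) ≤ s := by exact_mod_cast hs1
  set T := Real.sqrt (80 * (ν ^ 2 * (k + s))) with hTd
  have hT : 0 ≤ T := Real.sqrt_nonneg _
  have hT2 : T ^ 2 = 80 * (ν ^ 2 * (k + s)) := Real.sq_sqrt (by positivity)
  have hCp : 0 < p.choose k := Nat.choose_pos hk
  have hCm : 0 < m.choose s := Nat.choose_pos hs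
  set N : ℝ := ((p.choose k * m.choose s : ℕ) : ℝ) with hN
  have hN1 : 1 ≤ N := by
    rw [hN]
    exact_mod_cast Nat.mul_pos hCp hCm
  have hN0 : 0 < N := by linarith
  have hlogN : Real.log N ≤ k * Real.log (Real.exp 1 * p / k) + s * Real.log (Real.exp 1 * m / s) := by
    rw [hN, Nat.cast_mul, Real.log_mul (by exact_mod_cast hCp.ne') (by exact_mod_cast hCm.ne')]
    exact add_le_add (log_choose_le hk1 hk) (log_choose_le hs1 hs)
  have hlogN0 : 0 ≤ Real.log N := Real.log_nonneg hN1
  set w : Finset (Fin p) × Finset (Fin m) → Matrix (Fin p) (Fin m) ℝ → ℝ := fun q z =>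
    (max (nrm (restr q.1 q.2 z) - T) 0 / L) ^ 2 / 4 with hw
  have hwm : ∀ q, Measurable fun z => ENNReal.ofReal (Real.exp (w q z)) := by
    intro q
    have hm : Measurable fun z => nrm (restr q.1 q.2 z) :=
      hn.measurable.comp (measurable_restr q.1 q.2)
    exact (Real.measurable_exp.comp (((((hm.sub_const T).max measurable_const).div_const
      L).pow_const 2).div_const 4)).ennreal_ofReal
  refine ⟨fun z => ENNReal.ofReal (2 * T ^ 2 + 8 * L ^ 2 * Real.log N) +
    ENNReal.ofReal (8 * L ^ 2 / N) * ∑ q ∈ blocks p m k s, ENNReal.ofReal (Real.exp (w q z)),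
    ((Finset.measurable_sum _ fun q _ => hwm q).const_mul _).const_add _, ?_, ?_⟩
  · rw [lintegral_add_left measurable_const, lintegral_const, measure_univ, mul_one,
      lintegral_const_mul _ (Finset.measurable_sum _ fun q _ => hwm q),
      lintegral_finsetSum _ fun q _ => hwm q]
    have h1 : ∑ q ∈ blocks p m k s, ∫⁻ z, ENNReal.ofReal (Real.exp (w q z))
        ∂(stdGaussianMatrix p m) ≤ ENNReal.ofReal (N * 2) := by
      refine (Finset.sum_le_card_nsmul _ _ 2 fun q hq => ?_).trans ?_
      · exact h.lintegral_exp_nrm_restr_le hn hk1 hk hs1 hs (mem_blocks.1 hq).1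
          (mem_blocks.1 hq).2 hT hT2
      · rw [card_blocks, nsmul_eq_mul, ENNReal.ofReal_mul hN0.le, hN, ENNReal.ofReal_natCast]
        simp
    refine (add_le_add_right (mul_le_mul_right h1 _) _).trans ?_
    rw [← ENNReal.ofReal_mul (by positivity), ← ENNReal.ofReal_add (by positivity) (by positivity)]
    refine ENNReal.ofReal_le_ofReal ?_
    have e : 8 * L ^ 2 / N * (N * 2) = 16 * L ^ 2 := by
      field_simp
      ring
    have h2 : L ^ 2 ≤ ν ^ 2 := pow_le_pow_left₀ hL.le hLν 2
    have h3 := mul_le_mul_of_nonneg_left hlogN (sq_nonneg L)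
    have h4 : 0 ≤ L ^ 2 * Real.log N := by positivity
    rw [e, hT2]
    nlinarith [sq_nonneg ν]
  · intro q hq z
    have h1 : ENNReal.ofReal (Real.exp (w q z)) ≤
        ∑ q ∈ blocks p m k s, ENNReal.ofReal (Real.exp (w q z)) :=
      Finset.single_le_sum (f := fun q => ENNReal.ofReal (Real.exp (w q z)))
        (fun _ _ => bot_le) hq
    refine le_trans ?_ (add_le_add_right (mul_le_mul_right h1 _) _)
    rw [← ENNReal.ofReal_mul (by positivity), ← ENNReal.ofReal_add (by positivity) (by positivity)]
    refine ENNReal.ofReal_le_ofReal ?_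
    set x := nrm (restr q.1 q.2 z) with hx
    have hx0 : 0 ≤ x := hn.nonneg _
    have h2 : w q z ≤ Real.log N + Real.exp (w q z) / N := by
      have h3 := Real.add_one_le_exp (w q z - Real.log N)
      rw [Real.exp_sub, Real.exp_log hN0] at h3
      linarith
    have h4 : x ^ 2 ≤ 2 * T ^ 2 + 8 * L ^ 2 * w q z := by
      have e : 8 * L ^ 2 * w q z = 2 * max (x - T) 0 ^ 2 := by
        rw [hw]
        simp only [← hx]
        field_simp
        ring
      rw [e]
      have h5 : x ≤ T + max (x - T) 0 := by linarith [le_max_left (x - T) 0]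
      have h6 : x ^ 2 ≤ (T + max (x - T) 0) ^ 2 := pow_le_pow_left₀ hx0 h5 2
      nlinarith [sq_nonneg (T - max (x - T) 0)]
    calc x ^ 2 ≤ 2 * T ^ 2 + 8 * L ^ 2 * w q z := h4
      _ ≤ 2 * T ^ 2 + 8 * L ^ 2 * (Real.log N + Real.exp (w q z) / N) := by gcongr
      _ = _ := by ring

end Concentration

section UpperBound

variable {p m : ℕ} {nrm : Matrix (Fin p) (Fin m) ℝ → ℝ}

/-- The largest norm of a `k × s` block. -/
noncomputable def blockNorm {k s : ℕ} (hne : (blocks p m k s).Nonempty)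
    (nrm : Matrix (Fin p) (Fin m) ℝ → ℝ) (A : Matrix (Fin p) (Fin m) ℝ) : ℝ :=
  (blocks p m k s).sup' hne fun q => nrm (restr q.1 q.2 A)

variable {k s : ℕ} {hne : (blocks p m k s).Nonempty}

theorem nrm_restr_le_blockNorm {I : Finset (Fin p)} {J : Finset (Fin m)} (hI : I.card = k)
    (hJ : J.card = s) (A : Matrix (Fin p) (Fin m) ℝ) :
    nrm (restr I J A) ≤ blockNorm hne nrm A :=
  Finset.le_sup' (fun q : Finset (Fin p) × Finset (Fin m) => nrm (restr q.1 q.2 A))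
    (mem_blocks.2 ⟨hI, hJ⟩ : (I, J) ∈ blocks p m k s)

theorem exists_blockNorm_eq (A : Matrix (Fin p) (Fin m) ℝ) :
    ∃ q ∈ blocks p m k s, blockNorm hne nrm A = nrm (restr q.1 q.2 A) :=
  Finset.exists_mem_eq_sup' hne _

theorem IsMatrixNorm.blockNorm_nonneg (hn : IsMatrixNorm nrm) (A : Matrix (Fin p) (Fin m) ℝ) :
    0 ≤ blockNorm hne nrm A := by
  obtain ⟨q, -, h⟩ := exists_blockNorm_eq (hne := hne) (nrm := nrm) A
  exact h ▸ hn.nonneg _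

theorem IsMatrixNorm.blockNorm_sub_le (hn : IsMatrixNorm nrm) (A B : Matrix (Fin p) (Fin m) ℝ) :
    blockNorm hne nrm (A - B) ≤ blockNorm hne nrm A + blockNorm hne nrm B := by
  refine Finset.sup'_le _ _ fun q hq => ?_
  rw [restr_sub]
  exact (hn.sub_le _ _).trans (add_le_add
    (nrm_restr_le_blockNorm (mem_blocks.1 hq).1 (mem_blocks.1 hq).2 _)
    (nrm_restr_le_blockNorm (mem_blocks.1 hq).1 (mem_blocks.1 hq).2 _))

theorem continuous_restr (I : Finset (Fin p)) (J : Finset (Fin m)) :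
    Continuous (restr (p := p) (m := m) I J) := by
  refine continuous_matrix fun i j => ?_
  by_cases h : i ∈ I ∧ j ∈ J
  · simpa [restr, h] using continuous_id.matrix_elem i j
  · simpa [restr, h] using continuous_const

theorem IsMatrixNorm.continuous_blockNorm (hn : IsMatrixNorm nrm) :
    Continuous (blockNorm hne nrm) :=
  Continuous.finset_sup'_apply hne fun q _ => hn.continuous.comp (continuous_restr q.1 q.2)

theorem IsMatrixNorm.measurable_blockNorm (hn : IsMatrixNorm nrm) :
    Measurable (blockNorm hne nrm) := by
  have := Finset.measurable_sup' (s := blocks p m k s) hne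
    (f := fun q (A : Matrix (Fin p) (Fin m) ℝ) => nrm (restr q.1 q.2 A))
    fun q _ => hn.measurable.comp (measurable_restr q.1 q.2)
  convert this using 1
  ext A
  simp [blockNorm, Finset.sup'_apply]

/-- The norm of a difference of two sparse matrices is controlled by the `k × s` blocks. -/
theorem IsUnitarilyInvariant.nrm_sub_le_blockNorm (h : IsUnitarilyInvariant nrm)
    (hn : IsMatrixNorm nrm) (hk : k ≤ p) (hs : s ≤ m) {A B : Matrix (Fin p) (Fin m) ℝ}
    (hA : A ∈ SubmatrixSparse p m k s) (hB : B ∈ SubmatrixSparse p m k s) :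
    nrm (A - B) ≤ 3 * blockNorm hne nrm (A - B) := by
  obtain ⟨I, J, hI, hJ, hA⟩ := exists_restr_eq_of_mem_submatrixSparse hk hs hA
  obtain ⟨I', J', hI', hJ', hB⟩ := exists_restr_eq_of_mem_submatrixSparse hk hs hB
  have e : A - B = restr I J (A - B) + (restr (I' \ I) J' (A - B) + restr I' (J' \ J)
      (restr I J' (A - B))) := by
    rw [← hA, ← hB]
    ext i j
    simp only [restr, Matrix.of_apply, Matrix.add_apply, Matrix.sub_apply, Finset.mem_sdiff]
    grind
  have h1 : nrm (restr (I' \ I) J' (A - B)) ≤ blockNorm hne nrm (A - B) := by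
    have e1 : restr (I' \ I) J' (A - B) = restr (I' \ I) J' (restr I' J' (A - B)) := by
      rw [restr_restr, Finset.inter_self, Finset.inter_eq_left.2 Finset.sdiff_subset]
    rw [e1]
    exact (h.nrm_restr_le hn _ _ _).trans (nrm_restr_le_blockNorm hI' hJ' _)
  have h2 : nrm (restr I' (J' \ J) (restr I J' (A - B))) ≤ blockNorm hne nrm (A - B) := by
    have e1 : restr I' (J' \ J) (restr I J' (A - B)) =
        restr I (J' \ J) (restr I' J' (A - B)) := by
      rw [restr_restr, restr_restr, Finset.inter_comm]
    rw [e1]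
    exact (h.nrm_restr_le hn _ _ _).trans (nrm_restr_le_blockNorm hI' hJ' _)
  have h3 : nrm (restr I J (A - B)) ≤ blockNorm hne nrm (A - B) := nrm_restr_le_blockNorm hI hJ _
  have h4 := hn.1 (restr I J (A - B)) (restr (I' \ I) J' (A - B) + restr I' (J' \ J)
      (restr I J' (A - B)))
  have h5 := hn.1 (restr (I' \ I) J' (A - B)) (restr I' (J' \ J) (restr I J' (A - B)))
  rw [← e] at h4
  linarith

/-- A measurable near-minimizer of `D ↦ blockNorm (Y - D)` over the sparse matrices. -/
theorem IsUnitarilyInvariant.exists_measurable_selector (h : IsUnitarilyInvariant nrm)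
    (hn : IsMatrixNorm nrm) (hne : (blocks p m k s).Nonempty) (hk : k ≤ p) (hs : s ≤ m)
    {ε : ℝ} (hε : 0 < ε) :
    ∃ est : Matrix (Fin p) (Fin m) ℝ → Matrix (Fin p) (Fin m) ℝ, Measurable est ∧
      ∀ M ∈ SubmatrixSparse p m k s, ∀ z,
        nrm (est (M + z) - M) ≤ 6 * blockNorm hne nrm z + 3 * ε := by
  classical
  have : SecondCountableTopology (Matrix (Fin p) (Fin m) ℝ) :=
    inferInstanceAs (SecondCountableTopology (Fin p → Fin m → ℝ))
  have : Nonempty (SubmatrixSparse p m k s) := ⟨⟨0, by simp [SubmatrixSparse]⟩⟩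
  set D : ℕ → Matrix (Fin p) (Fin m) ℝ := fun n =>
    (TopologicalSpace.denseSeq (SubmatrixSparse p m k s) n : Matrix (Fin p) (Fin m) ℝ) with hD
  have hDF : ∀ n, D n ∈ SubmatrixSparse p m k s := fun n => Subtype.coe_prop _
  have hDd : ∀ M ∈ SubmatrixSparse p m k s, ∀ z, ∀ δ > 0, ∃ n,
      blockNorm hne nrm (M + z - D n) < blockNorm hne nrm z + δ := by
    intro M hM z δ hδ
    have hc : Continuous fun x : SubmatrixSparse p m k s => blockNorm hne nrm (M + z - x) :=
      hn.continuous_blockNorm.comp (continuous_const.sub continuous_subtype_val)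
    obtain ⟨n, hx⟩ := (TopologicalSpace.denseRange_denseSeq
      (SubmatrixSparse p m k s)).exists_mem_open
      (isOpen_lt hc (continuous_const (y := blockNorm hne nrm z + δ)))
      ⟨⟨M, hM⟩, by simpa using hδ⟩
    exact ⟨n, hx⟩
  set F : Matrix (Fin p) (Fin m) ℝ → ℝ := fun Y => ⨅ n, blockNorm hne nrm (Y - D n) with hF
  have hbdd : ∀ Y, BddBelow (Set.range fun n => blockNorm hne nrm (Y - D n)) := fun Y =>
    ⟨0, by rintro _ ⟨n, rfl⟩; exact hn.blockNorm_nonneg _⟩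
  have hmeas : ∀ n, Measurable fun Y : Matrix (Fin p) (Fin m) ℝ => blockNorm hne nrm (Y - D n) := by
    intro n
    refine hn.measurable_blockNorm.comp (measurable_of_entries fun i j => ?_)
    exact (measurable_entry i j).sub_const _
  have hFm : Measurable F := Measurable.iInf hmeas
  have hex : ∀ Y, ∃ n, blockNorm hne nrm (Y - D n) < F Y + ε := fun Y =>
    exists_lt_of_ciInf_lt (lt_add_of_pos_right _ hε)
  refine ⟨fun Y => D (Nat.find (hex Y)), (measurable_of_countable D).comp
    (measurable_find hex fun n => measurableSet_lt (hmeas n) (hFm.add_const ε)), ?_⟩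
  intro M hM z
  set n := Nat.find (hex (M + z)) with hnn
  have h1 : blockNorm hne nrm (M + z - D n) < F (M + z) + ε := Nat.find_spec (hex (M + z))
  have h2 : F (M + z) ≤ blockNorm hne nrm z := by
    refine le_of_forall_pos_le_add fun δ hδ => ?_
    obtain ⟨l, hl⟩ := hDd M hM z δ hδ
    exact (ciInf_le (hbdd _) l).trans hl.le
  have h3 := h.nrm_sub_le_blockNorm (hne := hne) hn hk hs (hDF n) hM
  have h4 := hn.blockNorm_sub_le (hne := hne) z (M + z - D n)
  have e : z - (M + z - D n) = D n - M := by abel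
  rw [e] at h4
  linarith

theorem one_le_log_exp_mul_div {n k : ℕ} (hk1 : 1 ≤ k) (hk : k ≤ n) :
    1 ≤ Real.log (Real.exp 1 * n / k) := by
  have hk0 : (0 : ℝ) < k := by exact_mod_cast hk1
  have hkn : (k : ℝ) ≤ n := by exact_mod_cast hk
  rw [Real.le_log_iff_exp_le (by have := Real.exp_pos 1; have := hk0.trans_le hkn; positivity),
    le_div_iff₀ hk0]
  gcongr

theorem IsUnitarilyInvariant.exists_estimator (h : IsUnitarilyInvariant nrm)
    (hn : IsMatrixNorm nrm) {k s : ℕ} (hk1 : 1 ≤ k) (hk : k ≤ p) (hs1 : 1 ≤ s) (hs : s ≤ m) :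
    ∃ est : Matrix (Fin p) (Fin m) ℝ → Matrix (Fin p) (Fin m) ℝ, Measurable est ∧
      ∀ M ∈ SubmatrixSparse p m k s,
        ∫⁻ z, ENNReal.ofReal (nrm (est (M + z) - M) ^ 2) ∂(stdGaussianMatrix p m) ≤
          ENNReal.ofReal (12114 * (nrm (Imat p m (min k s)) ^ 2 * ((k : ℝ) + s) +
            sparseLip p m k s nrm ^ 2 * ((k : ℝ) * Real.log (Real.exp 1 * p / k) +
              (s : ℝ) * Real.log (Real.exp 1 * m / s)))) := by
  have hne : (blocks p m k s).Nonempty := by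
    rw [← Finset.card_pos, card_blocks]
    exact Nat.mul_pos (Nat.choose_pos hk) (Nat.choose_pos hs)
  obtain ⟨Ψ, hΨm, hΨi, hΨ⟩ := h.exists_blocks_dominant hn hk1 hk hs1 hs
  have hν : 0 < nrm (Imat p m (min k s)) := Imat_pos hn (by omega) (by omega) (by omega)
  obtain ⟨est, hest, hb⟩ := h.exists_measurable_selector hn hne hk hs hν
  refine ⟨est, hest, fun M hM => ?_⟩
  have hk0 : (1 : ℝ) ≤ k := by exact_mod_cast hk1
  have hs0 : (1 : ℝ) ≤ s := by exact_mod_cast hs1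
  have hlk := one_le_log_exp_mul_div hk1 hk
  have hls := one_le_log_exp_mul_div hs1 hs
  set ν := nrm (Imat p m (min k s))
  set R := ν ^ 2 * ((k : ℝ) + s) + sparseLip p m k s nrm ^ 2 *
    ((k : ℝ) * Real.log (Real.exp 1 * p / k) + (s : ℝ) * Real.log (Real.exp 1 * m / s)) with hR
  have hνR : ν ^ 2 ≤ R := by
    have : 0 ≤ sparseLip p m k s nrm ^ 2 * ((k : ℝ) * Real.log (Real.exp 1 * p / k) +
      (s : ℝ) * Real.log (Real.exp 1 * m / s)) := by positivity
    nlinarith [sq_nonneg ν]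
  calc ∫⁻ z, ENNReal.ofReal (nrm (est (M + z) - M) ^ 2) ∂(stdGaussianMatrix p m)
      ≤ ∫⁻ z, (ENNReal.ofReal (18 * ν ^ 2) + ENNReal.ofReal 72 * Ψ z)
          ∂(stdGaussianMatrix p m) := by
        refine lintegral_mono fun z => ?_
        obtain ⟨q, hq, hqe⟩ := exists_blockNorm_eq (hne := hne) (nrm := nrm) z
        refine le_trans ?_ (add_le_add_right (mul_le_mul_right (hΨ q hq z) _) _)
        rw [← ENNReal.ofReal_mul (by norm_num), ← ENNReal.ofReal_add (by positivity)
          (by positivity), ← hqe]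
        refine ENNReal.ofReal_le_ofReal ?_
        have h1 := pow_le_pow_left₀ (hn.nonneg _) (hb M hM z) 2
        nlinarith [sq_nonneg (6 * blockNorm hne nrm z - 3 * ν)]
    _ = ENNReal.ofReal (18 * ν ^ 2) + ENNReal.ofReal 72 *
          ∫⁻ z, Ψ z ∂(stdGaussianMatrix p m) := by
        rw [lintegral_add_left measurable_const, lintegral_const, measure_univ, mul_one,
          lintegral_const_mul _ hΨm]
    _ ≤ ENNReal.ofReal (18 * ν ^ 2) + ENNReal.ofReal 72 * ENNReal.ofReal (168 * R) := by
        gcongr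
    _ ≤ _ := by
        rw [← ENNReal.ofReal_mul (by norm_num), ← ENNReal.ofReal_add (by positivity)
          (by have := (sq_nonneg ν).trans hνR; positivity)]
        refine ENNReal.ofReal_le_ofReal ?_
        linarith

end UpperBound

section BayesLowerBound

variable {p m : ℕ} {nrm : Matrix (Fin p) (Fin m) ℝ → ℝ}

theorem IsMatrixNorm.sq_sub_le (hn : IsMatrixNorm nrm) (A B : Matrix (Fin p) (Fin m) ℝ) :
    ENNReal.ofReal (nrm (A - B) ^ 2) ≤
      2 * (ENNReal.ofReal (nrm A ^ 2) + ENNReal.ofReal (nrm B ^ 2)) := by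
  rw [← ENNReal.ofReal_add (sq_nonneg _) (sq_nonneg _), ← ENNReal.ofReal_ofNat 2,
    ← ENNReal.ofReal_mul (by norm_num)]
  refine ENNReal.ofReal_le_ofReal ?_
  have h1 := pow_le_pow_left₀ (hn.nonneg _) (hn.sub_le A B) 2
  nlinarith [sq_nonneg (nrm A - nrm B)]

theorem IsMatrixNorm.measurable_sq_comp (hn : IsMatrixNorm nrm) {α : Type*} [MeasurableSpace α]
    {f : α → Matrix (Fin p) (Fin m) ℝ} (hf : Measurable f) :
    Measurable fun x => ENNReal.ofReal (nrm (f x) ^ 2) :=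
  ((hn.measurable.comp hf).pow_const 2).ennreal_ofReal

theorem measurable_matrix_add {α : Type*} [MeasurableSpace α]
    {f g : α → Matrix (Fin p) (Fin m) ℝ} (hf : Measurable f) (hg : Measurable g) :
    Measurable fun x => f x + g x :=
  measurable_of_entries fun i j =>
    ((measurable_entry i j).comp hf).add ((measurable_entry i j).comp hg)

theorem measurable_matrix_sub {α : Type*} [MeasurableSpace α]
    {f g : α → Matrix (Fin p) (Fin m) ℝ} (hf : Measurable f) (hg : Measurable g) :
    Measurable fun x => f x - g x :=
  measurable_of_entries fun i j =>
    ((measurable_entry i j).comp hf).sub ((measurable_entry i j).comp hg)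

/-- The Bayes risk under a Gaussian prior on a single block. -/
theorem IsMatrixNorm.le_lintegral_bayes (hn : IsMatrixNorm nrm) (I : Finset (Fin p))
    (J : Finset (Fin m)) {est : Matrix (Fin p) (Fin m) ℝ → Matrix (Fin p) (Fin m) ℝ}
    (hest : Measurable est) :
    ∫⁻ z, ENNReal.ofReal (nrm (restr I J z) ^ 2) ∂(stdGaussianMatrix p m) ≤
      4 * ∫⁻ x, ∫⁻ z, ENNReal.ofReal (nrm (est (restr I J x + z) - restr I J x) ^ 2)
        ∂(stdGaussianMatrix p m) ∂(stdGaussianMatrix p m) := by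
  classical
  set γ := stdGaussianMatrix p m
  set R := restr (p := p) (m := m) I J with hR
  have hRm : Measurable R := measurable_restr I J
  have hYm : Measurable fun q : Matrix (Fin p) (Fin m) ℝ × Matrix (Fin p) (Fin m) ℝ =>
      est (R q.1 + q.2) :=
    hest.comp (measurable_matrix_add (hRm.comp measurable_fst) measurable_snd)
  have hm1 := hn.measurable_sq_comp (measurable_matrix_sub hYm (hRm.comp measurable_fst))
  have hm2 := hn.measurable_sq_comp (measurable_matrix_sub hYm (hRm.comp measurable_snd))
  simp only [Function.comp_def] at hm1 hm2
  have hswap : ∫⁻ q, ENNReal.ofReal (nrm (est (R q.1 + q.2) - R q.1) ^ 2) ∂(γ.prod γ) =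
      ∫⁻ q, ENNReal.ofReal (nrm (est (R q.1 + q.2) - R q.2) ^ 2) ∂(γ.prod γ) := by
    have h1 := (measurePreserving_swap_stdGaussianMatrix (p := p) (m := m)
      (fun i j => decide (i ∈ I ∧ j ∈ J))).lintegral_comp hm1
    rw [← h1]
    refine lintegral_congr fun q => ?_
    have e1 : ∀ q : Matrix (Fin p) (Fin m) ℝ × Matrix (Fin p) (Fin m) ℝ,
      R (of fun i j => if decide (i ∈ I ∧ j ∈ J) = true then q.2 i j else q.1 i j) = R q.2 := by
      intro q
      ext i j
      simp only [hR, restr, Matrix.of_apply]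
      grind
    have e2 : R q.2 + (of fun i j => if decide (i ∈ I ∧ j ∈ J) = true then q.1 i j else q.2 i j)
        = R q.1 + q.2 := by
      ext i j
      simp only [hR, restr, Matrix.of_apply, Matrix.add_apply]
      grind
    simp only [e1, e2]
  set B := ∫⁻ q, ENNReal.ofReal (nrm (est (R q.1 + q.2) - R q.1) ^ 2) ∂(γ.prod γ) with hB
  have hBe : ∫⁻ x, ∫⁻ z, ENNReal.ofReal (nrm (est (R x + z) - R x) ^ 2) ∂γ ∂γ = B :=
    (lintegral_prod _ hm1.aemeasurable).symm
  set D := ∫⁻ q, ENNReal.ofReal (nrm (R q.2 - R q.1) ^ 2) ∂(γ.prod γ) with hD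
  have h1 : D ≤ 2 * (B + B) := by
    have e : B + B = ∫⁻ q, (ENNReal.ofReal (nrm (est (R q.1 + q.2) - R q.1) ^ 2) +
        ENNReal.ofReal (nrm (est (R q.1 + q.2) - R q.2) ^ 2)) ∂(γ.prod γ) := by
      rw [lintegral_add_left hm1, ← hswap]
    have hm3 := hm1.add hm2
    simp only [Pi.add_def] at hm3
    rw [e, ← lintegral_const_mul _ hm3]
    refine lintegral_mono fun q => ?_
    have e : R q.2 - R q.1 = (est (R q.1 + q.2) - R q.1) - (est (R q.1 + q.2) - R q.2) := by abel
    rw [e]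
    exact hn.sq_sub_le _ _
  have h2 : ∫⁻ z, ENNReal.ofReal (nrm (R z) ^ 2) ∂γ ≤ D := by
    have hneg : ∀ A, R (-A) = -R A := by
      intro A
      have := restr_smul I J (-1) A
      simpa using this
    have hma : Measurable fun z => ENNReal.ofReal (nrm (R z) ^ 2) := hn.measurable_sq_comp hRm
    have hmd := hn.measurable_sq_comp (measurable_matrix_sub
      ((hRm.comp measurable_snd : Measurable fun q : Matrix (Fin p) (Fin m) ℝ ×
        Matrix (Fin p) (Fin m) ℝ => R q.2)) (hRm.comp measurable_fst))
    simp only [Function.comp_def] at hmd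
    rw [hD, lintegral_prod _ hmd.aemeasurable]
    have h3 : ∀ x, ∫⁻ z, ENNReal.ofReal (nrm (R z) ^ 2) ∂γ ≤
        ∫⁻ z, ENNReal.ofReal (nrm (R z - R x) ^ 2) ∂γ := by
      intro x
      have hmx : Measurable fun z => ENNReal.ofReal (nrm (R z - R x) ^ 2) :=
        hn.measurable_sq_comp (measurable_matrix_sub hRm measurable_const)
      have h4 := (measurePreserving_neg_stdGaussianMatrix p m).lintegral_comp hmx
      have h5 : 4 * ∫⁻ z, ENNReal.ofReal (nrm (R z) ^ 2) ∂γ ≤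
          4 * ∫⁻ z, ENNReal.ofReal (nrm (R z - R x) ^ 2) ∂γ := by
        calc 4 * ∫⁻ z, ENNReal.ofReal (nrm (R z) ^ 2) ∂γ
            = ∫⁻ z, 4 * ENNReal.ofReal (nrm (R z) ^ 2) ∂γ := (lintegral_const_mul _ hma).symm
          _ ≤ ∫⁻ z, 2 * (ENNReal.ofReal (nrm (R z - R x) ^ 2) +
                ENNReal.ofReal (nrm (R (-z) - R x) ^ 2)) ∂γ := by
              refine lintegral_mono fun z => ?_
              have e : (2 : ℝ) • R z = (R z - R x) - (R (-z) - R x) := by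
                rw [hneg, two_smul]
                abel
              have h6 := hn.sq_sub_le (R z - R x) (R (-z) - R x)
              rw [← e, hn.2.1, mul_pow, ENNReal.ofReal_mul (by positivity)] at h6
              convert h6 using 2
              norm_num
          _ = 2 * (∫⁻ z, ENNReal.ofReal (nrm (R z - R x) ^ 2) ∂γ +
                ∫⁻ z, ENNReal.ofReal (nrm (R z - R x) ^ 2) ∂γ) := by
              rw [lintegral_const_mul, lintegral_add_left hmx, h4]
              exact hmx.add (hmx.comp (measurePreserving_neg_stdGaussianMatrix p m).measurable)
          _ = _ := by ring
      exact (ENNReal.mul_le_mul_iff_right (by norm_num) (by norm_num)).1 h5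
    calc _ = ∫⁻ _, ∫⁻ z, ENNReal.ofReal (nrm (R z) ^ 2) ∂γ ∂γ := by simp
      _ ≤ _ := lintegral_mono h3
  rw [hBe]
  calc _ ≤ D := h2
    _ ≤ _ := h1
    _ = _ := by ring

theorem IsUnitarilyInvariant.exists_le_risk_of_block (h : IsUnitarilyInvariant nrm)
    (hn : IsMatrixNorm nrm) {k s : ℕ} (hk1 : 1 ≤ k) (hk : k ≤ p) (hs1 : 1 ≤ s) (hs : s ≤ m)
    {est : Matrix (Fin p) (Fin m) ℝ → Matrix (Fin p) (Fin m) ℝ} (hest : Measurable est) :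
    ∃ M ∈ SubmatrixSparse p m k s,
      ENNReal.ofReal (1 / 1280 * (nrm (Imat p m (min k s)) ^ 2 * ((k : ℝ) + s))) ≤
        ∫⁻ z, ENNReal.ofReal (nrm (est (M + z) - M) ^ 2) ∂(stdGaussianMatrix p m) := by
  have hν : 0 < nrm (Imat p m (min k s)) := Imat_pos hn (by omega) (by omega) (by omega)
  obtain ⟨I, -, hI⟩ := Finset.exists_subset_card_eq (s := (Finset.univ : Finset (Fin p)))
    (n := k) (by simpa using hk)
  obtain ⟨J, -, hJ⟩ := Finset.exists_subset_card_eq (s := (Finset.univ : Finset (Fin m)))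
    (n := s) (by simpa using hs)
  have hk0 : (0 : ℝ) < k := by exact_mod_cast hk1
  by_contra! hcon
  have h1 := h.le_lintegral_nrm_restr_sq hn (I := I) (J := J) (by omega) (by omega)
  rw [hI, hJ] at h1
  have h2 := h1.trans (hn.le_lintegral_bayes I J hest)
  set a := nrm (Imat p m (min k s)) ^ 2 * ((k : ℝ) + s) with ha
  have ha0 : 0 < a := by positivity
  have h3 : ENNReal.ofReal (1 / 160 * a) ≤ 4 * ENNReal.ofReal (1 / 1280 * a) := by
    refine h2.trans (mul_le_mul_right ?_ _)
    calc _ ≤ ∫⁻ _, ENNReal.ofReal (1 / 1280 * a) ∂(stdGaussianMatrix p m) :=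
          lintegral_mono fun x => (hcon _ (restr_mem_submatrixSparse hI.le hJ.le x)).le
      _ = _ := by simp
  rw [← ENNReal.ofReal_ofNat 4, ← ENNReal.ofReal_mul (by norm_num),
    ENNReal.ofReal_le_ofReal_iff (by positivity)] at h3
  linarith

end BayesLowerBound

section FiniteFamily

variable {p m : ℕ} {nrm : Matrix (Fin p) (Fin m) ℝ → ℝ}

/-- If no ball of radius `ρ` contains many members of a finite family of matrices of Frobenius norm
`√t`, then no estimator has risk below `ρ ^ 2 / 2` on the whole family. -/
theorem IsMatrixNorm.exists_le_risk_of_family (hn : IsMatrixNorm nrm) {ι : Type*} [Fintype ι]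
    [Nonempty ι] (M : ι → Matrix (Fin p) (Fin m) ℝ) {t ρ n : ℝ} (hM : ∀ a, frobNorm (M a) ^ 2 = t)
    (hρ : 0 < ρ)
    (hball : ∀ (x : Matrix (Fin p) (Fin m) ℝ) (S : Finset ι), (∀ a ∈ S, nrm (x - M a) < ρ) →
      (S.card : ℝ) ≤ n)
    (hnt : n * Real.exp t ≤ Fintype.card ι / 8)
    {est : Matrix (Fin p) (Fin m) ℝ → Matrix (Fin p) (Fin m) ℝ} (hest : Measurable est) :
    ∃ a, ENNReal.ofReal (ρ ^ 2 / 2) ≤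
        ∫⁻ z, ENNReal.ofReal (nrm (est (M a + z) - M a) ^ 2) ∂(stdGaussianMatrix p m) := by
  classical
  by_contra! hcon
  set γ := stdGaussianMatrix p m
  set K : ι → Set (Matrix (Fin p) (Fin m) ℝ) := fun a => {y | nrm (est y - M a) < ρ} with hK
  have hKm : ∀ a, MeasurableSet (K a) := fun a =>
    measurableSet_lt (hn.measurable.comp (measurable_matrix_sub hest measurable_const))
      measurable_const
  set f : ι → Matrix (Fin p) (Fin m) ℝ → ℝ := fun a => (K a).indicator 1 with hf
  have hfm : ∀ a, Measurable (f a) := fun a => measurable_one.indicator (hKm a)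
  have hf0 : ∀ a z, 0 ≤ f a z := fun a z => Set.indicator_nonneg (fun _ _ => zero_le_one) _
  have hhalf : ∀ a, ENNReal.ofReal (1 / 2) ≤ ∫⁻ z, ENNReal.ofReal (f a (M a + z)) ∂γ := by
    intro a
    have h1 : ENNReal.ofReal 1 ≤ ENNReal.ofReal (1 / 2) +
        ∫⁻ z, ENNReal.ofReal (f a (M a + z)) ∂γ := by
      have hm : Measurable fun z => ENNReal.ofReal (nrm (est (M a + z) - M a) ^ 2) :=
        hn.measurable_sq_comp (measurable_matrix_sub
          (hest.comp (measurable_matrix_add measurable_const measurable_id)) measurable_const)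
      calc ENNReal.ofReal 1 = ∫⁻ _, ENNReal.ofReal 1 ∂γ := by simp
        _ ≤ ∫⁻ z, (ENNReal.ofReal (1 / ρ ^ 2) * ENNReal.ofReal (nrm (est (M a + z) - M a) ^ 2) +
              ENNReal.ofReal (f a (M a + z))) ∂γ := by
            refine lintegral_mono fun z => ?_
            rw [← ENNReal.ofReal_mul (by positivity), ← ENNReal.ofReal_add (by positivity)
              (hf0 _ _)]
            refine ENNReal.ofReal_le_ofReal ?_
            by_cases hz : M a + z ∈ K a
            · have : f a (M a + z) = 1 := by simp [hf, hz]
              rw [this]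
              have : 0 ≤ 1 / ρ ^ 2 * nrm (est (M a + z) - M a) ^ 2 := by positivity
              linarith
            · have h2 : ρ ≤ nrm (est (M a + z) - M a) := not_lt.1 hz
              have h3 := pow_le_pow_left₀ hρ.le h2 2
              have : 1 ≤ 1 / ρ ^ 2 * nrm (est (M a + z) - M a) ^ 2 := by
                rw [one_div, inv_mul_eq_div, le_div_iff₀ (by positivity)]
                linarith
              linarith [hf0 a (M a + z)]
        _ = ENNReal.ofReal (1 / ρ ^ 2) *
              ∫⁻ z, ENNReal.ofReal (nrm (est (M a + z) - M a) ^ 2) ∂γ +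
              ∫⁻ z, ENNReal.ofReal (f a (M a + z)) ∂γ := by
            rw [lintegral_add_left (hm.const_mul _), lintegral_const_mul _ hm]
        _ ≤ ENNReal.ofReal (1 / ρ ^ 2) * ENNReal.ofReal (ρ ^ 2 / 2) +
              ∫⁻ z, ENNReal.ofReal (f a (M a + z)) ∂γ := by
            gcongr
            exact (hcon a).le
        _ = _ := by
            rw [← ENNReal.ofReal_mul (by positivity)]
            congr 2
            field_simp
    have h2 : ENNReal.ofReal (1 / 2) + ENNReal.ofReal (1 / 2) ≤ ENNReal.ofReal (1 / 2) +
        ∫⁻ z, ENNReal.ofReal (f a (M a + z)) ∂γ := by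
      rw [← ENNReal.ofReal_add (by norm_num) (by norm_num)]
      norm_num at h1 ⊢
      exact h1
    exact ENNReal.le_of_add_le_add_left ENNReal.ofReal_ne_top h2
  set l : ι → Matrix (Fin p) (Fin m) ℝ → ℝ := fun a z => Real.exp (frobInner (M a) z - t / 2)
    with hl
  have hlm : ∀ a, Measurable (l a) := fun a =>
    Real.measurable_exp.comp ((measurable_frobInner (M a)).sub_const _)
  have hl2 : ∀ a, ∫⁻ z, ENNReal.ofReal (l a z ^ 2) ∂γ = ENNReal.ofReal (Real.exp t) := by
    intro a
    have h1 := lintegral_exp_frobInner ((2 : ℝ) • M a)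
    have e1 : frobNorm ((2 : ℝ) • M a) ^ 2 / 2 = 2 * t := by
      rw [frobNorm_smul, mul_pow, hM]
      norm_num
      ring
    have e2 : ∀ z, frobInner ((2 : ℝ) • M a) z = 2 * frobInner (M a) z := by
      intro z
      simp only [frobInner, Finset.mul_sum, Matrix.smul_apply, smul_eq_mul, mul_assoc]
    rw [e1] at h1
    simp_rw [e2] at h1
    calc _ = ∫⁻ z, ENNReal.ofReal (Real.exp (-t)) *
          ENNReal.ofReal (Real.exp (2 * frobInner (M a) z)) ∂γ := by
          refine lintegral_congr fun z => ?_
          rw [← ENNReal.ofReal_mul (Real.exp_nonneg _), ← Real.exp_add, hl, ← Real.exp_nat_mul]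
          congr 2
          push_cast
          ring
      _ = _ := by
          rw [lintegral_const_mul, h1, ← ENNReal.ofReal_mul (Real.exp_nonneg _), ← Real.exp_add]
          · ring_nf
          · exact (Real.measurable_exp.comp
              ((measurable_frobInner (M a)).const_mul 2)).ennreal_ofReal
  have hshift : ∀ a, ∫⁻ z, ENNReal.ofReal (f a (M a + z)) ∂γ =
      ∫⁻ z, ENNReal.ofReal (l a z * f a z) ∂γ := by
    intro a
    have h1 := lintegral_stdGaussianMatrix_add (M a) (f := fun z => ENNReal.ofReal (f a z))
      (hfm a).ennreal_ofReal
    rw [h1]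
    refine lintegral_congr fun z => ?_
    rw [← ENNReal.ofReal_mul (Real.exp_nonneg _), hM]
  have hlf : ∀ a, Measurable fun z => ENNReal.ofReal (l a z * f a z) := fun a =>
    ((hlm a).mul (hfm a)).ennreal_ofReal
  have hlq : ∀ a, Measurable fun z => ENNReal.ofReal (l a z ^ 2) := fun a =>
    ((hlm a).pow_const 2).ennreal_ofReal
  set N : ℝ := ((Fintype.card ι : ℕ) : ℝ) with hN
  have hN0 : 0 < N := by
    have : 0 < Fintype.card ι := Fintype.card_pos
    rw [hN]
    exact_mod_cast this
  have hn0 : 0 ≤ n := by simpa using hball 0 ∅ (by simp)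
  have hup : ∑ a, ∫⁻ z, ENNReal.ofReal (l a z * f a z) ∂γ ≤ ENNReal.ofReal (3 / 8 * N) := by
    calc _ = ∫⁻ z, ∑ a, ENNReal.ofReal (l a z * f a z) ∂γ :=
          (lintegral_finsetSum _ fun a _ => hlf a).symm
      _ ≤ ∫⁻ z, (ENNReal.ofReal (Real.exp t * n) +
            ENNReal.ofReal (1 / (4 * Real.exp t)) * ∑ a, ENNReal.ofReal (l a z ^ 2)) ∂γ := by
          refine lintegral_mono fun z => ?_
          rw [← ENNReal.ofReal_sum_of_nonneg fun a _ => mul_nonneg (Real.exp_nonneg _) (hf0 _ _),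
            ← ENNReal.ofReal_sum_of_nonneg fun a _ => sq_nonneg _,
            ← ENNReal.ofReal_mul (by positivity), ← ENNReal.ofReal_add (by positivity)
              (mul_nonneg (by positivity) (Finset.sum_nonneg fun a _ => sq_nonneg _))]
          refine ENNReal.ofReal_le_ofReal ?_
          have h1 : ∑ a, f a z ≤ n := by
            refine le_trans (le_of_eq ?_) (hball (est z)
              (Finset.univ.filter fun a => nrm (est z - M a) < ρ) (by simp))
            simp [hf, hK, Set.indicator_apply, Finset.sum_boole]
          calc ∑ a, l a z * f a z ≤
              ∑ a, (Real.exp t * f a z + 1 / (4 * Real.exp t) * l a z ^ 2) := by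
                refine Finset.sum_le_sum fun a _ => ?_
                have hff : f a z ^ 2 = f a z := by
                  by_cases hz : z ∈ K a <;> simp [hf, hz]
                have e : Real.exp t * f a z + 1 / (4 * Real.exp t) * l a z ^ 2 - l a z * f a z =
                    (2 * Real.exp t * f a z - l a z) ^ 2 / (4 * Real.exp t) := by
                  have := (Real.exp_pos t).ne'
                  field_simp
                  linear_combination (-4 * Real.exp t ^ 2) * hff
                have : 0 ≤ (2 * Real.exp t * f a z - l a z) ^ 2 / (4 * Real.exp t) := by positivity
                linarith
            _ = Real.exp t * ∑ a, f a z + 1 / (4 * Real.exp t) * ∑ a, l a z ^ 2 := by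
                rw [Finset.sum_add_distrib, Finset.mul_sum, Finset.mul_sum]
            _ ≤ _ := by gcongr
      _ = ENNReal.ofReal (Real.exp t * n) +
            ENNReal.ofReal (1 / (4 * Real.exp t)) * ∑ a, ∫⁻ z, ENNReal.ofReal (l a z ^ 2) ∂γ := by
          rw [lintegral_add_left measurable_const, lintegral_const, measure_univ, mul_one,
            lintegral_const_mul _ (Finset.measurable_sum _ fun a _ => hlq a),
            lintegral_finsetSum _ fun a _ => hlq a]
      _ = ENNReal.ofReal (Real.exp t * n + N / 4) := by
          simp_rw [hl2]
          rw [Finset.sum_const, nsmul_eq_mul, Finset.card_univ, ← ENNReal.ofReal_natCast,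
            ← ENNReal.ofReal_mul (by positivity), ← ENNReal.ofReal_mul (by positivity),
            ← ENNReal.ofReal_add (by positivity) (by positivity)]
          congr 2
          have := (Real.exp_pos t).ne'
          rw [← hN]
          field_simp
      _ ≤ _ := by
          refine ENNReal.ofReal_le_ofReal ?_
          linarith
  have hlow : ENNReal.ofReal (N / 2) ≤ ∑ a, ∫⁻ z, ENNReal.ofReal (l a z * f a z) ∂γ := by
    calc ENNReal.ofReal (N / 2) = ∑ _a : ι, ENNReal.ofReal (1 / 2) := by
          rw [Finset.sum_const, nsmul_eq_mul, Finset.card_univ, ← ENNReal.ofReal_natCast,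
            ← ENNReal.ofReal_mul (by positivity)]
          congr 1
          ring
      _ ≤ _ := Finset.sum_le_sum fun a _ => (hhalf a).trans (hshift a).le
  have h1 := hlow.trans hup
  rw [ENNReal.ofReal_le_ofReal_iff (by positivity)] at h1
  linarith

theorem card_mul_le_of_agree {d q : ℕ} (hq : 1 ≤ q) (a : Fin d → Fin q)
    (S : Finset (Fin d → Fin q))
    (hS : ∀ b ∈ S, d < 16 * (Finset.univ.filter fun g => a g = b g).card) :
    (S.card : ℝ) * Real.exp (d / 16 * Real.log q) ≤ (2 * q) ^ d := by
  have hq0 : (1 : ℝ) ≤ q := by exact_mod_cast hq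
  have hlq : 0 ≤ Real.log q := Real.log_nonneg hq0
  have h1 : ∀ b : Fin d → Fin q, (∏ g, if a g = b g then (q : ℝ) else 1) =
      (q : ℝ) ^ (Finset.univ.filter fun g => a g = b g).card := by
    intro b
    rw [Finset.prod_ite]
    simp
  have h2 : ∑ b : Fin d → Fin q, (∏ g, if a g = b g then (q : ℝ) else 1) ≤ (2 * q) ^ d := by
    have h3 := Finset.prod_univ_sum (fun _ : Fin d => (Finset.univ : Finset (Fin q)))
      (fun g y => if a g = y then (q : ℝ) else 1)
    rw [Fintype.piFinset_univ] at h3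
    rw [← h3]
    calc _ ≤ ∏ _g : Fin d, (2 * (q : ℝ)) := by
          refine Finset.prod_le_prod (fun g _ => Finset.sum_nonneg fun y _ => ?_) fun g _ => ?_
          · split_ifs <;> positivity
          · calc _ ≤ ∑ y : Fin q, ((if a g = y then (q : ℝ) else 0) + 1) := by
                  refine Finset.sum_le_sum fun y _ => ?_
                  split_ifs <;> linarith
              _ = 2 * q := by
                  rw [Finset.sum_add_distrib]
                  simp
                  ring
      _ = _ := by simp
  have h4 : ∀ n : ℕ, (q : ℝ) ^ n = Real.exp (n * Real.log q) := by
    intro n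
    rw [Real.exp_nat_mul, Real.exp_log (lt_of_lt_of_le one_pos hq0)]
  have h5 : ∀ b ∈ S, Real.exp (d / 16 * Real.log q) ≤
      ∏ g, if a g = b g then (q : ℝ) else 1 := by
    intro b hb
    have h3 := hS b hb
    rw [h1, h4]
    generalize (Finset.univ.filter fun g => a g = b g).card = n at h3 ⊢
    have h6 : (d : ℝ) ≤ 16 * n := by exact_mod_cast h3.le
    gcongr
    linarith
  have h7 : S.card • Real.exp (d / 16 * Real.log q) ≤
      ∑ b ∈ S, ∏ g, if a g = b g then (q : ℝ) else 1 := Finset.card_nsmul_le_sum _ _ _ h5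
  have h8 : ∑ b ∈ S, (∏ g, if a g = b g then (q : ℝ) else 1) ≤
      ∑ b : Fin d → Fin q, ∏ g, if a g = b g then (q : ℝ) else 1 :=
    Finset.sum_le_univ_sum_of_nonneg fun b => by
      rw [h1]
      positivity
  rw [nsmul_eq_mul] at h7
  exact h7.trans (h8.trans h2)

/-- Lower bound on the risk over a family indexed by words, whose members are separated when the
words agree in few places. -/
theorem IsMatrixNorm.exists_le_risk_of_code (hn : IsMatrixNorm nrm) {d q : ℕ} (hd : 1 ≤ d)
    (hq : 2 ^ 128 ≤ q) {L : ℝ} (hL : 0 < L) (N : (Fin d → Fin q) → Matrix (Fin p) (Fin m) ℝ)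
    (hN : ∀ a, frobNorm (N a) = 1)
    (hsep : ∀ a b, 16 * (Finset.univ.filter fun g => a g = b g).card ≤ d →
      L / 4 ≤ nrm (N a - N b))
    {est : Matrix (Fin p) (Fin m) ℝ → Matrix (Fin p) (Fin m) ℝ} (hest : Measurable est) :
    ∃ (τ : ℝ) (a : Fin d → Fin q), ENNReal.ofReal (L ^ 2 * (d * Real.log q) / 4096) ≤
        ∫⁻ z, ENNReal.ofReal (nrm (est (τ • N a + z) - τ • N a) ^ 2) ∂(stdGaussianMatrix p m) := by
  have hq1 : 1 ≤ q := le_trans (by norm_num) hq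
  have hq0 : (0 : ℝ) < q := by exact_mod_cast hq1
  have hd0 : (1 : ℝ) ≤ d := by exact_mod_cast hd
  have hlog : 128 * Real.log 2 ≤ Real.log q := by
    have h1 : Real.log ((2 : ℝ) ^ 128) ≤ Real.log q :=
      Real.log_le_log (by norm_num) (by exact_mod_cast hq)
    rwa [Real.log_pow] at h1
  have hl2 : 0 < Real.log 2 := Real.log_pos (by norm_num)
  have hlq : 0 < Real.log q := by linarith
  set t : ℝ := d / 32 * Real.log q with ht
  have ht0 : 0 < t := by positivity
  set τ := Real.sqrt t with hτ
  have hτ0 : 0 < τ := Real.sqrt_pos.2 ht0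
  have hτ2 : τ ^ 2 = t := Real.sq_sqrt ht0.le
  have : Nonempty (Fin q) := ⟨⟨0, hq1⟩⟩
  have hball : ∀ (x : Matrix (Fin p) (Fin m) ℝ) (S : Finset (Fin d → Fin q)),
      (∀ a ∈ S, nrm (x - τ • N a) < τ * L / 8) →
        (S.card : ℝ) ≤ (2 * q) ^ d * Real.exp (-(d / 16 * Real.log q)) := by
    intro x S hS
    rcases S.eq_empty_or_nonempty with rfl | ⟨a, ha⟩
    · simp
      positivity
    · rw [Real.exp_neg, ← div_eq_mul_inv, le_div_iff₀ (Real.exp_pos _)]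
      refine card_mul_le_of_agree hq1 a S fun b hb => ?_
      by_contra! hab
      have h1 := hsep a b hab
      have h2 := hn.sub_le (x - τ • N b) (x - τ • N a)
      have e : x - τ • N b - (x - τ • N a) = τ • (N a - N b) := by
        rw [smul_sub]
        abel
      rw [e, hn.2.1, abs_of_pos hτ0] at h2
      have h3 := mul_le_mul_of_nonneg_left h1 hτ0.le
      have h4 := hS a ha
      have h5 := hS b hb
      linarith
  have hcard : (2 * (q : ℝ)) ^ d * Real.exp (-(d / 16 * Real.log q)) * Real.exp t ≤
      Fintype.card (Fin d → Fin q) / 8 := by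
    have e1 : (2 : ℝ) ^ d = Real.exp (d * Real.log 2) := by
      rw [Real.exp_nat_mul, Real.exp_log (by norm_num)]
    have e2 : (8 : ℝ)⁻¹ = Real.exp (-(3 * Real.log 2)) := by
      rw [Real.exp_neg, show (3 : ℝ) * Real.log 2 = (3 : ℕ) * Real.log 2 by norm_num,
        Real.exp_nat_mul, Real.exp_log (by norm_num)]
      norm_num
    rw [Fintype.card_fun, Fintype.card_fin, Fintype.card_fin, Nat.cast_pow, div_eq_mul_inv _ (8 : ℝ),
      e2, mul_pow, e1]
    calc _ = (q : ℝ) ^ d * Real.exp (d * Real.log 2 + -(d / 16 * Real.log q) + t) := by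
          rw [Real.exp_add, Real.exp_add]
          ring
      _ ≤ _ := by
          gcongr
          rw [ht]
          nlinarith
  obtain ⟨a, ha⟩ := hn.exists_le_risk_of_family (fun a => τ • N a) (t := t) (fun a => by
    rw [frobNorm_smul, hN, mul_one, sq_abs, hτ2]) (by positivity) hball hcard hest
  refine ⟨τ, a, le_trans (le_of_eq ?_) ha⟩
  congr 1
  rw [div_pow, mul_pow, hτ2, ht]
  ring

end FiniteFamily

section RowEqualization

variable {p m : ℕ} {nrm : Matrix (Fin p) (Fin m) ℝ → ℝ}

/-- Rotation by the angle `θ` in the plane spanned by two basis vectors. -/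
noncomputable def planeRotation (a b : Fin p) (θ : ℝ) : Matrix (Fin p) (Fin p) ℝ :=
  Matrix.of fun i => if i = a then Real.cos θ • Pi.single a 1 + Real.sin θ • Pi.single b 1
    else if i = b then -Real.sin θ • Pi.single a 1 + Real.cos θ • Pi.single b 1
    else Pi.single i 1

theorem planeRotation_row (a b : Fin p) (θ : ℝ) (i : Fin p) : planeRotation a b θ i =
    if i = a then Real.cos θ • Pi.single a 1 + Real.sin θ • Pi.single b 1
    else if i = b then -Real.sin θ • Pi.single a 1 + Real.cos θ • Pi.single b 1
    else Pi.single i 1 := rfl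

theorem planeRotation_mul_transpose {a b : Fin p} (hab : a ≠ b) (θ : ℝ) :
    planeRotation a b θ * (planeRotation a b θ)ᵀ = 1 := by
  ext i l
  change planeRotation a b θ i ⬝ᵥ planeRotation a b θ l = _
  rw [planeRotation_row, planeRotation_row, Matrix.one_apply]
  split_ifs <;> simp_all <;>
    first | grind | (have h1 := Real.sin_sq_add_cos_sq θ; grind)

theorem planeRotation_mul_apply (a b : Fin p) (θ : ℝ) (A : Matrix (Fin p) (Fin m) ℝ) (i : Fin p)
    (j : Fin m) : (planeRotation a b θ * A) i j =
      if i = a then Real.cos θ * A a j + Real.sin θ * A b j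
      else if i = b then -Real.sin θ * A a j + Real.cos θ * A b j else A i j := by
  change planeRotation a b θ i ⬝ᵥ (fun l => A l j) = _
  rw [planeRotation_row]
  split_ifs <;> simp [add_dotProduct]

/-- Two rows can be rotated so that one of them gets a prescribed intermediate length. -/
theorem IsUnitarilyInvariant.exists_rotate_rows (h : IsUnitarilyInvariant nrm)
    (A : Matrix (Fin p) (Fin m) ℝ) {a b : Fin p} (hab : a ≠ b) {c : ℝ}
    (ha : ∑ j, A a j ^ 2 ≤ c) (hb : c ≤ ∑ j, A b j ^ 2) :
    ∃ W : Matrix (Fin p) (Fin m) ℝ, nrm W = nrm A ∧ (∀ i, i ≠ a → i ≠ b → ∀ j, W i j = A i j) ∧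
      (∀ j, (∀ i, A i j = 0) → ∀ i, W i j = 0) ∧ ∑ j, W a j ^ 2 = c ∧
      ∑ j, W a j ^ 2 + ∑ j, W b j ^ 2 = ∑ j, A a j ^ 2 + ∑ j, A b j ^ 2 := by
  set f : ℝ → ℝ := fun θ => ∑ j, (Real.cos θ * A a j + Real.sin θ * A b j) ^ 2 with hf
  have hfc : Continuous f := by fun_prop
  have hf0 : f 0 = ∑ j, A a j ^ 2 := by simp [hf]
  have hf1 : f (Real.pi / 2) = ∑ j, A b j ^ 2 := by simp [hf]
  obtain ⟨θ, -, hθ⟩ := intermediate_value_Icc (by positivity : (0 : ℝ) ≤ Real.pi / 2)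
    hfc.continuousOn (show c ∈ Set.Icc (f 0) (f (Real.pi / 2)) by rw [hf0, hf1]; exact ⟨ha, hb⟩)
  refine ⟨planeRotation a b θ * A, ?_, ?_, ?_, ?_, ?_⟩
  · simpa using h (planeRotation a b θ) 1 A (planeRotation_mul_transpose hab θ) (by simp)
  · intro i hia hib j
    simp [planeRotation_mul_apply, hia, hib]
  · intro j hj i
    simp [planeRotation_mul_apply, hj]
  · simpa [planeRotation_mul_apply] using hθ
  · simp only [planeRotation_mul_apply, if_true, if_neg hab.symm]
    rw [← Finset.sum_add_distrib, ← Finset.sum_add_distrib]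
    refine Finset.sum_congr rfl fun j _ => ?_
    linear_combination (A a j ^ 2 + A b j ^ 2) * Real.sin_sq_add_cos_sq θ

/-- The rows indexed by `I` can be given equal lengths by an orthogonal transformation. -/
theorem IsUnitarilyInvariant.exists_equal_rows (h : IsUnitarilyInvariant nrm)
    (I : Finset (Fin p)) (c : ℝ) (n : ℕ) (A : Matrix (Fin p) (Fin m) ℝ)
    (hA : (I.filter fun i => ∑ j, A i j ^ 2 ≠ c).card ≤ n)
    (hc : ∑ i ∈ I, ∑ j, A i j ^ 2 = I.card * c) :
    ∃ W : Matrix (Fin p) (Fin m) ℝ, nrm W = nrm A ∧ (∀ i, i ∉ I → ∀ j, W i j = A i j) ∧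
      (∀ j, (∀ i, A i j = 0) → ∀ i, W i j = 0) ∧ ∀ i ∈ I, ∑ j, W i j ^ 2 = c := by
  induction n generalizing A with
  | zero =>
    refine ⟨A, rfl, fun _ _ _ => rfl, fun j hj => hj, fun i hi => ?_⟩
    by_contra hne
    have : i ∈ I.filter fun i => ∑ j, A i j ^ 2 ≠ c := Finset.mem_filter.2 ⟨hi, hne⟩
    have := Finset.card_pos.2 ⟨i, this⟩
    omega
  | succ n ih =>
    by_cases hall : ∀ i ∈ I, ∑ j, A i j ^ 2 = c
    · exact ⟨A, rfl, fun _ _ _ => rfl, fun j hj => hj, hall⟩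
    have hsum : ∑ i ∈ I, ∑ j, A i j ^ 2 = ∑ i ∈ I, c := by simpa using hc
    have hlt : ∃ a ∈ I, ∑ j, A a j ^ 2 < c := by
      by_contra! hcon
      exact hall fun i hi => ((Finset.sum_eq_sum_iff_of_le hcon).1 hsum.symm i hi).symm
    have hgt : ∃ b ∈ I, c < ∑ j, A b j ^ 2 := by
      by_contra! hcon
      exact hall fun i hi => (Finset.sum_eq_sum_iff_of_le hcon).1 hsum i hi
    obtain ⟨a, haI, ha⟩ := hlt
    obtain ⟨b, hbI, hb⟩ := hgt
    have hab : a ≠ b := by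
      rintro rfl
      exact lt_asymm ha hb
    obtain ⟨B, hBn, hBo, hBc, hBa, hBab⟩ := h.exists_rotate_rows A hab ha.le hb.le
    have hB1 : (I.filter fun i => ∑ j, B i j ^ 2 ≠ c).card ≤ n := by
      have hss : (I.filter fun i => ∑ j, B i j ^ 2 ≠ c) ⊆
          (I.filter fun i => ∑ j, A i j ^ 2 ≠ c).erase a := by
        intro i hi
        rw [Finset.mem_filter] at hi
        have hia : i ≠ a := by
          rintro rfl
          exact hi.2 hBa
        rw [Finset.mem_erase, Finset.mem_filter]
        refine ⟨hia, hi.1, ?_⟩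
        by_cases hib : i = b
        · rw [hib]
          exact hb.ne'
        · simpa [hBo i hia hib] using hi.2
      have h1 := Finset.card_le_card hss
      rw [Finset.card_erase_of_mem (Finset.mem_filter.2 ⟨haI, ha.ne⟩)] at h1
      omega
    have hB2 : ∑ i ∈ I, ∑ j, B i j ^ 2 = I.card * c := by
      rw [← hc, ← Finset.add_sum_erase I _ haI, ← Finset.add_sum_erase I _ haI,
        ← Finset.add_sum_erase (I.erase a) _ (Finset.mem_erase.2 ⟨hab.symm, hbI⟩),
        ← Finset.add_sum_erase (I.erase a) _ (Finset.mem_erase.2 ⟨hab.symm, hbI⟩),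
        ← add_assoc, ← add_assoc, hBab]
      congr 1
      refine Finset.sum_congr rfl fun i hi => ?_
      simp only [Finset.mem_erase] at hi
      simp [hBo i hi.2.1 hi.1]
    obtain ⟨W, hW1, hW2, hW3, hW4⟩ := ih B hB1 hB2
    refine ⟨W, hW1.trans hBn, fun i hi j => ?_, fun j hj => hW3 j (hBc j hj), hW4⟩
    rw [hW2 i hi, hBo i (fun e => hi (e ▸ haI)) (fun e => hi (e ▸ hbI))]

end RowEqualization

section RowCode

variable {p m : ℕ} {nrm : Matrix (Fin p) (Fin m) ℝ → ℝ}

theorem frobNorm_restr_sq (I : Finset (Fin p)) (A : Matrix (Fin p) (Fin m) ℝ) :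
    frobNorm (restr I Finset.univ A) ^ 2 = ∑ i ∈ I, ∑ j, A i j ^ 2 := by
  rw [frobNorm_sq, ← Finset.sum_subset (Finset.subset_univ I)]
  · exact Finset.sum_congr rfl fun i hi => by simp [restr, hi]
  · intro i _ hi
    simp [restr, hi]

/-- A normalized sparse matrix has a copy with equally long rows. -/
theorem IsUnitarilyInvariant.exists_flat_rows (h : IsUnitarilyInvariant nrm) {k s : ℕ}
    (hk1 : 1 ≤ k) (hk : k ≤ p) (hs : s ≤ m) {A : Matrix (Fin p) (Fin m) ℝ}
    (hA : A ∈ SubmatrixSparse p m k s) (hAf : frobNorm A = 1) :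
    ∃ (I : Finset (Fin p)) (J : Finset (Fin m)) (W : Matrix (Fin p) (Fin m) ℝ), I.card = k ∧
      J.card = s ∧ restr I J W = W ∧ nrm W = nrm A ∧ ∀ i ∈ I, ∑ j, W i j ^ 2 = 1 / k := by
  have hk0 : (0 : ℝ) < k := by exact_mod_cast hk1
  obtain ⟨I, J, hI, hJ, hIJ⟩ := exists_restr_eq_of_mem_submatrixSparse hk hs hA
  have h0 : ∀ i j, ¬ (i ∈ I ∧ j ∈ J) → A i j = 0 := fun i j hij => by
    rw [← hIJ]
    simp only [restr, Matrix.of_apply, if_neg hij]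
  have hsum : ∑ i ∈ I, ∑ j, A i j ^ 2 = I.card * (1 / (k : ℝ)) := by
    rw [hI, mul_one_div_cancel hk0.ne', ← frobNorm_restr_sq]
    have : restr I Finset.univ A = A := by
      ext i j
      by_cases hi : i ∈ I
      · simp [restr, hi]
      · simp [restr, hi, h0 i j fun hij => hi hij.1]
    rw [this, hAf, one_pow]
  obtain ⟨W, hW, hWI, hWJ, hWc⟩ := h.exists_equal_rows I (1 / (k : ℝ)) _ A le_rfl hsum
  refine ⟨I, J, W, hI, hJ, ?_, hW, hWc⟩
  ext i j
  by_cases hij : i ∈ I ∧ j ∈ J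
  · simp only [restr, Matrix.of_apply, if_pos hij]
  · simp only [restr, Matrix.of_apply, if_neg hij]
    by_cases hi : i ∈ I
    · exact (hWJ j (fun l => h0 l j fun hl => hij ⟨hi, hl.2⟩) i).symm
    · rw [hWI i hi j, h0 i j hij]

/-- A family of normalized sparse matrices indexed by a code, obtained by permuting the rows of a
nearly extremal matrix with equally long rows. -/
theorem IsUnitarilyInvariant.exists_row_code (h : IsUnitarilyInvariant nrm)
    (hn : IsMatrixNorm nrm) {k s q : ℕ} (hk1 : 1 ≤ k) (hk : k ≤ p) (hs : s ≤ m)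
    (hq : k * q ≤ p) {L : ℝ} (hL : 0 < L)
    (hLA : ∀ A ∈ SubmatrixSparse p m k s, nrm A ≤ L * frobNorm A)
    {A : Matrix (Fin p) (Fin m) ℝ} (hA : A ∈ SubmatrixSparse p m k s) (hAf : frobNorm A = 1)
    (hAL : L / 2 ≤ nrm A) :
    ∃ N : (Fin k → Fin q) → Matrix (Fin p) (Fin m) ℝ,
      (∀ a, N a ∈ SubmatrixSparse p m k s) ∧ (∀ a, frobNorm (N a) = 1) ∧
      ∀ a b, 16 * (Finset.univ.filter fun g => a g = b g).card ≤ k → L / 4 ≤ nrm (N a - N b) := by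
  classical
  have hk0 : (0 : ℝ) < k := by exact_mod_cast hk1
  obtain ⟨I, J, W, hI, hJ, hIJ, hWA, hWc⟩ := h.exists_flat_rows hk1 hk hs hA hAf
  obtain ⟨e⟩ : Nonempty (Fin k × Fin q ↪ Fin p) :=
    Function.Embedding.nonempty_of_card_le (by simpa using hq)
  have einj : ∀ (g g' : Fin k) (y y' : Fin q), e (g, y) = e (g', y') → g = g' ∧ y = y' :=
    fun g g' y y' hg => by simpa using e.injective hg
  have hσ : ∀ a : Fin k → Fin q, ∃ σ : Equiv.Perm (Fin p),
      ∀ g, σ (e (g, a g)) = I.orderEmbOfFin hI g := fun a =>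
    Equiv.Perm.exists_extending_pair (fun g => e (g, a g)) (fun g => I.orderEmbOfFin hI g)
      (fun g g' hg => (einj _ _ _ _ hg).1) (I.orderEmbOfFin hI).injective
  choose σ hσ using hσ
  set S : (Fin k → Fin q) → Finset (Fin p) := fun a => Finset.univ.image fun g => e (g, a g)
    with hS
  set N : (Fin k → Fin q) → Matrix (Fin p) (Fin m) ℝ := fun a =>
    W.submatrix (σ a) (Equiv.refl (Fin m)) with hN
  have hScard : ∀ a, (S a).card = k := fun a => by
    rw [hS, Finset.card_image_of_injective _ fun g g' hg => (einj _ _ _ _ hg).1]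
    simp
  have hrow : ∀ a, ∀ x ∈ S a, ∑ j, N a x j ^ 2 = 1 / k := by
    intro a x hx
    obtain ⟨g, -, rfl⟩ := Finset.mem_image.1 hx
    simp only [hN, Matrix.submatrix_apply, hσ, Equiv.refl_apply]
    exact hWc _ (I.orderEmbOfFin_mem hI g)
  have hW0 : ∀ i j, ¬ (i ∈ I ∧ j ∈ J) → W i j = 0 := fun i j hij => by
    rw [← hIJ]
    simp only [restr, Matrix.of_apply, if_neg hij]
  have hSI : ∀ a x, σ a x ∈ I → x ∈ S a := by
    intro a x hx
    have : σ a x ∈ Set.range (I.orderEmbOfFin hI) := by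
      rw [Finset.range_orderEmbOfFin]
      exact hx
    obtain ⟨g, hg⟩ := this
    rw [← hσ a g] at hg
    exact Finset.mem_image.2 ⟨g, Finset.mem_univ _, (σ a).injective hg⟩
  have hNr : ∀ a T, restr T Finset.univ (N a) = restr (T ∩ S a) J (N a) := by
    intro a T
    ext x j
    simp only [restr, Matrix.of_apply, Finset.mem_inter, Finset.mem_univ, and_true]
    by_cases hT : x ∈ T
    · by_cases hx : x ∈ S a ∧ j ∈ J
      · simp [hT, hx]
      · have : W (σ a x) j = 0 := hW0 _ _ fun hc => hx ⟨hSI a x hc.1, hc.2⟩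
        simp [hT, hN, this]
    · simp [hT]
  have hNu : ∀ a, restr Finset.univ Finset.univ (N a) = N a := fun a => by
    ext x j
    simp [restr]
  have hNF : ∀ a T, restr T Finset.univ (N a) ∈ SubmatrixSparse p m k s := by
    intro a T
    rw [hNr]
    exact restr_mem_submatrixSparse
      ((Finset.card_le_card Finset.inter_subset_right).trans (hScard a).le) hJ.le _
  have hNS : ∀ a T, frobNorm (restr T Finset.univ (N a)) ^ 2 = (T ∩ S a).card / k := by
    intro a T
    have h1 : restr T Finset.univ (N a) = restr (T ∩ S a) Finset.univ (N a) := by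
      rw [hNr, hNr, Finset.inter_assoc, Finset.inter_self]
    rw [h1, frobNorm_restr_sq, Finset.sum_congr rfl fun x hx =>
      hrow a x (Finset.mem_inter.1 hx).2, Finset.sum_const, nsmul_eq_mul, mul_one_div]
  refine ⟨N, fun a => ?_, fun a => ?_, fun a b hab => ?_⟩
  · simpa only [hNu] using hNF a Finset.univ
  · have h1 := hNS a Finset.univ
    rw [hNu, Finset.univ_inter, hScard, div_self hk0.ne'] at h1
    exact (pow_eq_one_iff_of_nonneg (frobNorm_nonneg _) two_ne_zero).1 h1
  · have hcard : (S b ∩ S a).card ≤ (Finset.univ.filter fun g => a g = b g).card := by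
      refine (Finset.card_le_card (t := (Finset.univ.filter fun g => a g = b g).image
        fun g => e (g, a g)) fun x hx => ?_).trans Finset.card_image_le
      obtain ⟨hb, ha⟩ := Finset.mem_inter.1 hx
      obtain ⟨g, -, rfl⟩ := Finset.mem_image.1 ha
      obtain ⟨g', -, hg'⟩ := Finset.mem_image.1 hb
      obtain ⟨rfl, h2⟩ := einj _ _ _ _ hg'
      exact Finset.mem_image.2 ⟨_, Finset.mem_filter.2 ⟨Finset.mem_univ _, h2.symm⟩, rfl⟩
    have hfrob : frobNorm (restr (S b) Finset.univ (N a)) ≤ 1 / 4 := by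
      refine le_of_sq_le_sq ?_ (by norm_num)
      rw [hNS, div_le_iff₀ hk0]
      have h1 : 16 * ((S b ∩ S a).card : ℝ) ≤ k := by exact_mod_cast (by omega)
      linarith
    have hsplit : N a = restr (S b)ᶜ Finset.univ (N a - N b) + restr (S b) Finset.univ (N a) := by
      have h1 : restr (S b)ᶜ Finset.univ (N b) = 0 := by
        rw [hNr]
        ext x j
        simp [restr]
      rw [restr_sub, h1, sub_zero]
      ext x j
      by_cases hx : x ∈ S b <;> simp [restr, hx]
    have hNa : nrm (N a) = nrm W := h.nrm_submatrix W (σ a) (Equiv.refl _)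
    have h1 := hn.1 (restr (S b)ᶜ Finset.univ (N a - N b)) (restr (S b) Finset.univ (N a))
    rw [← hsplit, hNa, hWA] at h1
    have h2 := h.nrm_restr_le hn (S b)ᶜ Finset.univ (N a - N b)
    have h3 := hLA _ (hNF a (S b))
    have h4 := mul_le_mul_of_nonneg_left hfrob hL.le
    linarith

end RowCode

section LowerBound

variable {p m : ℕ} {nrm : Matrix (Fin p) (Fin m) ℝ → ℝ}

theorem log_exp_mul_div_le_two_mul_log {n k : ℕ} (hk1 : 1 ≤ k) (hk : k ≤ n)
    (hq : 2 ^ 128 ≤ n / k) : Real.log (Real.exp 1 * n / k) ≤ 2 * Real.log (n / k : ℕ) := by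
  have hk0 : (0 : ℝ) < k := by exact_mod_cast hk1
  have hn0 : (0 : ℝ) < n := by exact_mod_cast hk1.trans hk
  set q := n / k with hqdef
  have hq6 : (6 : ℝ) ≤ q := by
    have : 6 ≤ q := le_trans (by norm_num) hq
    exact_mod_cast this
  have hnq : (n : ℝ) ≤ k * (q + 1) := by
    have := (Nat.lt_mul_div_succ n (show 0 < k by omega)).le
    rw [← hqdef] at this
    exact_mod_cast this
  have he := Real.exp_one_lt_d9
  have he0 := Real.exp_pos 1
  have h2 : Real.exp 1 * n / k ≤ (q : ℝ) ^ 2 := by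
    rw [div_le_iff₀ hk0]
    have h3 : Real.exp 1 * n ≤ Real.exp 1 * (k * (q + 1)) := mul_le_mul_of_nonneg_left hnq he0.le
    have h4 : Real.exp 1 * (q + 1) ≤ (q : ℝ) ^ 2 := by nlinarith
    nlinarith
  calc Real.log (Real.exp 1 * n / k) ≤ Real.log ((q : ℝ) ^ 2) :=
        Real.log_le_log (by positivity) h2
    _ = 2 * Real.log q := by rw [Real.log_pow]; norm_num

theorem log_exp_mul_div_le_of_div_lt {n k : ℕ} (hk1 : 1 ≤ k) (hk : k ≤ n)
    (hq : n / k < 2 ^ 128) : Real.log (Real.exp 1 * n / k) ≤ 91 := by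
  have hk0 : (0 : ℝ) < k := by exact_mod_cast hk1
  have hn0 : (0 : ℝ) < n := by exact_mod_cast hk1.trans hk
  have h1 : (n : ℝ) / k ≤ 2 ^ 128 := by
    rw [div_le_iff₀ hk0]
    have := (Nat.div_lt_iff_lt_mul (show 0 < k by omega)).1 hq
    exact_mod_cast this.le
  have h2 := Real.log_le_log (by positivity) h1
  rw [Real.log_pow] at h2
  rw [mul_div_assoc, Real.log_mul (Real.exp_pos 1).ne' (by positivity), Real.log_exp]
  have := Real.log_two_lt_d9
  push_cast at h2
  linarith

theorem frobNorm_transpose (A : Matrix (Fin p) (Fin m) ℝ) : frobNorm Aᵀ = frobNorm A := by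
  simp only [frobNorm, Matrix.transpose_apply]
  rw [Finset.sum_comm]

theorem transpose_mem_submatrixSparse {k s : ℕ} {A : Matrix (Fin p) (Fin m) ℝ}
    (hA : A ∈ SubmatrixSparse p m k s) : Aᵀ ∈ SubmatrixSparse m p s k :=
  ⟨hA.2, hA.1⟩

theorem IsUnitarilyInvariant.exists_le_risk_of_rows (h : IsUnitarilyInvariant nrm)
    (hn : IsMatrixNorm nrm) {k s : ℕ} (hk1 : 1 ≤ k) (hk : k ≤ p) (hs1 : 1 ≤ s) (hs : s ≤ m)
    (hq : 2 ^ 128 ≤ p / k)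
    {est : Matrix (Fin p) (Fin m) ℝ → Matrix (Fin p) (Fin m) ℝ} (hest : Measurable est) :
    ∃ M ∈ SubmatrixSparse p m k s, ENNReal.ofReal
        (1 / 8192 * (sparseLip p m k s nrm ^ 2 * (k * Real.log (Real.exp 1 * p / k)))) ≤
      ∫⁻ z, ENNReal.ofReal (nrm (est (M + z) - M) ^ 2) ∂(stdGaussianMatrix p m) := by
  obtain ⟨hL, A, hA, hAf, hAL⟩ := h.exists_half_sparseLip_le hn hk1 hk hs1 hs
  obtain ⟨N, hNF, hNf, hsep⟩ := h.exists_row_code hn hk1 hk hs (Nat.mul_div_le p k) hL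
    (fun A hA => h.nrm_le_sparseLip_mul hn hk1 hk hs1 hs hA) hA hAf hAL
  obtain ⟨τ, a, hτ⟩ := hn.exists_le_risk_of_code hk1 hq hL N hNf hsep hest
  refine ⟨_, smul_mem_submatrixSparse τ (hNF a), le_trans (ENNReal.ofReal_le_ofReal ?_) hτ⟩
  have h1 := mul_le_mul_of_nonneg_left (log_exp_mul_div_le_two_mul_log hk1 hk hq)
    (show (0 : ℝ) ≤ sparseLip p m k s nrm ^ 2 * k by positivity)
  linarith

theorem IsUnitarilyInvariant.exists_le_risk_of_columns (h : IsUnitarilyInvariant nrm)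
    (hn : IsMatrixNorm nrm) {k s : ℕ} (hk1 : 1 ≤ k) (hk : k ≤ p) (hs1 : 1 ≤ s) (hs : s ≤ m)
    (hq : 2 ^ 128 ≤ m / s)
    {est : Matrix (Fin p) (Fin m) ℝ → Matrix (Fin p) (Fin m) ℝ} (hest : Measurable est) :
    ∃ M ∈ SubmatrixSparse p m k s, ENNReal.ofReal
        (1 / 8192 * (sparseLip p m k s nrm ^ 2 * (s * Real.log (Real.exp 1 * m / s)))) ≤
      ∫⁻ z, ENNReal.ofReal (nrm (est (M + z) - M) ^ 2) ∂(stdGaussianMatrix p m) := by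
  obtain ⟨hL, A, hA, hAf, hAL⟩ := h.exists_half_sparseLip_le hn hk1 hk hs1 hs
  obtain ⟨N, hNF, hNf, hsep⟩ := h.transpose.exists_row_code hn.transpose hs1 hs hk
    (Nat.mul_div_le m s) hL (fun B hB => by
      rw [← frobNorm_transpose]
      exact h.nrm_le_sparseLip_mul hn hk1 hk hs1 hs (transpose_mem_submatrixSparse hB))
    (transpose_mem_submatrixSparse hA) (by rw [frobNorm_transpose, hAf])
    (by rwa [Matrix.transpose_transpose])
  obtain ⟨τ, a, hτ⟩ := hn.exists_le_risk_of_code hs1 hq hL (fun a => (N a)ᵀ)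
    (fun a => by rw [frobNorm_transpose, hNf])
    (fun a b hab => by simpa only [Matrix.transpose_sub] using hsep a b hab) hest
  refine ⟨_, smul_mem_submatrixSparse τ (transpose_mem_submatrixSparse (hNF a)),
    le_trans (ENNReal.ofReal_le_ofReal ?_) hτ⟩
  have h1 := mul_le_mul_of_nonneg_left (log_exp_mul_div_le_two_mul_log hs1 hs hq)
    (show (0 : ℝ) ≤ sparseLip p m k s nrm ^ 2 * s by positivity)
  linarith

theorem IsUnitarilyInvariant.exists_le_risk (h : IsUnitarilyInvariant nrm)
    (hn : IsMatrixNorm nrm) {k s : ℕ} (hk1 : 1 ≤ k) (hk : k ≤ p) (hs1 : 1 ≤ s) (hs : s ≤ m)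
    {est : Matrix (Fin p) (Fin m) ℝ → Matrix (Fin p) (Fin m) ℝ} (hest : Measurable est) :
    ∃ M ∈ SubmatrixSparse p m k s,
      ENNReal.ofReal (1 / 300000 * (nrm (Imat p m (min k s)) ^ 2 * ((k : ℝ) + s) +
          sparseLip p m k s nrm ^ 2 * ((k : ℝ) * Real.log (Real.exp 1 * p / k) +
            (s : ℝ) * Real.log (Real.exp 1 * m / s)))) ≤
        ∫⁻ z, ENNReal.ofReal (nrm (est (M + z) - M) ^ 2) ∂(stdGaussianMatrix p m) := by
  have hL0 := (h.exists_half_sparseLip_le hn hk1 hk hs1 hs).1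
  have hLν := h.sparseLip_le hn hk1 hk hs1 hs
  obtain ⟨M₀, hM₀, h₀⟩ := h.exists_le_risk_of_block hn hk1 hk hs1 hs hest
  have hrow := fun hq => h.exists_le_risk_of_rows hn hk1 hk hs1 hs hq hest
  have hcol := fun hq => h.exists_le_risk_of_columns hn hk1 hk hs1 hs hq hest
  have hlk := one_le_log_exp_mul_div hk1 hk
  have hls := one_le_log_exp_mul_div hs1 hs
  have hpk := log_exp_mul_div_le_of_div_lt hk1 hk
  have hms := log_exp_mul_div_le_of_div_lt hs1 hs
  set ν := nrm (Imat p m (min k s))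
  set L := sparseLip p m k s nrm
  set x := Real.log (Real.exp 1 * p / k)
  set y := Real.log (Real.exp 1 * m / s)
  have hk0 : (0 : ℝ) ≤ k := k.cast_nonneg
  have hs0 : (0 : ℝ) ≤ s := s.cast_nonneg
  have hLν2 : L ^ 2 ≤ ν ^ 2 := pow_le_pow_left₀ hL0.le hLν 2
  have hsmall : ∀ n t : ℝ, 0 ≤ n → 0 ≤ t → t ≤ 91 → L ^ 2 * (n * t) ≤ 91 * (ν ^ 2 * n) := by
    intro n t hn0 ht0 ht
    have h1 : L ^ 2 * (n * t) ≤ ν ^ 2 * (n * 91) := by gcongr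
    linarith
  have ha : 0 ≤ ν ^ 2 * k := by positivity
  have ha' : 0 ≤ ν ^ 2 * s := by positivity
  have hb : 0 ≤ L ^ 2 * (k * x) := by positivity
  have hd : 0 ≤ L ^ 2 * (s * y) := by positivity
  by_cases hmax : L ^ 2 * (k * x) ≤ 91 * (ν ^ 2 * k + ν ^ 2 * s) ∧
      L ^ 2 * (s * y) ≤ 91 * (ν ^ 2 * k + ν ^ 2 * s)
  · refine ⟨M₀, hM₀, le_trans (ENNReal.ofReal_le_ofReal ?_) h₀⟩
    linarith [hmax.1, hmax.2]
  rcases le_total (L ^ 2 * (s * y)) (L ^ 2 * (k * x)) with hle | hle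
  · have hgt : 91 * (ν ^ 2 * k + ν ^ 2 * s) < L ^ 2 * (k * x) :=
      lt_of_not_ge fun hcon => hmax ⟨hcon, hle.trans hcon⟩
    obtain ⟨M, hM, hrisk⟩ := hrow <| le_of_not_gt fun hcon => by
      linarith [hsmall k x hk0 (by linarith) (hpk hcon)]
    refine ⟨M, hM, le_trans (ENNReal.ofReal_le_ofReal ?_) hrisk⟩
    linarith
  · have hgt : 91 * (ν ^ 2 * k + ν ^ 2 * s) < L ^ 2 * (s * y) :=
      lt_of_not_ge fun hcon => hmax ⟨hle.trans hcon, hcon⟩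
    obtain ⟨M, hM, hrisk⟩ := hcol <| le_of_not_gt fun hcon => by
      linarith [hsmall s y hs0 (by linarith) (hms hcon)]
    refine ⟨M, hM, le_trans (ENNReal.ofReal_le_ofReal ?_) hrisk⟩
    linarith

end LowerBound

/-- Minimax rate for Gaussian mean matrix estimation under submatrix
sparsity: there are universal constants `c, C > 0` such that for all
`1 ≤ k ≤ p`, `1 ≤ s ≤ m` and every unitarily invariant norm `‖·‖` on `ℝ^{p×m}`,
the minimax risk over `ℱ(k,s;p,m)` in the model `Y = M + Z` is, up to the constants
`c` and `C`, equal to `‖I_r‖²(k+s) + L²(k log(ep/k) + s log(em/s))`, `r = min(k,s)`. -/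
theorem submatrix_sparse_minimax :
    ∃ c C : ℝ, 0 < c ∧ 0 < C ∧
      ∀ (p m k s : ℕ), 1 ≤ k → k ≤ p → 1 ≤ s → s ≤ m →
        ∀ nrm : Matrix (Fin p) (Fin m) ℝ → ℝ,
          IsMatrixNorm nrm → IsUnitarilyInvariant nrm →
          -- minimax lower bound
          ((∀ est : Matrix (Fin p) (Fin m) ℝ → Matrix (Fin p) (Fin m) ℝ, Measurable est →
            ∃ M ∈ SubmatrixSparse p m k s,
              ENNReal.ofReal (c * (nrm (Imat p m (min k s)) ^ 2 * ((k : ℝ) + s) +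
                  sparseLip p m k s nrm ^ 2 *
                    ((k : ℝ) * Real.log (Real.exp 1 * p / k) +
                     (s : ℝ) * Real.log (Real.exp 1 * m / s))))
                ≤ ∫⁻ z, ENNReal.ofReal (nrm (est (M + z) - M) ^ 2) ∂(stdGaussianMatrix p m)) ∧
          -- minimax upper bound
          (∃ est : Matrix (Fin p) (Fin m) ℝ → Matrix (Fin p) (Fin m) ℝ, Measurable est ∧
            ∀ M ∈ SubmatrixSparse p m k s,
              (∫⁻ z, ENNReal.ofReal (nrm (est (M + z) - M) ^ 2) ∂(stdGaussianMatrix p m))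
                ≤ ENNReal.ofReal (C * (nrm (Imat p m (min k s)) ^ 2 * ((k : ℝ) + s) +
                    sparseLip p m k s nrm ^ 2 *
                      ((k : ℝ) * Real.log (Real.exp 1 * p / k) +
                       (s : ℝ) * Real.log (Real.exp 1 * m / s)))))) := by
  refine ⟨1 / 300000, 12114, by norm_num, by norm_num, ?_⟩
  intro p m k s hk1 hk hs1 hs nrm hn h
  exact ⟨fun est hest => h.exists_le_risk hn hk1 hk hs1 hs hest,
    h.exists_estimator hn hk1 hk hs1 hs⟩
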